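/- Let n ≥ 2, fix signs ε_1,…,ε_n ∈ {1,−1}, and let (q,r) be an admissible pair with q > 2 and r > 2. There is a constant C > 0 such that for every F ∈ 𝒮(ℝ×ℝⁿ) and every j ∈ ℤ, ‖∫_0^t W_±(t−s)P_j F(s)ds‖_{L^q_t L^r_x} ≤ C 2^{−j/2} sup_{e∈S^{n−1}} ‖P_j F‖_{L^{1,2}_e}. -/

import Mathlib

open MeasureTheory Complex Filter
open scoped FourierTransform RealInnerProductSpace ENNReal NNReal Topology

noncomputable section

namespace DNLS

/-- Euclidean space ℝⁿ. -/
abbrev Eucl (n : ℕ) := EuclideanSpace ℝ (Fin n)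

/-- The quadratic symbol `|ξ|²_± = Σ εᵢ ξᵢ²`. -/
def quadSym {n : ℕ} (ε : Fin n → ℝ) (ξ : Eucl n) : ℝ := ∑ i, ε i * (ξ i) ^ 2

/-- The signed vector `e_± = (ε₁e₁, …, εₙeₙ)`. -/
def epm {n : ℕ} (ε : Fin n → ℝ) (e : Eucl n) : Eucl n := WithLp.toLp 2 (fun i => ε i * e i)

/-- Fourier multiplier operator with symbol `m`. -/
def mulOp {n : ℕ} (m : Eucl n → ℂ) (f : Eucl n → ℂ) : Eucl n → ℂ :=
  𝓕⁻ (fun ξ => m ξ * 𝓕 f ξ)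

/-- The propagator `W_±(t)`, with `(W_±(t)φ)^(ξ) = e^{-it|ξ|²_±} φ̂(ξ)`. -/
def prop {n : ℕ} (ε : Fin n → ℝ) (t : ℝ) (φ : Eucl n → ℂ) : Eucl n → ℂ :=
  mulOp (fun ξ => Complex.exp (-Complex.I * t * quadSym ε ξ)) φ

/-- Fourier multiplier operator acting in the space variable of a space-time function. -/
def mulOpT {n : ℕ} (m : Eucl n → ℂ) (u : ℝ × Eucl n → ℂ) : ℝ × Eucl n → ℂ :=
  fun p => mulOp m (fun y => u (p.1, y)) p.2

/-- Hypotheses on the bump function χ : even, smooth, compactly supported in (-2,2),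
equal to one on [-1,1]. -/
structure IsBump (χ : ℝ → ℝ) : Prop where
  smooth : ∀ k : ℕ, ContDiff ℝ k χ
  even : ∀ s, χ (-s) = χ s
  supp : ∀ s, 2 ≤ |s| → χ s = 0
  one : ∀ s, |s| ≤ 1 → χ s = 1

/-- `ψ(s) = χ(|s|) - χ(2|s|)`. -/
def psiR (χ : ℝ → ℝ) (s : ℝ) : ℝ := χ |s| - χ (2 * |s|)

/-- `ψ_{≥k}(s) = Σ_{m ≥ k} ψ(2^{-m} s)`. -/
def psiGe (χ : ℝ → ℝ) (k : ℤ) (s : ℝ) : ℝ :=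
  ∑' m : ℤ, if k ≤ m then psiR χ ((2 : ℝ) ^ (-m) * s) else 0

/-- Littlewood–Paley projection `P_j`. -/
def proj {n : ℕ} (χ : ℝ → ℝ) (j : ℤ) (f : Eucl n → ℂ) : Eucl n → ℂ :=
  mulOp (fun ξ => (psiR χ ((2 : ℝ) ^ (-j) * ‖ξ‖) : ℂ)) f

/-- Low-frequency projection `P_{≤0} = I - Σ_{j≥1} P_j`. -/
def lowProj {n : ℕ} (χ : ℝ → ℝ) (f : Eucl n → ℂ) : Eucl n → ℂ :=
  mulOp (fun ξ => ((1 - psiGe χ 1 ‖ξ‖ : ℝ) : ℂ)) f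

/-- Directional frequency cutoff `Q^{e}_{j,l}` with symbol `ψ_{≥ j-l}(ξ·e)`. -/
def qproj {n : ℕ} (χ : ℝ → ℝ) (e : Eucl n) (j l : ℤ) (f : Eucl n → ℂ) : Eucl n → ℂ :=
  mulOp (fun ξ => ((psiGe χ (j - l) (inner ℝ ξ e : ℝ) : ℝ) : ℂ)) f

/-- `P_j` acting in the space variable of a space-time function. -/
def projT {n : ℕ} (χ : ℝ → ℝ) (j : ℤ) (u : ℝ × Eucl n → ℂ) : ℝ × Eucl n → ℂ :=
  fun p => proj χ j (fun y => u (p.1, y)) p.2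

/-- `P_{≤0}` acting in the space variable of a space-time function. -/
def lowProjT {n : ℕ} (χ : ℝ → ℝ) (u : ℝ × Eucl n → ℂ) : ℝ × Eucl n → ℂ :=
  fun p => lowProj χ (fun y => u (p.1, y)) p.2

/-- `Q^{e}_{j,l}` acting in the space variable of a space-time function. -/
def qprojT {n : ℕ} (χ : ℝ → ℝ) (e : Eucl n) (j l : ℤ) (u : ℝ × Eucl n → ℂ) :
    ℝ × Eucl n → ℂ :=
  fun p => qproj χ e j l (fun y => u (p.1, y)) p.2

/-- The hyperplane `P_e = {ξ : ξ·e = 0}`. -/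
def hyperplane {n : ℕ} (e : Eucl n) : Submodule ℝ (Eucl n) := (ℝ ∙ e)ᗮ

/-- Inner part of the anisotropic norm: the `L^q` norm over `P_e × ℝ` of
`(t,v) ↦ u(t, re + v)`. -/
def innerQ {n : ℕ} (q : ℝ≥0∞) (e : Eucl n) (u : ℝ × Eucl n → ℂ) (r : ℝ) : ℝ≥0∞ :=
  eLpNorm (fun tv : ℝ × (hyperplane e) => u (tv.1, r • e + (tv.2 : Eucl n))) q volume

/-- The anisotropic norm `‖u‖_{L^{p,q}_e}`. -/
def aniNorm {n : ℕ} (p q : ℝ≥0∞) (e : Eucl n) (u : ℝ × Eucl n → ℂ) : ℝ≥0∞ :=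
  if p = ∞ then essSup (innerQ q e u) volume
  else (∫⁻ r : ℝ, innerQ q e u r ^ p.toReal) ^ (1 / p.toReal)

/-- The mixed space-time norm `‖u‖_{L^q_t L^r_x}`. -/
def mixNorm {n : ℕ} (q r : ℝ≥0∞) (u : ℝ × Eucl n → ℂ) : ℝ≥0∞ :=
  if q = ∞ then essSup (fun t => eLpNorm (fun x => u (t, x)) r volume) volume
  else (∫⁻ t : ℝ, eLpNorm (fun x => u (t, x)) r volume ^ q.toReal) ^ (1 / q.toReal)

/-- `2^a` as an extended nonnegative real. -/
def tp (a : ℝ) : ℝ≥0∞ := ENNReal.ofReal ((2 : ℝ) ^ a)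

/-- Homogeneous Besov norm `‖φ‖_{Ḃ^s_{2,1}}`. -/
def homBesov {n : ℕ} (χ : ℝ → ℝ) (s : ℝ) (φ : Eucl n → ℂ) : ℝ≥0∞ :=
  ∑' j : ℤ, tp (s * j) * eLpNorm (proj χ j φ) 2 volume

/-- Inhomogeneous Besov norm `‖φ‖_{B^s_{2,1}}`. -/
def besov {n : ℕ} (χ : ℝ → ℝ) (s : ℝ) (φ : Eucl n → ℂ) : ℝ≥0∞ :=
  eLpNorm (lowProj χ φ) 2 volume
    + ∑' j : ℕ, tp (s * (j + 1)) * eLpNorm (proj χ (j + 1) φ) 2 volume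

/-- The supremum over unit vectors, auxiliary notation. -/
def sphSup {n : ℕ} (g : Eucl n → ℝ≥0∞) : ℝ≥0∞ := ⨆ (e : Eucl n) (_ : ‖e‖ = 1), g e

/-- `‖P_j u‖_{M^m_j} = 2^{-(n/2-1/(m-1))j} sup_e ‖P_j u‖_{L^{m-1,∞}_e}`. -/
def MmJ {n : ℕ} (χ : ℝ → ℝ) (m : ℕ) (j : ℤ) (u : ℝ × Eucl n → ℂ) : ℝ≥0∞ :=
  tp (-((n : ℝ) / 2 - 1 / ((m : ℝ) - 1)) * j)
    * sphSup (fun e => aniNorm ((m : ℝ≥0∞) - 1) ∞ e (projT χ j u))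

/-- `‖P_j u‖_{S_j} = 2^{j/2} sup_e ‖P_j Q^{e_±}_{j,20} u‖_{L^{∞,2}_e}`. -/
def SJ {n : ℕ} (ε : Fin n → ℝ) (χ : ℝ → ℝ) (j : ℤ) (u : ℝ × Eucl n → ℂ) : ℝ≥0∞ :=
  tp ((j : ℝ) / 2)
    * sphSup (fun e => aniNorm ∞ 2 e (projT χ j (qprojT χ (epm ε e) j 20 u)))

/-- `‖P_j u‖_{T_j} = ‖P_j u‖_{L^∞_t L²_x}`. -/
def TJ {n : ℕ} (χ : ℝ → ℝ) (j : ℤ) (u : ℝ × Eucl n → ℂ) : ℝ≥0∞ :=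
  mixNorm ∞ 2 (projT χ j u)

/-- `‖P_j u‖_{Y^m_j}`. -/
def YmJ {n : ℕ} (ε : Fin n → ℝ) (χ : ℝ → ℝ) (m : ℕ) (j : ℤ) (u : ℝ × Eucl n → ℂ) : ℝ≥0∞ :=
  MmJ χ m j u + SJ ε χ j u + TJ χ j u

/-- The homogeneous resolution norm `‖u‖_{Ż^σ_{2,1}}`. -/
def Zhom {n : ℕ} (ε : Fin n → ℝ) (χ : ℝ → ℝ) (m : ℕ) (σ : ℝ) (u : ℝ × Eucl n → ℂ) : ℝ≥0∞ :=
  ∑' j : ℤ, tp (σ * j) * YmJ ε χ m j u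

/-- `N_j`-norm of a function: `2^{-j/2} sup_e ‖f‖_{L^{1,2}_e}`. -/
def NJraw {n : ℕ} (j : ℤ) (f : ℝ × Eucl n → ℂ) : ℝ≥0∞ :=
  tp (-(j : ℝ) / 2) * sphSup (fun e => aniNorm 1 2 e f)

/-- `‖P_j u‖_{N_j}`. -/
def NJ {n : ℕ} (χ : ℝ → ℝ) (j : ℤ) (u : ℝ × Eucl n → ℂ) : ℝ≥0∞ :=
  NJraw j (projT χ j u)

/-- The homogeneous nonlinear norm `‖F‖_{Ṅ^σ_{2,1}}`. -/
def Nhom {n : ℕ} (χ : ℝ → ℝ) (σ : ℝ) (F : ℝ × Eucl n → ℂ) : ℝ≥0∞ :=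
  ∑' j : ℤ, tp (σ * j) * NJ χ j F

/-- `‖P_j u‖_{T̃_j} = ‖P_j u‖_{L^∞_t L²_x} + ‖P_j u‖_{L^{2+4/n}_{t,x}}`. -/
def TtilJ {n : ℕ} (χ : ℝ → ℝ) (j : ℤ) (u : ℝ × Eucl n → ℂ) : ℝ≥0∞ :=
  mixNorm ∞ 2 (projT χ j u)
    + eLpNorm (projT χ j u) (ENNReal.ofReal (2 + 4 / (n : ℝ))) volume

/-- `‖P_j u‖_{M̃_j} = sup_{p ∈ ℤ, p ≥ 2, np ≥ 6} sup_e 2^{(n/2-1/p)j}‖P_j u‖_{L^{p,∞}_e}`. -/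
def MtilJ {n : ℕ} (χ : ℝ → ℝ) (j : ℤ) (u : ℝ × Eucl n → ℂ) : ℝ≥0∞ :=
  ⨆ (p : ℕ) (_ : 2 ≤ p ∧ 6 ≤ n * p),
    sphSup (fun e => tp (((n : ℝ) / 2 - 1 / (p : ℝ)) * j) * aniNorm (p : ℝ≥0∞) ∞ e (projT χ j u))

/-- `‖P_j u‖_{Ỹ_j}`. -/
def YtilJ {n : ℕ} (ε : Fin n → ℝ) (χ : ℝ → ℝ) (j : ℤ) (u : ℝ × Eucl n → ℂ) : ℝ≥0∞ :=
  MtilJ χ j u + SJ ε χ j u + TtilJ χ j u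

/-- The inhomogeneous resolution norm `‖u‖_{Z̃^σ_{2,1}}`. -/
def Ztil {n : ℕ} (ε : Fin n → ℝ) (χ : ℝ → ℝ) (σ : ℝ) (u : ℝ × Eucl n → ℂ) : ℝ≥0∞ :=
  (∑' j : ℤ, if j ≤ 0 then YtilJ ε χ j u ^ 2 else 0) ^ ((1 : ℝ) / 2)
    + ∑' j : ℤ, if 1 ≤ j then tp (σ * j) * YtilJ ε χ j u else 0

/-- `‖f‖_{Ñ_j}`: infimum over decompositions `f = v + w`. -/
def NtilJraw {n : ℕ} (j : ℤ) (f : ℝ × Eucl n → ℂ) : ℝ≥0∞ :=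
  ⨅ (vw : (ℝ × Eucl n → ℂ) × (ℝ × Eucl n → ℂ)) (_ : f = vw.1 + vw.2),
    NJraw j vw.1 + eLpNorm vw.2 (ENNReal.ofReal ((2 * (n : ℝ) + 4) / ((n : ℝ) + 4))) volume

/-- The inhomogeneous nonlinear norm `‖F‖_{Ñ^σ_{2,1}}`. -/
def Ntil {n : ℕ} (χ : ℝ → ℝ) (σ : ℝ) (F : ℝ × Eucl n → ℂ) : ℝ≥0∞ :=
  (∑' j : ℤ, if j ≤ 0 then NtilJraw j (projT χ j F) ^ 2 else 0) ^ ((1 : ℝ) / 2)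
    + ∑' j : ℤ, if 1 ≤ j then tp (σ * j) * NtilJraw j (projT χ j F) else 0

/-- `k`-th spatial partial derivative of a space-time function. -/
def pd {n : ℕ} (k : ℕ) (u : ℝ × Eucl n → ℂ) (p : ℝ × Eucl n) : ℂ :=
  if h : k < n then fderiv ℝ (fun y => u (p.1, y)) p.2 (EuclideanSpace.single ⟨k, h⟩ (1 : ℝ))
  else 0

/-- The retarded Duhamel integral `∫_0^t W_±(t-s) G(s) ds`. -/
def duhamel {n : ℕ} (ε : Fin n → ℝ) (G : ℝ × Eucl n → ℂ) (p : ℝ × Eucl n) : ℂ :=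
  ∫ s in (0 : ℝ)..p.1, prop ε (p.1 - s) (fun y => G (s, y)) p.2

/-- Admissible Strichartz pair: `2/q = n(1/2 - 1/r)`, `q, r ≥ 2`, and `q ≠ 2` when `n = 2`. -/
def Admissible (n : ℕ) (q r : ℝ) : Prop :=
  2 / q = (n : ℝ) * (1 / 2 - 1 / r) ∧ 2 ≤ q ∧ 2 ≤ r ∧ (n = 2 → q ≠ 2)

/-- Value of a power series with coefficients `c` at `z`. -/
def polyVal {d : ℕ} (c : (Fin d →₀ ℕ) → ℂ) (z : Fin d → ℂ) : ℂ :=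
  ∑' β : Fin d →₀ ℕ, c β * ∏ i, z i ^ β i

/-- The argument vector `(u, ū, ∇u, ∇ū)` of the general nonlinearity. -/
def nlArg {n : ℕ} (u : ℝ × Eucl n → ℂ) (p : ℝ × Eucl n) (i : Fin (2 * n + 2)) : ℂ :=
  if (i : ℕ) = 0 then u p
  else if (i : ℕ) = 1 then starRingEnd ℂ (u p)
  else if (i : ℕ) < n + 2 then pd ((i : ℕ) - 2) u p
  else pd ((i : ℕ) - (n + 2)) (fun q => starRingEnd ℂ (u q)) p

/-- The argument vector `(∇u, ∇ū)` of a nonlinearity in `2n` variables. -/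
def gradArg {n : ℕ} (u : ℝ × Eucl n → ℂ) (p : ℝ × Eucl n) (i : Fin (2 * n)) : ℂ :=
  if (i : ℕ) < n then pd (i : ℕ) u p
  else pd ((i : ℕ) - n) (fun q => starRingEnd ℂ (u q)) p

end DNLS
open DNLS

namespace DNLS

/-! ### Integral inequalities -/

/-- Minkowski's integral inequality. -/
theorem lintegral_Lp_lintegral_le {α β : Type*} [MeasurableSpace α] [MeasurableSpace β]
    {μ : Measure α} {ν : Measure β} [SFinite μ] [SigmaFinite ν] {f : α → β → ℝ≥0∞}
    (hf : Measurable (Function.uncurry f)) {p : ℝ} (hp : 1 < p) :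
    (∫⁻ b, (∫⁻ a, f a b ∂μ) ^ p ∂ν) ^ (1 / p) ≤ ∫⁻ a, (∫⁻ b, f a b ^ p ∂ν) ^ (1 / p) ∂μ := by
  have hp0 : 0 < p := by linarith
  have hpq := Real.HolderConjugate.conjExponent hp
  set q := p.conjExponent
  set S : β → ℝ≥0∞ := fun b => ∫⁻ a, f a b ∂μ with hS
  have hSm : Measurable S := Measurable.lintegral_prod_left' hf
  set R := ∫⁻ a, (∫⁻ b, f a b ^ p ∂ν) ^ (1 / p) ∂μ with hR
  let T : ℕ → β → ℝ≥0∞ := fun N => (spanningSets ν N).indicator (fun b => min (S b) N)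
  have hTm : ∀ N, Measurable (T N) := fun N =>
    (hSm.min measurable_const).indicator (measurableSet_spanningSets ν N)
  have hTS : ∀ N b, T N b ≤ S b := fun N b =>
    (Set.indicator_le_self _ _ b).trans (min_le_left _ _)
  have key : ∀ N, ∫⁻ b, T N b ^ p ∂ν ≤ R ^ p := by
    intro N
    set X := ∫⁻ b, T N b ^ p ∂ν with hX
    have hXfin : X ≠ ∞ := by
      have : X ≤ ∫⁻ b, (spanningSets ν N).indicator (fun _ => (N : ℝ≥0∞) ^ p) b ∂ν := by
        refine lintegral_mono fun b => ?_
        by_cases hb : b ∈ spanningSets ν N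
        · simp only [T, Set.indicator_of_mem hb]
          exact ENNReal.rpow_le_rpow (min_le_right _ _) hp0.le
        · simp [T, Set.indicator_of_notMem hb, hp0]
      refine ne_top_of_le_ne_top ?_ this
      rw [lintegral_indicator_const (measurableSet_spanningSets ν N)]
      exact ENNReal.mul_ne_top (ENNReal.rpow_ne_top_of_nonneg hp0.le (by simp))
        (measure_spanningSets_lt_top ν N).ne
    have h1 : X ≤ R * X ^ (1 / q) := by
      calc X ≤ ∫⁻ b, S b * T N b ^ (p - 1) ∂ν := by
            refine lintegral_mono fun b => ?_
            rcases eq_or_ne (T N b) 0 with h0 | h0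
            · simp [h0, hp0]
            calc T N b ^ p = T N b ^ (1 + (p - 1)) := by ring_nf
              _ = T N b * T N b ^ (p - 1) := by
                rw [ENNReal.rpow_add_of_nonneg _ _ (by norm_num) (by linarith), ENNReal.rpow_one]
              _ ≤ _ := by gcongr; exact hTS N b
        _ = ∫⁻ b, ∫⁻ a, f a b * T N b ^ (p - 1) ∂μ ∂ν := by
            refine lintegral_congr fun b => ?_
            exact (lintegral_mul_const _ (hf.comp measurable_prodMk_right)).symm
        _ = ∫⁻ a, ∫⁻ b, f a b * T N b ^ (p - 1) ∂ν ∂μ := by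
            rw [lintegral_lintegral_swap]
            refine Measurable.aemeasurable ?_
            exact (hf.comp measurable_swap).mul (((hTm N).comp measurable_fst).pow_const _)
        _ ≤ ∫⁻ a, (∫⁻ b, f a b ^ p ∂ν) ^ (1 / p) * X ^ (1 / q) ∂μ := by
            refine lintegral_mono fun a => ?_
            have := ENNReal.lintegral_mul_le_Lp_mul_Lq ν hpq
              (f := f a) (g := fun b => T N b ^ (p - 1))
              (hf.comp measurable_prodMk_left).aemeasurable ((hTm N).pow_const _).aemeasurable
            refine this.trans (le_of_eq ?_)
            congr 3
            ext b
            rw [← ENNReal.rpow_mul, hpq.sub_one_mul_conj]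
        _ = R * X ^ (1 / q) := by
            rw [lintegral_mul_const]
            exact (Measurable.lintegral_prod_right' (f := fun z => f z.1 z.2 ^ p)
              (hf.pow_const _)).pow_const _
    rcases eq_or_ne X 0 with h0 | h0
    · rw [h0]; exact zero_le
    have h2 : X ^ (1 / p) ≤ R := by
      have h3 : X ^ (1 / p) * X ^ (1 / q) ≤ R * X ^ (1 / q) := by
        rw [← ENNReal.rpow_add _ _ h0 hXfin, one_div, one_div, hpq.inv_add_inv_eq_one,
          ENNReal.rpow_one, ← one_div]
        exact h1
      rwa [ENNReal.mul_le_mul_iff_left] at h3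
      · simp [h0, hXfin]
      · exact ENNReal.rpow_ne_top_of_nonneg (by have := hpq.symm.pos; positivity) hXfin
    calc X = (X ^ (1 / p)) ^ p := by
          rw [← ENNReal.rpow_mul, one_div_mul_cancel hp0.ne', ENNReal.rpow_one]
      _ ≤ _ := ENNReal.rpow_le_rpow h2 hp0.le
  have hmono : Monotone T := by
    intro M N hMN b
    simp only [T]
    by_cases hb : b ∈ spanningSets ν M
    · rw [Set.indicator_of_mem hb, Set.indicator_of_mem (monotone_spanningSets ν hMN hb)]
      exact min_le_min le_rfl (by exact_mod_cast hMN)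
    · rw [Set.indicator_of_notMem hb]; exact zero_le
  have hsup : ∀ b, S b ^ p ≤ ⨆ N, T N b ^ p := by
    intro b
    obtain ⟨N0, hN0⟩ : ∃ N, b ∈ spanningSets ν N := by
      have := iUnion_spanningSets ν
      exact Set.mem_iUnion.1 (by rw [this]; trivial)
    have h4 : Tendsto (fun N : ℕ => (min (S b) (N : ℝ≥0∞)) ^ p) atTop (𝓝 (S b ^ p)) := by
      refine (ENNReal.continuous_rpow_const.tendsto _).comp ?_
      have := (tendsto_const_nhds (x := S b)).min ENNReal.tendsto_nat_nhds_top
      simpa using this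
    refine le_of_tendsto h4 ?_
    filter_upwards [eventually_ge_atTop N0] with N hN
    refine le_trans (le_of_eq ?_) (le_iSup (fun N => T N b ^ p) N)
    simp only [T]
    rw [Set.indicator_of_mem (monotone_spanningSets ν hN hN0)]
  have hfin : ∫⁻ b, S b ^ p ∂ν ≤ R ^ p := by
    refine (lintegral_mono hsup).trans ?_
    rw [lintegral_iSup (fun N => (hTm N).pow_const _)
      (fun M N h b => ENNReal.rpow_le_rpow (hmono h b) hp0.le)]
    exact iSup_le key
  calc (∫⁻ b, S b ^ p ∂ν) ^ (1 / p) ≤ (R ^ p) ^ (1 / p) :=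
        ENNReal.rpow_le_rpow hfin (by positivity)
    _ = R := by rw [← ENNReal.rpow_mul, mul_one_div_cancel hp0.ne', ENNReal.rpow_one]

theorem lintegral_Ioc_rpow {a c : ℝ} (ha : -1 < a) (hc : 0 ≤ c) :
    ∫⁻ x in Set.Ioc 0 c, ENNReal.ofReal (x ^ a) = ENNReal.ofReal (c ^ (a + 1) / (a + 1)) := by
  have hi := (intervalIntegral.intervalIntegrable_rpow' (a := 0) (b := c) ha)
  rw [intervalIntegrable_iff_integrableOn_Ioc_of_le hc] at hi
  rw [← ofReal_integral_eq_lintegral_ofReal hi, ← intervalIntegral.integral_of_le hc,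
    integral_rpow (Or.inl ha), Real.zero_rpow (by linarith), sub_zero]
  filter_upwards [ae_restrict_mem measurableSet_Ioc] with x hx
  exact Real.rpow_nonneg hx.1.le _

theorem lintegral_Ioi_rpow {a c : ℝ} (ha : a < -1) (hc : 0 < c) :
    ∫⁻ x in Set.Ioi c, ENNReal.ofReal (x ^ a) = ENNReal.ofReal (-c ^ (a + 1) / (a + 1)) := by
  have hi := (integrableOn_Ioi_rpow_of_lt ha hc)
  rw [← ofReal_integral_eq_lintegral_ofReal hi, integral_Ioi_rpow_of_lt ha hc]
  filter_upwards [ae_restrict_mem measurableSet_Ioi] with x hx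
  exact Real.rpow_nonneg (hc.le.trans (le_of_lt hx)) _

theorem near_pairing_const (R : ℝ) (f : ℝ → ℝ≥0∞) :
    ∫⁻ t : ℝ, ∫⁻ s : ℝ, (if |t - s| < R then f t else 0)
      = ENNReal.ofReal (2 * R) * ∫⁻ t, f t := by
  have : ∀ t : ℝ, ∫⁻ s : ℝ, (if |t - s| < R then f t else 0) = f t * ENNReal.ofReal (2 * R) := by
    intro t
    have : (fun s : ℝ => if |t - s| < R then f t else 0)
        = (Metric.ball t R).indicator (fun _ => f t) := by
      ext s
      simp only [Set.indicator, Metric.mem_ball, Real.dist_eq, abs_sub_comm s t]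
    rw [this, lintegral_indicator_const measurableSet_ball, Real.volume_ball]
  simp_rw [this]
  rw [lintegral_mul_const' _ _ ENNReal.ofReal_ne_top, mul_comm]

theorem near_pairing_le {p : ℝ} (hp : 1 < p) (R : ℝ) {f b : ℝ → ℝ≥0∞} (hf : Measurable f)
    (hb : Measurable b) (h1 : ∫⁻ t, b t ^ p ≤ 1) :
    ∫⁻ t : ℝ, ∫⁻ s : ℝ, (if |t - s| < R then f t * b s else 0)
      ≤ ENNReal.ofReal (2 * R) ^ (1 - 1 / p) * ∫⁻ t, f t := by
  have hpq := Real.HolderConjugate.conjExponent hp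
  set q := p.conjExponent
  have hq : 1 / q = 1 - 1 / p := by
    have := hpq.inv_add_inv_eq_one
    rw [one_div, one_div]; linarith
  have : ∀ t : ℝ, ∫⁻ s : ℝ, (if |t - s| < R then f t * b s else 0)
      ≤ f t * ENNReal.ofReal (2 * R) ^ (1 - 1 / p) := by
    intro t
    have e : (fun s : ℝ => if |t - s| < R then f t * b s else 0)
        = fun s => f t * (b * (Metric.ball t R).indicator (fun _ => (1 : ℝ≥0∞))) s := by
      ext s
      simp only [Set.indicator, Metric.mem_ball, Real.dist_eq, abs_sub_comm s t, Pi.mul_apply]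
      split_ifs <;> simp
    have hm : Measurable ((Metric.ball t R).indicator (fun _ => (1 : ℝ≥0∞))) :=
      measurable_const.indicator measurableSet_ball
    rw [e, lintegral_const_mul _ (hb.mul hm)]
    gcongr
    refine (ENNReal.lintegral_mul_le_Lp_mul_Lq volume hpq hb.aemeasurable hm.aemeasurable).trans ?_
    have e2 : ∀ s, (Metric.ball t R).indicator (fun _ => (1 : ℝ≥0∞)) s ^ q
        = (Metric.ball t R).indicator (fun _ => (1 : ℝ≥0∞)) s := by
      intro s
      simp only [Set.indicator]
      split_ifs
      · simp
      · simp [hpq.symm.pos]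
    simp_rw [e2]
    rw [lintegral_indicator_const measurableSet_ball, Real.volume_ball, one_mul, hq]
    calc _ ≤ (1 : ℝ≥0∞) ^ (1 / p) * ENNReal.ofReal (2 * R) ^ (1 - 1 / p) := by gcongr
      _ = _ := by simp
  refine (lintegral_mono this).trans (le_of_eq ?_)
  rw [lintegral_mul_const _ hf, mul_comm]

theorem near_pairing_swap (R : ℝ) {f b : ℝ → ℝ≥0∞} (hf : Measurable f) (hb : Measurable b) :
    ∫⁻ t : ℝ, ∫⁻ s : ℝ, (if |t - s| < R then f s * b t else 0)
      = ∫⁻ t : ℝ, ∫⁻ s : ℝ, (if |t - s| < R then f t * b s else 0) := by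
  rw [lintegral_lintegral_swap]
  · simp_rw [abs_sub_comm]
  · refine Measurable.aemeasurable ?_
    refine Measurable.ite ?_ ((hf.comp measurable_snd).mul (hb.comp measurable_fst))
      measurable_const
    exact measurableSet_lt (measurable_fst.sub measurable_snd).abs measurable_const

/-- The truncated form of the Hardy–Littlewood–Sobolev pairing at scale `R`. -/
theorem near_pairing_self_le {p : ℝ} (hp : 1 < p) {R : ℝ} (γ : ℝ) {a : ℝ → ℝ}
    (ha : Measurable a) (h1 : ∫⁻ t, ENNReal.ofReal (a t) ^ p ≤ 1) :
    ∫⁻ t : ℝ, ∫⁻ s : ℝ,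
        (if |t - s| < R then ENNReal.ofReal (a t) * ENNReal.ofReal (a s) else 0)
      ≤ 2 * (ENNReal.ofReal (2 * R) *
            ∫⁻ t, (if a t ≤ γ then ENNReal.ofReal (a t) ^ (2 : ℝ) else 0))
        + 2 * (ENNReal.ofReal (2 * R) ^ (1 - 1 / p) *
            ∫⁻ t, (if a t ≤ γ then 0 else ENNReal.ofReal (a t))) := by
  set b : ℝ → ℝ≥0∞ := fun t => ENNReal.ofReal (a t) with hbdef
  have hb : Measurable b := ha.ennreal_ofReal
  set c : ℝ → ℝ≥0∞ := fun t => if a t ≤ γ then b t ^ (2 : ℝ) else 0 with hc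
  set d : ℝ → ℝ≥0∞ := fun t => if a t ≤ γ then 0 else b t with hd
  have hset : MeasurableSet {t | a t ≤ γ} := measurableSet_le ha measurable_const
  have hcm : Measurable c := Measurable.ite hset (hb.pow_const _) measurable_const
  have hdm : Measurable d := Measurable.ite hset measurable_const hb
  have hpt : ∀ t s, b t * b s ≤ c t + c s + (d t * b s + d s * b t) := by
    intro t s
    by_cases ht : a t ≤ γ
    · by_cases hs : a s ≤ γ
      · simp only [hc, hd, ht, hs, if_true]
        refine le_add_right ?_
        simp only [ENNReal.rpow_two]
        rcases le_total (b t) (b s) with h | h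
        · exact le_add_left (by rw [sq]; gcongr)
        · exact le_add_right (by rw [sq]; gcongr)
      · simp only [hd, hs, if_false]
        rw [mul_comm (b s)]
        exact le_add_left (le_add_left le_rfl)
    · simp only [hd, ht, if_false]
      exact le_add_left (le_add_right le_rfl)
  have hmeas : ∀ f : ℝ × ℝ → ℝ≥0∞, Measurable f →
      Measurable fun z : ℝ × ℝ => if |z.1 - z.2| < R then f z else 0 := fun f hf =>
    Measurable.ite (measurableSet_lt (measurable_fst.sub measurable_snd).abs measurable_const) hf
      measurable_const
  calc ∫⁻ t : ℝ, ∫⁻ s : ℝ, (if |t - s| < R then b t * b s else 0)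
      ≤ ∫⁻ t : ℝ, ∫⁻ s : ℝ, ((if |t - s| < R then c t else 0)
          + (if |t - s| < R then c s else 0) + ((if |t - s| < R then d t * b s else 0)
          + (if |t - s| < R then d s * b t else 0))) := by
        refine lintegral_mono fun t => lintegral_mono fun s => ?_
        dsimp only
        split_ifs
        · exact hpt t s
        · simp
    _ = (∫⁻ t : ℝ, ∫⁻ s : ℝ, (if |t - s| < R then c t else 0))
        + (∫⁻ t : ℝ, ∫⁻ s : ℝ, (if |t - s| < R then c s else 0))
        + ((∫⁻ t : ℝ, ∫⁻ s : ℝ, (if |t - s| < R then d t * b s else 0))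
        + (∫⁻ t : ℝ, ∫⁻ s : ℝ, (if |t - s| < R then d s * b t else 0))) := by
        have m1 := hmeas (fun z => c z.1) (hcm.comp measurable_fst)
        have m2 := hmeas (fun z => c z.2) (hcm.comp measurable_snd)
        have m3 := hmeas (fun z => d z.1 * b z.2)
          ((hdm.comp measurable_fst).mul (hb.comp measurable_snd))
        have m4 := hmeas (fun z => d z.2 * b z.1)
          ((hdm.comp measurable_snd).mul (hb.comp measurable_fst))
        have M1 : Measurable fun t => ∫⁻ s, if |t - s| < R then c t else 0 :=
          m1.lintegral_prod_right'
        have M2 : Measurable fun t => ∫⁻ s, if |t - s| < R then c s else 0 :=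
          m2.lintegral_prod_right'
        have M3 : Measurable fun t => ∫⁻ s, if |t - s| < R then d t * b s else 0 :=
          m3.lintegral_prod_right'
        rw [← lintegral_add_left M1, ← lintegral_add_left M3,
          ← lintegral_add_left (show Measurable fun t => (∫⁻ s, if |t - s| < R then c t else 0)
            + ∫⁻ s, if |t - s| < R then c s else 0 from M1.add M2)]
        refine lintegral_congr fun t => ?_
        have n1 := m1.comp (measurable_prodMk_left (x := t))
        have n2 := m2.comp (measurable_prodMk_left (x := t))
        have n3 := m3.comp (measurable_prodMk_left (x := t))
        simp only [Function.comp_def] at n1 n2 n3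
        rw [← lintegral_add_left n1, ← lintegral_add_left n3,
          ← lintegral_add_left (show Measurable fun s => (if |t - s| < R then c t else 0)
            + if |t - s| < R then c s else 0 from n1.add n2)]
    _ ≤ _ := by
        have s1 := near_pairing_swap R hcm (measurable_const (a := (1 : ℝ≥0∞)))
        have s2 := near_pairing_swap R hdm hb
        simp only [mul_one] at s1
        rw [s1, s2, near_pairing_const, ← two_mul, ← two_mul]
        gcongr
        exact near_pairing_le hp R hdm hb h1

theorem le_rpow_neg_inv_iff {p a R : ℝ} (hp : 0 < p) (ha : 0 < a) (hR : 0 < R) :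
    a ≤ R ^ (-(1 / p)) ↔ R ≤ a ^ (-p) := by
  have : R ^ (-(1 / p)) = (R⁻¹) ^ p⁻¹ := by
    rw [Real.inv_rpow hR.le, Real.rpow_neg hR.le, one_div]
  rw [this, Real.le_rpow_inv_iff_of_pos ha.le (by positivity) hp, Real.rpow_neg ha.le,
    le_inv_comm₀ (by positivity) hR]

theorem hls_normalized {p : ℝ} (hp : 1 < p) (hp2 : p < 2) {a : ℝ → ℝ} (ha0 : ∀ t, 0 ≤ a t)
    (ha : Measurable a) (h1 : ∫⁻ t, ENNReal.ofReal (a t) ^ p ≤ 1) :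
    ∫⁻ t : ℝ, ∫⁻ s : ℝ, ENNReal.ofReal (|t - s| ^ (-(2 - 2 / p)))
        * (ENNReal.ofReal (a t) * ENNReal.ofReal (a s))
      ≤ ENNReal.ofReal (2 - 2 / p) * (ENNReal.ofReal (4 / (2 / p - 1))
          + ENNReal.ofReal (4 / (1 - 1 / p))) := by
  have hp0 : 0 < p := by linarith
  set α := 2 - 2 / p with hα
  have i1 : 1 / p < 1 := by rw [div_lt_one hp0]; exact hp
  have i2 : 1 / 2 < 1 / p := one_div_lt_one_div_of_lt hp0 hp2
  have i3 : 2 / p = 2 * (1 / p) := by ring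
  have hα0 : 0 < α := by rw [hα, i3]; linarith
  have hα1 : α < 1 := by rw [hα, i3]; linarith
  have hker : ∀ u : ℝ, ENNReal.ofReal (|u| ^ (-α)) ≤ ENNReal.ofReal α *
      ∫⁻ R in Set.Ioi (0 : ℝ), (if |u| < R then ENNReal.ofReal (R ^ (-α - 1)) else 0) := by
    intro u
    rcases eq_or_ne u 0 with rfl | hu
    · simp [Real.zero_rpow (by linarith : -α ≠ 0)]
    have hu' : 0 < |u| := abs_pos.mpr hu
    have e : ∫⁻ R in Set.Ioi (0 : ℝ), (if |u| < R then ENNReal.ofReal (R ^ (-α - 1)) else 0)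
        = ∫⁻ R in Set.Ioi |u|, ENNReal.ofReal (R ^ (-α - 1)) := by
      rw [← lintegral_indicator measurableSet_Ioi, ← lintegral_indicator measurableSet_Ioi]
      refine lintegral_congr fun R => ?_
      simp only [Set.indicator, Set.mem_Ioi]
      by_cases h : |u| < R
      · simp [h, hu'.trans h]
      · simp [h]
    rw [e, lintegral_Ioi_rpow (by linarith) hu', ← ENNReal.ofReal_mul hα0.le]
    refine ENNReal.ofReal_le_ofReal (le_of_eq ?_)
    rw [sub_add_cancel]
    field_simp
  set b : ℝ → ℝ≥0∞ := fun t => ENNReal.ofReal (a t) with hb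
  have hbm : Measurable b := ha.ennreal_ofReal
  have hw : Measurable fun R : ℝ => ENNReal.ofReal (R ^ (-α - 1)) :=
    (measurable_id.pow_const _).ennreal_ofReal
  have hchange : ∫⁻ t : ℝ, ∫⁻ s : ℝ, ENNReal.ofReal (|t - s| ^ (-α)) * (b t * b s)
      ≤ ENNReal.ofReal α * ∫⁻ R in Set.Ioi (0 : ℝ), ENNReal.ofReal (R ^ (-α - 1)) *
        ∫⁻ t : ℝ, ∫⁻ s : ℝ, (if |t - s| < R then b t * b s else 0) := by
    have hF : Measurable fun y : (ℝ × ℝ) × ℝ => if |y.1.1 - y.1.2| < y.2 then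
        ENNReal.ofReal (y.2 ^ (-α - 1)) * (b y.1.1 * b y.1.2) else 0 := by
      refine Measurable.ite (measurableSet_lt (by fun_prop) (by fun_prop)) ?_ measurable_const
      exact (hw.comp measurable_snd).mul ((hbm.comp (measurable_fst.comp measurable_fst)).mul
        (hbm.comp (measurable_snd.comp measurable_fst)))
    have hFi : Measurable fun z : ℝ × ℝ => ∫⁻ R in Set.Ioi (0 : ℝ), (if |z.1 - z.2| < R then
        ENNReal.ofReal (R ^ (-α - 1)) * (b z.1 * b z.2) else 0) :=
      Measurable.lintegral_prod_right' (ν := volume.restrict (Set.Ioi 0)) hF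
    calc ∫⁻ t : ℝ, ∫⁻ s : ℝ, ENNReal.ofReal (|t - s| ^ (-α)) * (b t * b s)
        ≤ ∫⁻ t : ℝ, ∫⁻ s : ℝ, ENNReal.ofReal α * ∫⁻ R in Set.Ioi (0 : ℝ), (if |t - s| < R then
            ENNReal.ofReal (R ^ (-α - 1)) * (b t * b s) else 0) := by
          refine lintegral_mono fun t => lintegral_mono fun s => ?_
          refine (mul_le_mul_left (hker (t - s)) _).trans (le_of_eq ?_)
          rw [mul_assoc, ← lintegral_mul_const]
          · simp only [ite_mul, zero_mul]
          · exact Measurable.ite measurableSet_Ioi hw measurable_const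
      _ = ENNReal.ofReal α * ∫⁻ z : ℝ × ℝ, ∫⁻ R in Set.Ioi (0 : ℝ), (if |z.1 - z.2| < R then
            ENNReal.ofReal (R ^ (-α - 1)) * (b z.1 * b z.2) else 0) := by
          rw [Measure.volume_eq_prod, lintegral_prod _ hFi.aemeasurable,
            ← lintegral_const_mul' _ _ ENNReal.ofReal_ne_top]
          refine lintegral_congr fun t => ?_
          rw [← lintegral_const_mul' _ _ ENNReal.ofReal_ne_top]
      _ = ENNReal.ofReal α * ∫⁻ R in Set.Ioi (0 : ℝ), ENNReal.ofReal (R ^ (-α - 1)) *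
            ∫⁻ t : ℝ, ∫⁻ s : ℝ, (if |t - s| < R then b t * b s else 0) := by
          congr 1
          rw [lintegral_lintegral_swap hF.aemeasurable]
          refine lintegral_congr fun R => ?_
          have hFR := hF.comp (measurable_prodMk_right (y := R))
          simp only [Function.comp_def] at hFR
          rw [Measure.volume_eq_prod, lintegral_prod _ hFR.aemeasurable,
            ← lintegral_const_mul' _ _ ENNReal.ofReal_ne_top]
          refine lintegral_congr fun t => ?_
          rw [← lintegral_const_mul' _ _ ENNReal.ofReal_ne_top]
          simp only [mul_ite, mul_zero]
  refine hchange.trans ?_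
  gcongr
  calc ∫⁻ R in Set.Ioi (0 : ℝ), ENNReal.ofReal (R ^ (-α - 1)) *
        ∫⁻ t : ℝ, ∫⁻ s : ℝ, (if |t - s| < R then b t * b s else 0)
      ≤ ∫⁻ R in Set.Ioi (0 : ℝ),
          ((∫⁻ t, (if a t ≤ R ^ (-(1 / p)) then ENNReal.ofReal (4 * R ^ (-α)) * b t ^ (2 : ℝ)
            else 0))
          + ∫⁻ t, (if a t ≤ R ^ (-(1 / p)) then 0
              else ENNReal.ofReal (4 * R ^ (-α - 1 + (1 - 1 / p))) * b t)) := by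
        refine setLIntegral_mono' measurableSet_Ioi fun R (hR : 0 < R) => ?_
        refine (mul_le_mul_right (near_pairing_self_le hp (R ^ (-(1 / p))) ha h1) _).trans ?_
        rw [mul_add]
        refine add_le_add ?_ ?_
        · rw [← mul_assoc, ← mul_assoc, ← lintegral_const_mul' _ _ (by finiteness)]
          refine lintegral_mono fun t => ?_
          dsimp only
          split_ifs
          · refine mul_le_mul_left (le_of_eq ?_) _
            rw [show (2 : ℝ≥0∞) = ENNReal.ofReal 2 by simp, ← ENNReal.ofReal_mul (by positivity),
              ← ENNReal.ofReal_mul (by positivity)]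
            congr 1
            rw [Real.rpow_sub_one hR.ne']
            field_simp
            norm_num
          · simp
        · rw [← mul_assoc, ← mul_assoc, ← lintegral_const_mul' _ _
            (by rw [ENNReal.ofReal_rpow_of_pos (by positivity)]; finiteness)]
          refine lintegral_mono fun t => ?_
          dsimp only
          split_ifs
          · simp
          · refine mul_le_mul_left ?_ _
            rw [ENNReal.ofReal_rpow_of_pos (by positivity),
              show (2 : ℝ≥0∞) = ENNReal.ofReal 2 by simp, ← ENNReal.ofReal_mul (by positivity),
              ← ENNReal.ofReal_mul (by positivity)]
            refine ENNReal.ofReal_le_ofReal ?_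
            rw [Real.mul_rpow (by norm_num) hR.le, Real.rpow_add hR]
            have : (2 : ℝ) ^ (1 - 1 / p) ≤ 2 := by
              calc (2 : ℝ) ^ (1 - 1 / p) ≤ 2 ^ (1 : ℝ) :=
                    Real.rpow_le_rpow_of_exponent_le (by norm_num) (by linarith [i2])
                _ = 2 := by simp
            have h3 : 0 ≤ R ^ (-α - 1) * R ^ (1 - 1 / p) := by positivity
            nlinarith
    _ = (∫⁻ t, ∫⁻ R in Set.Ioi (0 : ℝ),
          (if a t ≤ R ^ (-(1 / p)) then ENNReal.ofReal (4 * R ^ (-α)) * b t ^ (2 : ℝ) else 0))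
        + ∫⁻ t, ∫⁻ R in Set.Ioi (0 : ℝ), (if a t ≤ R ^ (-(1 / p)) then 0
              else ENNReal.ofReal (4 * R ^ (-α - 1 + (1 - 1 / p))) * b t) := by
        have k : MeasurableSet {y : ℝ × ℝ | a y.2 ≤ y.1 ^ (-(1 / p))} :=
          measurableSet_le (ha.comp measurable_snd) (measurable_fst.pow_const _)
        have k1 : Measurable fun y : ℝ × ℝ => if a y.2 ≤ y.1 ^ (-(1 / p)) then
            ENNReal.ofReal (4 * y.1 ^ (-α)) * b y.2 ^ (2 : ℝ) else 0 :=
          Measurable.ite k (((measurable_fst.pow_const _).const_mul _).ennreal_ofReal.mul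
            ((hbm.comp measurable_snd).pow_const _)) measurable_const
        have k2 : Measurable fun y : ℝ × ℝ => if a y.2 ≤ y.1 ^ (-(1 / p)) then 0 else
            ENNReal.ofReal (4 * y.1 ^ (-α - 1 + (1 - 1 / p))) * b y.2 :=
          Measurable.ite k measurable_const
            (((measurable_fst.pow_const _).const_mul _).ennreal_ofReal.mul
              (hbm.comp measurable_snd))
        rw [lintegral_add_left]
        · exact congrArg₂ (· + ·) (lintegral_lintegral_swap k1.aemeasurable)
            (lintegral_lintegral_swap k2.aemeasurable)
        · exact k1.lintegral_prod_right'
    _ ≤ (∫⁻ t, ENNReal.ofReal (4 / (2 / p - 1)) * b t ^ p)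
        + ∫⁻ t, ENNReal.ofReal (4 / (1 - 1 / p)) * b t ^ p := by
        gcongr with t t
        · rcases (ha0 t).eq_or_lt with h0 | h0
          · simp [hb, ← h0]
          have e : ∀ R ∈ Set.Ioi (0 : ℝ), (if a t ≤ R ^ (-(1 / p)) then
              ENNReal.ofReal (4 * R ^ (-α)) * b t ^ (2 : ℝ) else 0)
              = (Set.Ioc 0 (a t ^ (-p))).indicator
                (fun R => 4 * ENNReal.ofReal (R ^ (-α)) * b t ^ (2 : ℝ)) R := by
            intro R (hR : 0 < R)
            simp only [le_rpow_neg_inv_iff hp0 h0 hR, Set.indicator, Set.mem_Ioc, hR, true_and]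
            rw [ENNReal.ofReal_mul (by norm_num)]
            simp
          rw [setLIntegral_congr_fun measurableSet_Ioi e, lintegral_indicator measurableSet_Ioc,
            Measure.restrict_restrict measurableSet_Ioc,
            Set.inter_eq_left.mpr Set.Ioc_subset_Ioi_self,
            lintegral_mul_const' _ _ (by finiteness), lintegral_const_mul' _ _ (by finiteness),
            lintegral_Ioc_rpow (by linarith) (by positivity),
            show (4 : ℝ≥0∞) = ENNReal.ofReal 4 by simp, hb]
          dsimp only
          rw [ENNReal.ofReal_rpow_of_pos h0, ENNReal.ofReal_rpow_of_pos h0,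
            ← ENNReal.ofReal_mul (by positivity), ← ENNReal.ofReal_mul,
            ← ENNReal.ofReal_mul]
          · refine ENNReal.ofReal_le_ofReal (le_of_eq ?_)
            have : a t ^ p = (a t ^ (-p)) ^ (-α + 1) * a t ^ (2 : ℝ) := by
              rw [← Real.rpow_mul h0.le, ← Real.rpow_add h0]
              congr 1
              rw [hα]; field_simp; ring
            rw [this, show -α + 1 = 2 / p - 1 by rw [hα]; ring]
            ring
          · exact div_nonneg (by norm_num) (by linarith)
          · refine mul_nonneg (by norm_num) (div_nonneg (by positivity) (by linarith))
        · rcases (ha0 t).eq_or_lt with h0 | h0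
          · simp [hb, ← h0]
          have e : ∀ R ∈ Set.Ioi (0 : ℝ), (if a t ≤ R ^ (-(1 / p)) then 0 else
              ENNReal.ofReal (4 * R ^ (-α - 1 + (1 - 1 / p))) * b t)
              = (Set.Ioi (a t ^ (-p))).indicator
                (fun R => 4 * ENNReal.ofReal (R ^ (-α - 1 + (1 - 1 / p))) * b t) R := by
            intro R (hR : 0 < R)
            simp only [le_rpow_neg_inv_iff hp0 h0 hR, Set.indicator, Set.mem_Ioi, ← not_le,
              ite_not]
            rw [ENNReal.ofReal_mul (by norm_num)]
            simp
          rw [setLIntegral_congr_fun measurableSet_Ioi e, lintegral_indicator measurableSet_Ioi,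
            Measure.restrict_restrict measurableSet_Ioi,
            Set.inter_eq_left.mpr (Set.Ioi_subset_Ioi (by positivity)),
            lintegral_mul_const' _ _ (by finiteness), lintegral_const_mul' _ _ (by finiteness),
            lintegral_Ioi_rpow (by linarith) (by positivity),
            show (4 : ℝ≥0∞) = ENNReal.ofReal 4 by simp, hb]
          dsimp only
          have e1 : -α - 1 + (1 - 1 / p) + 1 = -(1 - 1 / p) := by rw [hα]; ring
          rw [ENNReal.ofReal_rpow_of_pos h0,
            ← ENNReal.ofReal_mul (by positivity), ← ENNReal.ofReal_mul,
            ← ENNReal.ofReal_mul, e1]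
          · refine ENNReal.ofReal_le_ofReal (le_of_eq ?_)
            have : a t ^ p = (a t ^ (-p)) ^ (-(1 - 1 / p)) * a t := by
              rw [← Real.rpow_mul h0.le]
              nth_rw 3 [← Real.rpow_one (a t)]
              rw [← Real.rpow_add h0]
              congr 1
              field_simp; ring
            rw [this, neg_div_neg_eq]
            ring
          · exact div_nonneg (by norm_num) (by linarith)
          · rw [e1, neg_div_neg_eq]
            exact mul_nonneg (by norm_num) (div_nonneg (by positivity) (by linarith))
    _ ≤ ENNReal.ofReal (4 / (2 / p - 1)) + ENNReal.ofReal (4 / (1 - 1 / p)) := by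
        rw [lintegral_const_mul' _ _ ENNReal.ofReal_ne_top,
          lintegral_const_mul' _ _ ENNReal.ofReal_ne_top]
        exact add_le_add (mul_le_of_le_one_right' h1) (mul_le_of_le_one_right' h1)

/-- Hardy–Littlewood–Sobolev inequality on the line, in quadratic form. -/
theorem exists_hls_const {p : ℝ} (hp : 1 < p) (hp2 : p < 2) :
    ∃ C : ℝ≥0∞, C ≠ ∞ ∧ ∀ a : ℝ → ℝ, (∀ t, 0 ≤ a t) → Measurable a →
      ∫⁻ t : ℝ, ∫⁻ s : ℝ, ENNReal.ofReal (|t - s| ^ (-(2 - 2 / p)))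
        * (ENNReal.ofReal (a t) * ENNReal.ofReal (a s))
      ≤ C * (∫⁻ t, ENNReal.ofReal (a t) ^ p) ^ (2 / p) := by
  have hp0 : 0 < p := by linarith
  have i1 : 1 / p < 1 := by rw [div_lt_one hp0]; exact hp
  have i3 : 2 / p = 2 * (1 / p) := by ring
  refine ⟨ENNReal.ofReal (2 - 2 / p) * (ENNReal.ofReal (4 / (2 / p - 1))
          + ENNReal.ofReal (4 / (1 - 1 / p))), by finiteness, fun a ha0 ha => ?_⟩
  set C : ℝ≥0∞ := ENNReal.ofReal (2 - 2 / p) * (ENNReal.ofReal (4 / (2 / p - 1))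
          + ENNReal.ofReal (4 / (1 - 1 / p))) with hC
  have hC0 : C ≠ 0 := by
    refine mul_ne_zero ?_ ?_
    · rw [Ne, ENNReal.ofReal_eq_zero, not_le, i3]; linarith
    · refine (lt_of_lt_of_le ?_ le_add_self).ne'
      rw [ENNReal.ofReal_pos]
      exact div_pos (by norm_num) (by linarith)
  set I := ∫⁻ t, ENNReal.ofReal (a t) ^ p with hI
  rcases eq_or_ne I 0 with h0 | h0
  · have hae : ∀ᵐ t, ENNReal.ofReal (a t) = 0 := by
      have := (lintegral_eq_zero_iff (ha.ennreal_ofReal.pow_const p)).mp h0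
      filter_upwards [this] with t ht
      simpa [hp0, hp0.le] using ht
    refine (le_of_eq ?_).trans zero_le
    rw [lintegral_congr_ae (g := fun _ => 0), lintegral_zero]
    filter_upwards [hae] with t ht
    simp [ht]
  rcases eq_or_ne I ∞ with h1 | h1
  · rw [h1, ENNReal.top_rpow_of_pos (by positivity), ENNReal.mul_top hC0]
    exact le_top
  set N : ℝ := I.toReal ^ (1 / p) with hN
  have hIpos : 0 < I.toReal := ENNReal.toReal_pos h0 h1
  have hNpos : 0 < N := by positivity
  have hscale : ∀ t, ENNReal.ofReal (a t) = ENNReal.ofReal N * ENNReal.ofReal (a t / N) := by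
    intro t
    rw [← ENNReal.ofReal_mul hNpos.le, mul_div_cancel₀ _ hNpos.ne']
  have hnorm : ∫⁻ t, ENNReal.ofReal (a t / N) ^ p ≤ 1 := by
    have e : I = ENNReal.ofReal N ^ p * ∫⁻ t, ENNReal.ofReal (a t / N) ^ p := by
      rw [← lintegral_const_mul' _ _ (by finiteness), hI]
      refine lintegral_congr fun t => ?_
      rw [hscale t, ENNReal.mul_rpow_of_nonneg _ _ hp0.le]
    have e2 : ENNReal.ofReal N ^ p = I := by
      rw [ENNReal.ofReal_rpow_of_pos hNpos, hN, ← Real.rpow_mul hIpos.le, one_div,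
        inv_mul_cancel₀ hp0.ne', Real.rpow_one, ENNReal.ofReal_toReal h1]
    rw [e2] at e
    by_contra! hlt
    have : I * 1 < I * ∫⁻ t, ENNReal.ofReal (a t / N) ^ p :=
      (ENNReal.mul_lt_mul_iff_right h0 h1).mpr hlt
    rw [← e, mul_one] at this
    exact lt_irrefl _ this
  have key := hls_normalized hp hp2 (fun t => div_nonneg (ha0 t) hNpos.le) (ha.div_const N) hnorm
  calc ∫⁻ t : ℝ, ∫⁻ s : ℝ, ENNReal.ofReal (|t - s| ^ (-(2 - 2 / p)))
        * (ENNReal.ofReal (a t) * ENNReal.ofReal (a s))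
      = ENNReal.ofReal (N ^ 2) * ∫⁻ t : ℝ, ∫⁻ s : ℝ, ENNReal.ofReal (|t - s| ^ (-(2 - 2 / p)))
        * (ENNReal.ofReal (a t / N) * ENNReal.ofReal (a s / N)) := by
        rw [← lintegral_const_mul' _ _ (by finiteness)]
        refine lintegral_congr fun t => ?_
        rw [← lintegral_const_mul' _ _ (by finiteness)]
        refine lintegral_congr fun s => ?_
        rw [hscale t, hscale s, sq, ENNReal.ofReal_mul hNpos.le]
        ring
    _ ≤ ENNReal.ofReal (N ^ 2) * C := by gcongr
    _ = C * I ^ (2 / p) := by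
        rw [mul_comm]
        congr 1
        rw [hN, ← Real.rpow_two, ← Real.rpow_mul hIpos.le, ← ENNReal.ofReal_rpow_of_pos hIpos,
          ENNReal.ofReal_toReal h1]
        congr 1
        ring

theorem le_rpow_neg_iff {b c l s : ℝ} (hs : 0 < s) (hc : 0 < c) (hl : 0 < l) (hb : 0 < b) :
    b ≤ (l / c) ^ (-s) ↔ l ≤ c * b ^ (-(1 / s)) := by
  have h := le_rpow_neg_inv_iff (p := 1 / s) (by positivity) hb (div_pos hl hc)
  rw [one_div_one_div] at h
  rw [h, div_le_iff₀ hc, mul_comm]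

/-- A bounded kernel whose operator is an `L²` contraction maps `L^{r'}` to `L^r`. -/
theorem lintegral_kernel_rpow_le {X Y : Type*} [MeasurableSpace X] [MeasurableSpace Y]
    {μ : Measure X} {ν : Measure Y} [SFinite μ] [SFinite ν] {r : ℝ} (hr : 2 < r) {A : ℝ}
    (hA : 0 < A) {K : Y → X → ℂ} (hK : Measurable (Function.uncurry K))
    (hKA : ∀ y x, ‖K y x‖ ≤ A)
    (hL2 : ∀ f : X → ℂ, Measurable f → Integrable f μ → MemLp f 2 μ →
      ∫⁻ y, ‖∫ x, K y x * f x ∂μ‖ₑ ^ (2 : ℝ) ∂ν ≤ ∫⁻ x, ‖f x‖ₑ ^ (2 : ℝ) ∂μ)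
    {f : X → ℂ} (hf : Measurable f) (hf1 : Integrable f μ) (hf2 : MemLp f 2 μ) :
    ∫⁻ y, ‖∫ x, K y x * f x ∂μ‖ₑ ^ r ∂ν
      ≤ ENNReal.ofReal (4 * r / (r - 2) * 2 ^ (r - 2) * A ^ (r - 2))
        * (∫⁻ x, ‖f x‖ₑ ^ (r / (r - 1)) ∂μ) ^ (r - 1) := by
  set p := r / (r - 1) with hp
  have hr1 : 0 < r - 1 := by linarith
  have hr2 : 0 < r - 2 := by linarith
  have hp1 : 1 < p := by rw [hp, one_lt_div hr1]; linarith
  have hp0 : 0 < p := by linarith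
  have hpr : 1 / (r - 1) = p - 1 := by rw [hp]; field_simp; ring
  set C₀ : ℝ := 4 * r / (r - 2) * 2 ^ (r - 2) * A ^ (r - 2) with hC₀
  have hC₀pos : 0 < C₀ := by positivity
  set I := ∫⁻ x, ‖f x‖ₑ ^ p ∂μ with hI
  rcases eq_or_ne I 0 with h0 | h0
  · have hae : ∀ᵐ x ∂μ, f x = 0 := by
      have := (lintegral_eq_zero_iff (hf.enorm.pow_const p)).mp h0
      filter_upwards [this] with t ht
      simpa [hp0, hp0.le] using ht
    refine (le_of_eq ?_).trans zero_le
    have : ∀ y, ∫ x, K y x * f x ∂μ = 0 := fun y => by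
      rw [integral_congr_ae (g := fun _ => 0), integral_zero]
      filter_upwards [hae] with x hx
      simp [hx]
    simp [this, show 0 < r by linarith]
  rcases eq_or_ne I ∞ with h1 | h1
  · rw [h1, ENNReal.top_rpow_of_pos hr1, ENNReal.mul_top (by simpa using hC₀pos)]
    exact le_top
  set N := I.toReal with hN
  have hNpos : 0 < N := ENNReal.toReal_pos h0 h1
  have hIN : I = ENNReal.ofReal N := (ENNReal.ofReal_toReal h1).symm
  set T : (X → ℂ) → Y → ℂ := fun g y => ∫ x, K y x * g x ∂μ with hT
  have hTm : ∀ g : X → ℂ, Measurable g → Measurable (T g) := fun g hg => by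
    have : StronglyMeasurable (Function.uncurry fun y x => K y x * g x) :=
      (hK.mul (hg.comp measurable_snd)).stronglyMeasurable
    exact (StronglyMeasurable.integral_prod_right this).measurable
  set c : ℝ := 2 * A * N with hc
  have hcpos : 0 < c := by positivity
  have hset : ∀ γ : ℝ, MeasurableSet {x | ‖f x‖ ≤ γ} := fun γ =>
    measurableSet_le hf.norm measurable_const
  have hKint : ∀ (g : X → ℂ) (y : Y), Integrable g μ → Integrable (fun x => K y x * g x) μ :=
    fun g y hg => hg.bdd_mul
      (hK.comp measurable_prodMk_left).aestronglyMeasurable (Eventually.of_forall (hKA y))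
  -- the weak-type estimate
  have hweak : ∀ l : ℝ, 0 < l → ν {y | l < ‖T f y‖} ≤ ENNReal.ofReal (4 * l ^ (-2 : ℝ)) *
      ∫⁻ x, (if ‖f x‖ ≤ (l / c) ^ (-(r - 1)) then ‖f x‖ₑ ^ (2 : ℝ) else 0) ∂μ := by
    intro l hl
    set γ := (l / c) ^ (-(r - 1)) with hγ
    have hγpos : 0 < γ := by positivity
    set f2 := {x | ‖f x‖ ≤ γ}.indicator f with hf2def
    set f1 := {x | ‖f x‖ ≤ γ}ᶜ.indicator f with hf1def
    have hsum : f = f1 + f2 := by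
      rw [hf1def, hf2def, add_comm, Set.indicator_self_add_compl]
    have i1 : Integrable f1 μ := hf1.indicator (hset γ).compl
    have i2 : Integrable f2 μ := hf1.indicator (hset γ)
    have hbig : ∀ y, ‖T f1 y‖ ≤ l / 2 := by
      intro y
      have hb : ∀ x, ‖K y x * f1 x‖ₑ ≤ ENNReal.ofReal (A * γ ^ (1 - p)) * ‖f x‖ₑ ^ p := by
        intro x
        simp only [hf1def, Set.indicator, Set.mem_compl_iff, Set.mem_ofPred_eq]
        split_ifs with h
        · simp
        · rw [not_le] at h
          have hfx : 0 < ‖f x‖ := hγpos.trans h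
          rw [← ofReal_norm, ← ofReal_norm, norm_mul, ENNReal.ofReal_rpow_of_pos hfx,
            ← ENNReal.ofReal_mul (by positivity)]
          refine ENNReal.ofReal_le_ofReal ?_
          rw [mul_assoc]
          refine mul_le_mul (hKA y x) ?_ (norm_nonneg _) hA.le
          calc ‖f x‖ = ‖f x‖ ^ (1 - p) * ‖f x‖ ^ p := by
                rw [← Real.rpow_add hfx]; simp
            _ ≤ _ := by
                gcongr ?_ * _
                exact Real.rpow_le_rpow_of_nonpos hγpos h.le (by linarith)
      have h3 : ‖T f1 y‖ₑ ≤ ENNReal.ofReal (A * γ ^ (1 - p)) * I := by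
        refine (enorm_integral_le_lintegral_enorm _).trans ?_
        rw [hI, ← lintegral_const_mul' _ _ (by finiteness)]
        exact lintegral_mono hb
      rw [hIN, ← ENNReal.ofReal_mul (by positivity), ← ofReal_norm,
        ENNReal.ofReal_le_ofReal_iff (by positivity)] at h3
      refine h3.trans (le_of_eq ?_)
      have : γ ^ (1 - p) = l / c := by
        rw [hγ, ← Real.rpow_mul (by positivity), show -(r - 1) * (1 - p) = 1 by
          rw [← neg_sub p 1, ← hpr]; field_simp, Real.rpow_one]
      rw [this, hc]
      field_simp
    have hsub : {y | l < ‖T f y‖} ⊆ {y | ENNReal.ofReal (l / 2) ^ (2 : ℝ) ≤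
        ‖T f2 y‖ₑ ^ (2 : ℝ)} := by
      intro y (hy : l < ‖T f y‖)
      have e : T f y = T f1 y + T f2 y := by
        simp only [hT]
        rw [← integral_add (hKint f1 y i1) (hKint f2 y i2)]
        refine integral_congr_ae (Eventually.of_forall fun x => ?_)
        dsimp only
        rw [← mul_add]
        exact congrArg _ (congrFun hsum x)
      have : l / 2 ≤ ‖T f2 y‖ := by
        have := norm_add_le (T f1 y) (T f2 y)
        rw [← e] at this
        linarith [hbig y]
      change ENNReal.ofReal (l / 2) ^ (2 : ℝ) ≤ ‖T f2 y‖ₑ ^ (2 : ℝ)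
      rw [← ofReal_norm]
      gcongr
    have hcheb := mul_meas_ge_le_lintegral (μ := ν)
          ((hTm f2 (hf.indicator (hset γ))).enorm.pow_const
      (2 : ℝ)) (ENNReal.ofReal (l / 2) ^ (2 : ℝ))
    have hl2 := hL2 f2 (hf.indicator (hset γ)) i2 (hf2.indicator (hset γ))
    have e2 : ∫⁻ x, ‖f2 x‖ₑ ^ (2 : ℝ) ∂μ
        = ∫⁻ x, (if ‖f x‖ ≤ γ then ‖f x‖ₑ ^ (2 : ℝ) else 0) ∂μ := by
      refine lintegral_congr fun x => ?_
      simp only [hf2def, Set.indicator, Set.mem_ofPred_eq]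
      split_ifs <;> simp
    have h4 : ENNReal.ofReal (4 * l ^ (-2 : ℝ)) * ENNReal.ofReal (l / 2) ^ (2 : ℝ) = 1 := by
      rw [ENNReal.ofReal_rpow_of_pos (by positivity), ← ENNReal.ofReal_mul (by positivity),
        Real.rpow_neg hl.le, Real.rpow_two, Real.rpow_two, show 4 * (l ^ 2)⁻¹ * (l / 2) ^ 2 = 1 by
          field_simp; norm_num, ENNReal.ofReal_one]
    calc ν {y | l < ‖T f y‖} ≤ 1 * ν {y | ENNReal.ofReal (l / 2) ^ (2 : ℝ) ≤
        ‖T f2 y‖ₑ ^ (2 : ℝ)} := by rw [one_mul]; exact measure_mono hsub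
      _ ≤ _ := by
        rw [← h4, mul_assoc, ← e2]
        gcongr
        exact hcheb.trans hl2
  have e1 : ∫⁻ y, ‖T f y‖ₑ ^ r ∂ν = ∫⁻ y, ENNReal.ofReal (‖T f y‖ ^ r) ∂ν := by
    refine lintegral_congr fun y => ?_
    rw [← ofReal_norm, ENNReal.ofReal_rpow_of_nonneg (norm_nonneg _) (by linarith)]
  change ∫⁻ y, ‖T f y‖ₑ ^ r ∂ν ≤ _
  rw [e1, lintegral_rpow_eq_lintegral_meas_lt_mul ν (Eventually.of_forall fun y => norm_nonneg _)
    (hTm f hf).norm.aemeasurable (by linarith)]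
  have k : Measurable fun z : ℝ × X => if ‖f z.2‖ ≤ (z.1 / c) ^ (-(r - 1)) then
      ENNReal.ofReal (4 * z.1 ^ (r - 3)) * ‖f z.2‖ₑ ^ (2 : ℝ) else 0 := by
    refine Measurable.ite (measurableSet_le (hf.comp measurable_snd).norm
      ((measurable_fst.div_const _).pow_const _)) ?_ measurable_const
    exact ((measurable_fst.pow_const _).const_mul _).ennreal_ofReal.mul
      ((hf.comp measurable_snd).enorm.pow_const _)
  calc ENNReal.ofReal r * ∫⁻ l in Set.Ioi (0 : ℝ),
        ν {y | l < ‖T f y‖} * ENNReal.ofReal (l ^ (r - 1))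
      ≤ ENNReal.ofReal r * ∫⁻ l in Set.Ioi (0 : ℝ), ∫⁻ x,
          (if ‖f x‖ ≤ (l / c) ^ (-(r - 1)) then
            ENNReal.ofReal (4 * l ^ (r - 3)) * ‖f x‖ₑ ^ (2 : ℝ) else 0) ∂μ := by
        refine mul_le_mul_right (setLIntegral_mono' measurableSet_Ioi fun l (hl : 0 < l) => ?_) _
        refine (mul_le_mul_left (hweak l hl) _).trans (le_of_eq ?_)
        rw [mul_right_comm, ← ENNReal.ofReal_mul (by positivity),
          ← lintegral_const_mul' _ _ (by finiteness)]
        refine lintegral_congr fun x => ?_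
        rw [mul_ite, mul_zero, mul_assoc 4, ← Real.rpow_add hl,
          show -2 + (r - 1) = r - 3 by ring]
    _ = ENNReal.ofReal r * ∫⁻ x, (∫⁻ l in Set.Ioi (0 : ℝ),
          (if ‖f x‖ ≤ (l / c) ^ (-(r - 1)) then
            ENNReal.ofReal (4 * l ^ (r - 3)) * ‖f x‖ₑ ^ (2 : ℝ) else 0)) ∂μ :=
        congrArg _ (lintegral_lintegral_swap k.aemeasurable)
    _ ≤ ENNReal.ofReal r * ∫⁻ x, ENNReal.ofReal (4 / (r - 2) * c ^ (r - 2)) * ‖f x‖ₑ ^ p ∂μ := by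
        refine mul_le_mul_right (lintegral_mono fun x => ?_) _
        rcases (norm_nonneg (f x)).eq_or_lt with h0 | h0
        · simp [norm_eq_zero.mp h0.symm]
        have e : ∀ l ∈ Set.Ioi (0 : ℝ), (if ‖f x‖ ≤ (l / c) ^ (-(r - 1)) then
            ENNReal.ofReal (4 * l ^ (r - 3)) * ‖f x‖ₑ ^ (2 : ℝ) else 0)
            = (Set.Ioc 0 (c * ‖f x‖ ^ (-(1 / (r - 1))))).indicator
              (fun l => 4 * ENNReal.ofReal (l ^ (r - 3)) * ‖f x‖ₑ ^ (2 : ℝ)) l := by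
          intro l (hl : 0 < l)
          simp only [le_rpow_neg_iff hr1 hcpos hl h0, Set.indicator, Set.mem_Ioc, hl, true_and]
          rw [ENNReal.ofReal_mul (by norm_num)]
          simp
        rw [setLIntegral_congr_fun measurableSet_Ioi e, lintegral_indicator measurableSet_Ioc,
          Measure.restrict_restrict measurableSet_Ioc,
          Set.inter_eq_left.mpr Set.Ioc_subset_Ioi_self,
          lintegral_mul_const' _ _ (by finiteness), lintegral_const_mul' _ _ (by finiteness),
          lintegral_Ioc_rpow (by linarith) (by positivity),
          show (4 : ℝ≥0∞) = ENNReal.ofReal 4 by simp, ← ofReal_norm,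
          ENNReal.ofReal_rpow_of_pos h0, ENNReal.ofReal_rpow_of_pos h0,
          show r - 3 + 1 = r - 2 by ring,
          ← ENNReal.ofReal_mul (by positivity), ← ENNReal.ofReal_mul (by positivity),
          ← ENNReal.ofReal_mul (by positivity)]
        refine ENNReal.ofReal_le_ofReal (le_of_eq ?_)
        have : ‖f x‖ ^ p = (‖f x‖ ^ (-(1 / (r - 1)))) ^ (r - 2) * ‖f x‖ ^ (2 : ℝ) := by
          rw [← Real.rpow_mul h0.le, ← Real.rpow_add h0]
          congr 1
          rw [hp]; field_simp; ring
        rw [this, Real.mul_rpow hcpos.le (by positivity)]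
        ring
    _ = _ := by
        rw [lintegral_const_mul' _ _ (by finiteness), ← mul_assoc,
          ← ENNReal.ofReal_mul (by linarith),
          ← hI, hIN, ← ENNReal.ofReal_mul (by positivity), ENNReal.ofReal_rpow_of_pos hNpos,
          ← ENNReal.ofReal_mul (by positivity)]
        congr 1
        rw [hC₀, hc, Real.mul_rpow (by positivity) hNpos.le, Real.mul_rpow (by positivity) hA.le,
          show r - 1 = (r - 2) + 1 by ring, Real.rpow_add_one hNpos.ne']
        ring

section Plancherel

variable {V : Type*} [NormedAddCommGroup V] [InnerProductSpace ℝ V] [FiniteDimensional ℝ V]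
  [MeasurableSpace V] [BorelSpace V]

theorem continuous_fourier_of_integrable {f : V → ℂ} (h1 : Integrable f) : Continuous (𝓕 f) :=
  VectorFourier.fourierIntegral_continuous Real.continuous_fourierChar continuous_inner h1

theorem fourier_toLp_ae_eq {f : V → ℂ} (h1 : Integrable f) (h2 : MemLp f 2) :
    ((𝓕 (h2.toLp f) : Lp ℂ 2) : V → ℂ) =ᵐ[volume] 𝓕 f := by
  refine ae_eq_of_integral_contDiff_smul_eq
    ((Lp.memLp _).locallyIntegrable (by norm_num))
    (continuous_fourier_of_integrable h1).locallyIntegrable fun g hg hgc => ?_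
  have hg₁ : HasCompactSupport (Complex.ofRealCLM ∘ g) := hgc.comp_left rfl
  have hg₂ : ContDiff ℝ (↑(⊤ : ℕ∞)) (Complex.ofRealCLM ∘ g) := by fun_prop
  set G := hg₁.toSchwartzMap hg₂ with hG
  have hGg : ∀ x, G x = g x := fun x => rfl
  have e1 := congrArg (fun T => T G) (Lp.fourier_toTemperedDistribution_eq (h2.toLp f))
  simp only [TemperedDistribution.fourier_apply, Lp.toTemperedDistribution_apply] at e1
  have e2 := VectorFourier.integral_fourierIntegral_smul_eq_flip (L := innerₗ V)
    (μ := (volume : Measure V)) (ν := (volume : Measure V)) Real.continuous_fourierChar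
    continuous_inner G.integrable h1
  have e3 : ∫ x, (𝓕 G) x • (h2.toLp f) x = ∫ x, (𝓕 G) x • f x := by
    refine integral_congr_ae ?_
    filter_upwards [h2.coeFn_toLp] with x hx
    rw [hx]
  rw [e3] at e1
  have e6 : (innerₗ V).flip = innerₗ V := by
    ext x y
    simp
  rw [e6] at e2
  exact e1.symm.trans e2

/-- Plancherel's identity for functions in `L¹ ∩ L²`. -/
theorem eLpNorm_fourier_two {f : V → ℂ} (h1 : Integrable f) (h2 : MemLp f 2) :
    eLpNorm (𝓕 f) 2 volume = eLpNorm f 2 volume := by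
  rw [← eLpNorm_congr_ae (fourier_toLp_ae_eq h1 h2), ← Lp.enorm_def, ← ofReal_norm,
    Lp.norm_fourier_eq, ofReal_norm, Lp.enorm_toLp]

theorem eLpNorm_fourierInv_two {f : V → ℂ} (h1 : Integrable f) (h2 : MemLp f 2) :
    eLpNorm (𝓕⁻ f) 2 volume = eLpNorm f 2 volume := by
  have : 𝓕⁻ f = 𝓕 f ∘ (fun x => -x) := by
    ext x
    rw [Real.fourierInv_eq_fourier_neg]; rfl
  rw [this, eLpNorm_comp_measurePreserving
    (continuous_fourier_of_integrable h1).aestronglyMeasurable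
    (Measure.measurePreserving_neg volume), eLpNorm_fourier_two h1 h2]

end Plancherel

theorem lintegral_enorm_rpow_two {X : Type*} [MeasurableSpace X] (μ : Measure X) (f : X → ℂ) :
    ∫⁻ x, ‖f x‖ₑ ^ (2 : ℝ) ∂μ = eLpNorm f 2 μ ^ (2 : ℝ) := by
  rw [eLpNorm_eq_lintegral_rpow_enorm_toReal (by norm_num) (by norm_num), ← ENNReal.rpow_mul]
  simp

section Dispersive

variable {n : ℕ} (ε : Fin n → ℝ)

/-- The space-time oscillation `e^{2πi⟨ξ,x⟩ - it|ξ|²_±}`. -/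
def phase (t : ℝ) (x ξ : Eucl n) : ℂ :=
  cexp (((2 * Real.pi * inner ℝ ξ x - t * quadSym ε ξ : ℝ) : ℂ) * Complex.I)

/-- Gaussian weight. -/
def gaussW (δ : ℝ) (ξ : Eucl n) : ℝ := Real.exp (-δ * ‖ξ‖ ^ 2)

/-- The Gaussian-regularised kernel of `W_±(t)`. -/
def dispKer (δ t : ℝ) (x : Eucl n) : ℂ := ∫ ξ, (gaussW δ ξ : ℂ) * phase ε t x ξ

theorem continuous_quadSym : Continuous (quadSym ε) := by
  unfold quadSym
  fun_prop

theorem norm_phase (t : ℝ) (x ξ : Eucl n) : ‖phase ε t x ξ‖ = 1 :=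
  Complex.norm_exp_ofReal_mul_I _

theorem enorm_phase (t : ℝ) (x ξ : Eucl n) : ‖phase ε t x ξ‖ₑ = 1 := by
  rw [← ofReal_norm, norm_phase, ENNReal.ofReal_one]

theorem continuous_phase : Continuous fun z : ℝ × Eucl n × Eucl n => phase ε z.1 z.2.1 z.2.2 := by
  unfold phase
  have := continuous_quadSym ε
  fun_prop

theorem phase_mul_conj (t s : ℝ) (x y ξ : Eucl n) :
    phase ε t x ξ * starRingEnd ℂ (phase ε s y ξ) = phase ε (t - s) (x - y) ξ := by
  unfold phase
  rw [← Complex.exp_conj, ← Complex.exp_add, map_mul, Complex.conj_ofReal, Complex.conj_I,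
    inner_sub_right]
  congr 1
  push_cast
  ring

theorem integrable_gaussW {δ : ℝ} (hδ : 0 < δ) : Integrable (gaussW δ : Eucl n → ℝ) := by
  have := (GaussianFourier.integrable_cexp_neg_mul_sq_norm_add (V := Eucl n) (b := δ)
    (by simpa using hδ) 0 0).norm
  refine this.congr (Eventually.of_forall fun ξ => ?_)
  simp only [gaussW, Complex.norm_exp]
  congr 1
  rw [zero_mul, add_zero]
  norm_cast

theorem continuous_gaussW (δ : ℝ) : Continuous (gaussW δ : Eucl n → ℝ) := by
  unfold gaussW
  fun_prop

theorem gaussW_pos (δ : ℝ) (ξ : Eucl n) : 0 < gaussW δ ξ := Real.exp_pos _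

theorem gaussW_le_one {δ : ℝ} (hδ : 0 < δ) (ξ : Eucl n) : gaussW δ ξ ≤ 1 := by
  unfold gaussW
  rw [Real.exp_le_one_iff]
  nlinarith [sq_nonneg ‖ξ‖]

theorem measurable_integral_right {X Y : Type*} [MeasurableSpace X] [MeasurableSpace Y]
    {μ : Measure Y} [SFinite μ] {f : X → Y → ℂ} (hf : Measurable (Function.uncurry f)) :
    Measurable fun x => ∫ y, f x y ∂μ :=
  (StronglyMeasurable.integral_prod_right (f := f) hf.stronglyMeasurable).measurable

theorem measurable_phase : Measurable fun z : ℝ × Eucl n × Eucl n => phase ε z.1 z.2.1 z.2.2 :=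
  (continuous_phase ε).measurable

theorem measurable_gaussW (δ : ℝ) : Measurable (gaussW δ : Eucl n → ℝ) :=
  (continuous_gaussW δ).measurable

theorem measurable_dispKer (δ : ℝ) :
    Measurable fun z : ℝ × Eucl n => dispKer ε δ z.1 z.2 := by
  have h1 : Measurable fun w : (ℝ × Eucl n) × Eucl n => phase ε w.1.1 w.1.2 w.2 :=
    (measurable_phase ε).comp (f := fun w : (ℝ × Eucl n) × Eucl n => (w.1.1, w.1.2, w.2))
      (by fun_prop)
  have h2 : Measurable fun w : (ℝ × Eucl n) × Eucl n => (gaussW δ w.2 : ℂ) :=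
    Complex.measurable_ofReal.comp ((measurable_gaussW δ).comp measurable_snd)
  exact measurable_integral_right (f := fun (z : ℝ × Eucl n) (ξ : Eucl n) =>
    (gaussW δ ξ : ℂ) * phase ε z.1 z.2 ξ) (h2.mul h1)

/-- The dispersive estimate, uniformly in the regularisation. -/
theorem norm_dispKer_le (hε : ∀ i, ε i = 1 ∨ ε i = -1) {δ t : ℝ} (hδ : 0 < δ) (ht : t ≠ 0)
    (x : Eucl n) : ‖dispKer ε δ t x‖ ≤ (Real.pi / |t|) ^ ((n : ℝ) / 2) := by
  set b : Fin n → ℂ := fun i => δ + ε i * t * Complex.I with hb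
  set c : Fin n → ℂ := fun i => 2 * Real.pi * x i * Complex.I with hc
  have hbre : ∀ i, (b i).re = δ := by intro i; simp [hb]
  have hbim : ∀ i, (b i).im = ε i * t := by intro i; simp [hb]
  have hbn : ∀ i, |t| ≤ ‖b i‖ := by
    intro i
    calc |t| = |(b i).im| := by
          rw [hbim]; rcases hε i with h | h <;> simp [h]
      _ ≤ _ := Complex.abs_im_le_norm _
  have ht' : 0 < |t| := abs_pos.mpr ht
  have e : dispKer ε δ t x = ∏ i, (Real.pi / b i) ^ (1 / 2 : ℂ) * cexp (c i ^ 2 / (4 * b i)) := by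
    rw [← GaussianFourier.integral_cexp_neg_sum_mul_add (fun i => (hbre i).symm ▸ hδ) c, dispKer,
      ← (PiLp.volume_preserving_toLp (Fin n)).integral_comp
        (MeasurableEquiv.toLp 2 _).measurableEmbedding]
    refine integral_congr_ae (Eventually.of_forall fun v => ?_)
    dsimp only
    rw [gaussW, phase, Complex.ofReal_exp, ← Complex.exp_add]
    congr 1
    simp only [hb, hc, quadSym, EuclideanSpace.norm_sq_eq, PiLp.inner_apply, RCLike.inner_apply,
      conj_trivial, Real.norm_eq_abs, sq_abs]
    push_cast
    simp only [Finset.mul_sum, sub_mul, Finset.sum_mul, ← Finset.sum_neg_distrib,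
      ← Finset.sum_sub_distrib, ← Finset.sum_add_distrib]
    refine Finset.sum_congr rfl fun i _ => ?_
    ring
  rw [e, norm_prod]
  calc ∏ i, ‖(Real.pi / b i) ^ (1 / 2 : ℂ) * cexp (c i ^ 2 / (4 * b i))‖
      ≤ ∏ _i : Fin n, (Real.pi / |t|) ^ ((1 : ℝ) / 2) := by
        refine Finset.prod_le_prod (fun i _ => norm_nonneg _) fun i _ => ?_
        rw [norm_mul]
        have hb0 : 0 < ‖b i‖ := ht'.trans_le (hbn i)
        have h1 : ‖cexp (c i ^ 2 / (4 * b i))‖ ≤ 1 := by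
          rw [Complex.norm_exp, Real.exp_le_one_iff]
          have : c i ^ 2 = ((-(2 * Real.pi * x i) ^ 2 : ℝ) : ℂ) := by
            simp only [hc, mul_pow, Complex.I_sq]; push_cast; ring
          rw [this, Complex.div_re]
          simp only [Complex.ofReal_re, Complex.ofReal_im, zero_mul, zero_div, add_zero]
          refine div_nonpos_of_nonpos_of_nonneg ?_ (Complex.normSq_nonneg _)
          refine mul_nonpos_of_nonpos_of_nonneg (by nlinarith [sq_nonneg (2 * Real.pi * x i)]) ?_
          rw [show (4 : ℂ) = ((4 : ℝ) : ℂ) by simp, Complex.re_ofReal_mul, hbre]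
          positivity
        have h2 : ‖((Real.pi : ℂ) / b i) ^ (1 / 2 : ℂ)‖ ≤ (Real.pi / |t|) ^ ((1 : ℝ) / 2) := by
          rw [show (1 / 2 : ℂ) = (((1 / 2 : ℝ)) : ℂ) by push_cast; ring,
            Complex.norm_cpow_real, norm_div, Complex.norm_real, Real.norm_eq_abs,
            abs_of_pos Real.pi_pos]
          gcongr
          exact hbn i
        calc _ ≤ (Real.pi / |t|) ^ ((1 : ℝ) / 2) * 1 := by gcongr
          _ = _ := mul_one _
    _ = (Real.pi / |t|) ^ ((n : ℝ) / 2) := by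
        rw [Finset.prod_const, Finset.card_univ, Fintype.card_fin, ← Real.rpow_natCast,
          ← Real.rpow_mul (by positivity)]
        congr 1
        ring

end Dispersive

section FixedTime

variable {n : ℕ} (ε : Fin n → ℝ)

theorem phase_eq_mul (t : ℝ) (x ξ : Eucl n) :
    phase ε t x ξ = phase ε 0 x ξ * phase ε t 0 ξ := by
  unfold phase
  rw [← Complex.exp_add, inner_zero_right]
  congr 1
  push_cast
  ring

theorem phase_sub (t : ℝ) (x y ξ : Eucl n) :
    phase ε t (x - y) ξ = phase ε t x ξ * starRingEnd ℂ (phase ε 0 y ξ) := by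
  rw [phase_mul_conj, sub_zero]

theorem fourier_eq_integral_phase (f : Eucl n → ℂ) (ξ : Eucl n) :
    𝓕 f ξ = ∫ y, starRingEnd ℂ (phase ε 0 y ξ) * f y := by
  rw [Real.fourier_eq']
  refine integral_congr_ae (Eventually.of_forall fun y => ?_)
  simp only [phase, ← Complex.exp_conj, map_mul, Complex.conj_ofReal, Complex.conj_I, smul_eq_mul]
  congr 2
  rw [real_inner_comm]
  push_cast
  ring

theorem fourierInv_eq_integral_phase (g : Eucl n → ℂ) (x : Eucl n) :
    𝓕⁻ g x = ∫ ξ, phase ε 0 x ξ * g ξ := by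
  rw [Real.fourierInv_eq']
  refine integral_congr_ae (Eventually.of_forall fun ξ => ?_)
  simp only [phase, smul_eq_mul]
  congr 2
  push_cast
  ring

theorem integral_dispKer_mul {δ : ℝ} (hδ : 0 < δ) (t : ℝ) {f : Eucl n → ℂ}
    (hf : Integrable f) (x : Eucl n) :
    ∫ y, dispKer ε δ t (x - y) * f y
      = 𝓕⁻ (fun ξ => ((gaussW δ ξ : ℂ) * phase ε t 0 ξ) * 𝓕 f ξ) x := by
  have hint : Integrable (Function.uncurry fun (y ξ : Eucl n) =>
      (gaussW δ ξ : ℂ) * phase ε t (x - y) ξ * f y) (volume.prod volume) := by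
    have h1 : Integrable (fun z : Eucl n × Eucl n => f z.1 * (gaussW δ z.2 : ℂ))
        (volume.prod volume) := hf.mul_prod (integrable_gaussW hδ).ofReal
    have hm : Measurable fun z : Eucl n × Eucl n => phase ε t (x - z.1) z.2 :=
      (measurable_phase ε).comp (f := fun z : Eucl n × Eucl n => (t, x - z.1, z.2)) (by fun_prop)
    refine (h1.bdd_mul (c := 1) hm.aestronglyMeasurable
      (Eventually.of_forall fun z => (norm_phase ε _ _ _).le)).congr
      (Eventually.of_forall fun z => ?_)
    simp only [Function.uncurry]
    ring
  calc ∫ y, dispKer ε δ t (x - y) * f y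
      = ∫ y, ∫ ξ, (gaussW δ ξ : ℂ) * phase ε t (x - y) ξ * f y := by
        simp only [dispKer, integral_mul_const]
    _ = ∫ ξ, ∫ y, (gaussW δ ξ : ℂ) * phase ε t (x - y) ξ * f y := integral_integral_swap hint
    _ = ∫ ξ, phase ε 0 x ξ * (((gaussW δ ξ : ℂ) * phase ε t 0 ξ) * 𝓕 f ξ) := by
        refine integral_congr_ae (Eventually.of_forall fun ξ => ?_)
        simp only
        rw [fourier_eq_integral_phase ε, ← integral_const_mul, ← integral_const_mul]
        refine integral_congr_ae (Eventually.of_forall fun y => ?_)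
        simp only [phase_sub, phase_eq_mul ε t x]
        ring
    _ = _ := (fourierInv_eq_integral_phase ε _ x).symm

theorem measurable_phase_right (t : ℝ) (x : Eucl n) : Measurable (phase ε t x) :=
  (measurable_phase ε).comp (f := fun ξ : Eucl n => (t, x, ξ)) (by fun_prop)

theorem lintegral_dispKer_sq_le {δ : ℝ} (hδ : 0 < δ) (t : ℝ) {f : Eucl n → ℂ}
    (hf : Integrable f) (hf2 : MemLp f 2) :
    ∫⁻ x, ‖∫ y, dispKer ε δ t (x - y) * f y‖ₑ ^ (2 : ℝ) ≤ ∫⁻ x, ‖f x‖ₑ ^ (2 : ℝ) := by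
  have hFc : Continuous (𝓕 f) := continuous_fourier_of_integrable hf
  have hF2 : eLpNorm (𝓕 f) 2 volume = eLpNorm f 2 volume := eLpNorm_fourier_two hf hf2
  have hFm : MemLp (𝓕 f) 2 := ⟨hFc.aestronglyMeasurable, hF2 ▸ hf2.2⟩
  set m : Eucl n → ℂ := fun ξ => (gaussW δ ξ : ℂ) * phase ε t 0 ξ with hm
  have hmm : Measurable m :=
    (Complex.measurable_ofReal.comp (measurable_gaussW δ)).mul (measurable_phase_right ε t 0)
  have hmn : ∀ ξ, ‖m ξ‖ = gaussW δ ξ := fun ξ => by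
    simp only [hm, norm_mul, norm_phase, mul_one, Complex.norm_real, Real.norm_eq_abs,
      abs_of_pos (gaussW_pos δ ξ)]
  have hmle : ∀ ξ, ‖m ξ‖ ≤ 1 := fun ξ => (hmn ξ).trans_le (gaussW_le_one hδ ξ)
  have hmi : Integrable m :=
    (integrable_gaussW hδ).mono' hmm.aestronglyMeasurable
      (Eventually.of_forall fun ξ => (hmn ξ).le)
  have hg1 : Integrable (fun ξ => m ξ * 𝓕 f ξ) := by
    obtain ⟨B, hB⟩ : ∃ B, ∀ ξ, ‖𝓕 f ξ‖ ≤ B :=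
      ⟨_, fun ξ => VectorFourier.norm_fourierIntegral_le_integral_norm _ _ _ _ _⟩
    refine (hmi.bdd_mul (c := B) hFc.aestronglyMeasurable (Eventually.of_forall hB)).congr
      (Eventually.of_forall fun ξ => mul_comm _ _)
  have hle : eLpNorm (fun ξ => m ξ * 𝓕 f ξ) 2 volume ≤ eLpNorm (𝓕 f) 2 volume := by
    refine eLpNorm_mono fun ξ => ?_
    rw [norm_mul]
    exact mul_le_of_le_one_left (norm_nonneg _) (hmle ξ)
  have hg2 : MemLp (fun ξ => m ξ * 𝓕 f ξ) 2 := ⟨hg1.1, hle.trans_lt hFm.2⟩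
  calc ∫⁻ x, ‖∫ y, dispKer ε δ t (x - y) * f y‖ₑ ^ (2 : ℝ)
      = ∫⁻ x, ‖𝓕⁻ (fun ξ => m ξ * 𝓕 f ξ) x‖ₑ ^ (2 : ℝ) := by
        simp only [integral_dispKer_mul ε hδ t hf, hm]
    _ = eLpNorm (𝓕⁻ (fun ξ => m ξ * 𝓕 f ξ)) 2 volume ^ (2 : ℝ) := lintegral_enorm_rpow_two _ _
    _ = eLpNorm (fun ξ => m ξ * 𝓕 f ξ) 2 volume ^ (2 : ℝ) := by
        rw [eLpNorm_fourierInv_two hg1 hg2]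
    _ ≤ eLpNorm f 2 volume ^ (2 : ℝ) := by
        rw [← hF2]
        gcongr
    _ = _ := (lintegral_enorm_rpow_two _ _).symm

/-- The `L^p` norm with the exponent dual to `r`. -/
def dualNorm (r : ℝ) (f : Eucl n → ℂ) : ℝ≥0∞ :=
  (∫⁻ x, ‖f x‖ₑ ^ (r / (r - 1))) ^ ((r - 1) / r)

theorem exists_pairing_const (hε : ∀ i, ε i = 1 ∨ ε i = -1) {r : ℝ} (hr : 2 < r) :
    ∃ C : ℝ≥0∞, C ≠ ∞ ∧ ∀ δ > 0, ∀ t ≠ 0, ∀ f g : Eucl n → ℂ, Measurable f → Integrable f →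
      MemLp f 2 → Measurable g →
      ∫⁻ x, ‖g x‖ₑ * ‖∫ y, dispKer ε δ t (x - y) * f y‖ₑ
        ≤ C * ENNReal.ofReal (|t| ^ (-((n : ℝ) * (1 / 2 - 1 / r)))) *
            (dualNorm r g * dualNorm r f) := by
  have hr0 : 0 < r := by linarith
  have hr1 : 0 < r - 1 := by linarith
  have hr2 : 0 < r - 2 := by linarith
  set c : ℝ := 4 * r / (r - 2) * 2 ^ (r - 2) * Real.pi ^ ((n : ℝ) / 2 * (r - 2)) with hc
  have hc0 : 0 < c := by positivity
  refine ⟨ENNReal.ofReal c ^ (1 / r), (ENNReal.rpow_lt_top_of_nonneg (by positivity)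
    ENNReal.ofReal_ne_top).ne, fun δ hδ t ht f g hf hf1 hf2 hg => ?_⟩
  have ht' : 0 < |t| := abs_pos.mpr ht
  have hKm : Measurable fun z : Eucl n × Eucl n => dispKer ε δ t (z.1 - z.2) :=
    (measurable_dispKer ε δ).comp (f := fun z : Eucl n × Eucl n => (t, z.1 - z.2)) (by fun_prop)
  have hTm : Measurable fun x => ∫ y, dispKer ε δ t (x - y) * f y :=
    measurable_integral_right (f := fun x y => dispKer ε δ t (x - y) * f y)
      (hKm.mul (hf.comp measurable_snd))
  have key := lintegral_kernel_rpow_le (μ := (volume : Measure (Eucl n)))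
    (ν := (volume : Measure (Eucl n))) hr (A := (Real.pi / |t|) ^ ((n : ℝ) / 2)) (by positivity)
    (K := fun x y => dispKer ε δ t (x - y)) hKm
    (fun x y => norm_dispKer_le ε hε hδ ht _)
    (fun f _ h1 h2 => lintegral_dispKer_sq_le ε hδ t h1 h2) hf hf1 hf2
  have hA : 4 * r / (r - 2) * 2 ^ (r - 2) * ((Real.pi / |t|) ^ ((n : ℝ) / 2)) ^ (r - 2)
      = c * |t| ^ (-((n : ℝ) / 2 * (r - 2))) := by
    rw [hc, ← Real.rpow_mul (by positivity), Real.div_rpow Real.pi_pos.le ht'.le,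
      Real.rpow_neg ht'.le]
    ring
  have hpq : (r / (r - 1)).HolderConjugate r := by
    constructor <;> first | positivity | (field_simp; try ring)
  calc ∫⁻ x, ‖g x‖ₑ * ‖∫ y, dispKer ε δ t (x - y) * f y‖ₑ
      ≤ (∫⁻ x, ‖g x‖ₑ ^ (r / (r - 1))) ^ (1 / (r / (r - 1)))
        * (∫⁻ x, ‖∫ y, dispKer ε δ t (x - y) * f y‖ₑ ^ r) ^ (1 / r) :=
        ENNReal.lintegral_mul_le_Lp_mul_Lq _ hpq hg.enorm.aemeasurable hTm.enorm.aemeasurable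
    _ ≤ dualNorm r g * (ENNReal.ofReal (c * |t| ^ (-((n : ℝ) / 2 * (r - 2))))
          * (∫⁻ x, ‖f x‖ₑ ^ (r / (r - 1))) ^ (r - 1)) ^ (1 / r) := by
        rw [dualNorm, one_div_div, ← hA]
        gcongr
    _ = _ := by
        rw [ENNReal.mul_rpow_of_nonneg _ _ (by positivity), ENNReal.ofReal_mul hc0.le,
          ENNReal.mul_rpow_of_nonneg _ _ (by positivity), ← ENNReal.rpow_mul,
          ENNReal.ofReal_rpow_of_pos (x := |t| ^ _) (by positivity), ← Real.rpow_mul ht'.le,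
          dualNorm, dualNorm]
        rw [show -((n : ℝ) / 2 * (r - 2)) * (1 / r) = -((n : ℝ) * (1 / 2 - 1 / r)) by
          field_simp, show (r - 1) * (1 / r) = (r - 1) / r by ring]
        ring

end FixedTime

theorem memLp_of_bounded_of_support {X : Type*} [MeasurableSpace X] {μ : Measure X} {f : X → ℂ}
    (hf : AEStronglyMeasurable f μ) {B : ℝ} (hB : ∀ x, ‖f x‖ ≤ B) {s : Set X}
    (hs : MeasurableSet s) (hμ : μ s ≠ ∞) (h0 : ∀ x, x ∉ s → f x = 0) (p : ℝ≥0∞) :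
    MemLp f p μ := by
  refine (memLp_indicator_const p hs B (Or.inr hμ)).mono hf (Eventually.of_forall fun x => ?_)
  by_cases hx : x ∈ s
  · rw [Set.indicator_of_mem hx]
    exact (hB x).trans (le_abs_self B)
  · rw [h0 x hx, norm_zero]
    exact norm_nonneg _

/-- Bounded measurable functions with bounded support. -/
structure IsTest {V : Type*} [NormedAddCommGroup V] [MeasurableSpace V] (f : V → ℂ) : Prop where
  measurable : Measurable f
  bounded : ∃ B : ℝ, ∀ x, ‖f x‖ ≤ B
  support : ∃ M : ℝ, ∀ x, f x ≠ 0 → ‖x‖ ≤ M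

section Test

variable {V : Type*} [NormedAddCommGroup V] [MeasurableSpace V] [BorelSpace V]
  [ProperSpace V] {μ : Measure V} [IsFiniteMeasureOnCompacts μ]

theorem IsTest.memLp {f : V → ℂ} (hf : IsTest f) (p : ℝ≥0∞) : MemLp f p μ := by
  obtain ⟨B, hB⟩ := hf.bounded
  obtain ⟨M, hM⟩ := hf.support
  refine memLp_of_bounded_of_support hf.measurable.aestronglyMeasurable hB
    (s := Metric.closedBall 0 M) measurableSet_closedBall
    (isCompact_closedBall _ _).measure_lt_top.ne (fun x hx => ?_) p
  by_contra h
  exact hx (by simpa using hM x h)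

theorem IsTest.integrable {f : V → ℂ} (hf : IsTest f) : Integrable f μ :=
  memLp_one_iff_integrable.mp (hf.memLp 1)

end Test

theorem IsTest.conj {V : Type*} [NormedAddCommGroup V] [MeasurableSpace V] {f : V → ℂ}
    (hf : IsTest f) : IsTest fun x => starRingEnd ℂ (f x) := by
  obtain ⟨B, hB⟩ := hf.bounded
  obtain ⟨M, hM⟩ := hf.support
  refine ⟨Complex.continuous_conj.measurable.comp hf.measurable, ⟨B, fun x => ?_⟩, ⟨M, fun x hx =>
    hM x fun h => hx ?_⟩⟩
  · rw [RCLike.norm_conj]; exact hB x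
  · rw [h, map_zero]

theorem IsTest.slice {V W : Type*} [NormedAddCommGroup V] [MeasurableSpace V]
    [NormedAddCommGroup W] [MeasurableSpace W] {f : W × V → ℂ} (hf : IsTest f) (t : W) :
    IsTest fun x => f (t, x) := by
  obtain ⟨B, hB⟩ := hf.bounded
  obtain ⟨M, hM⟩ := hf.support
  exact ⟨hf.measurable.comp measurable_prodMk_left, ⟨B, fun x => hB _⟩,
    ⟨M, fun x hx => (norm_snd_le (t, x)).trans (hM _ hx)⟩⟩

section TT

variable {n : ℕ} (ε : Fin n → ℝ)

theorem measurable_phase_comp {X : Type*} [MeasurableSpace X] {a : X → ℝ} {b c : X → Eucl n}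
    (ha : Measurable a) (hb : Measurable b) (hc : Measurable c) :
    Measurable fun x => phase ε (a x) (b x) (c x) :=
  (measurable_phase ε).comp (f := fun x => (a x, b x, c x)) (ha.prodMk (hb.prodMk hc))

theorem norm_dispKer_le_integral {δ : ℝ} (t : ℝ) (x : Eucl n) :
    ‖dispKer ε δ t x‖ ≤ ∫ ξ : Eucl n, gaussW δ ξ := by
  refine (norm_integral_le_integral_norm _).trans_eq (integral_congr_ae
    (Eventually.of_forall fun ξ => ?_))
  simp only [norm_mul, norm_phase, mul_one, Complex.norm_real, Real.norm_eq_abs,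
      abs_of_pos (gaussW_pos δ ξ)]

/-- The adjoint of the extension operator. -/
def restr (f : ℝ × Eucl n → ℂ) (ξ : Eucl n) : ℂ := ∫ z, f z * phase ε z.1 z.2 ξ

theorem measurable_restr {f : ℝ × Eucl n → ℂ} (hf : Measurable f) : Measurable (restr ε f) :=
  measurable_integral_right (f := fun ξ z => f z * phase ε z.1 z.2 ξ)
    ((hf.comp measurable_snd).mul (measurable_phase_comp ε (by fun_prop) (by fun_prop)
      (by fun_prop)))

theorem norm_restr_le (f : ℝ × Eucl n → ℂ) (ξ : Eucl n) : ‖restr ε f ξ‖ ≤ ∫ z, ‖f z‖ := by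
  refine (norm_integral_le_integral_norm _).trans_eq (integral_congr_ae
    (Eventually.of_forall fun ξ => ?_))
  simp only [norm_mul, norm_phase, mul_one]

theorem integral_gaussW_mul_restr {δ : ℝ} (hδ : 0 < δ) {f : ℝ × Eucl n → ℂ} (hf : IsTest f) :
    ∫ ξ, (gaussW δ ξ : ℂ) * (restr ε f ξ * starRingEnd ℂ (restr ε f ξ))
      = ∫ z, f z * ∫ s, ∫ y, dispKer ε δ (z.1 - s) (z.2 - y) * starRingEnd ℂ (f (s, y)) := by
  have hfi : Integrable f := hf.integrable
  have hfc : Integrable fun z => starRingEnd ℂ (f z) := hf.conj.integrable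
  have hff : Integrable fun w : (ℝ × Eucl n) × (ℝ × Eucl n) => f w.1 * starRingEnd ℂ (f w.2) :=
    hfi.mul_prod hfc
  have hint : Integrable (Function.uncurry fun (ξ : Eucl n) (w : (ℝ × Eucl n) × (ℝ × Eucl n)) =>
      phase ε (w.1.1 - w.2.1) (w.1.2 - w.2.2) ξ *
        ((gaussW δ ξ : ℂ) * (f w.1 * starRingEnd ℂ (f w.2)))) (volume.prod volume) := by
    have h1 := ((integrable_gaussW (n := n) hδ).ofReal (𝕜 := ℂ)).mul_prod hff
    have hm : Measurable fun v : Eucl n × ((ℝ × Eucl n) × (ℝ × Eucl n)) =>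
        phase ε (v.2.1.1 - v.2.2.1) (v.2.1.2 - v.2.2.2) v.1 :=
      measurable_phase_comp ε (by fun_prop) (by fun_prop) (by fun_prop)
    exact h1.bdd_mul (c := 1) hm.aestronglyMeasurable
      (Eventually.of_forall fun z => (norm_phase ε _ _ _).le)
  have hker : ∀ w : (ℝ × Eucl n) × (ℝ × Eucl n),
      ∫ ξ, phase ε (w.1.1 - w.2.1) (w.1.2 - w.2.2) ξ *
        ((gaussW δ ξ : ℂ) * (f w.1 * starRingEnd ℂ (f w.2)))
      = f w.1 * (dispKer ε δ (w.1.1 - w.2.1) (w.1.2 - w.2.2) * starRingEnd ℂ (f w.2)) := by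
    intro w
    rw [mul_left_comm (f w.1), dispKer, ← integral_mul_const]
    refine integral_congr_ae (Eventually.of_forall fun ξ => ?_)
    simp only
    ring
  have hint2 := hint.integral_prod_right
  simp only [Function.uncurry, hker] at hint2
  calc ∫ ξ, (gaussW δ ξ : ℂ) * (restr ε f ξ * starRingEnd ℂ (restr ε f ξ))
      = ∫ ξ, ∫ w : (ℝ × Eucl n) × (ℝ × Eucl n),
          phase ε (w.1.1 - w.2.1) (w.1.2 - w.2.2) ξ *
            ((gaussW δ ξ : ℂ) * (f w.1 * starRingEnd ℂ (f w.2))) := by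
        refine integral_congr_ae (Eventually.of_forall fun ξ => ?_)
        simp only
        rw [restr, ← integral_conj, ← integral_prod_mul, ← integral_const_mul]
        refine integral_congr_ae (Eventually.of_forall fun w => ?_)
        simp only [map_mul, ← phase_mul_conj]
        ring
    _ = ∫ w : (ℝ × Eucl n) × (ℝ × Eucl n), ∫ ξ,
          phase ε (w.1.1 - w.2.1) (w.1.2 - w.2.2) ξ *
            ((gaussW δ ξ : ℂ) * (f w.1 * starRingEnd ℂ (f w.2))) := integral_integral_swap hint
    _ = ∫ w : (ℝ × Eucl n) × (ℝ × Eucl n),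
          f w.1 * (dispKer ε δ (w.1.1 - w.2.1) (w.1.2 - w.2.2) * starRingEnd ℂ (f w.2)) := by
        simp only [hker]
    _ = ∫ z, ∫ w, f z * (dispKer ε δ (z.1 - w.1) (z.2 - w.2) * starRingEnd ℂ (f w)) :=
        integral_prod _ hint2
    _ = _ := by
        refine integral_congr_ae (Eventually.of_forall fun z => ?_)
        simp only
        rw [integral_const_mul]
        congr 1
        refine integral_prod _ ?_
        have hm : Measurable fun w : ℝ × Eucl n => dispKer ε δ (z.1 - w.1) (z.2 - w.2) :=
          (measurable_dispKer ε δ).comp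
            (f := fun w : ℝ × Eucl n => (z.1 - w.1, z.2 - w.2)) (by fun_prop)
        exact hfc.bdd_mul hm.aestronglyMeasurable
          (Eventually.of_forall fun w => norm_dispKer_le_integral ε _ _)

theorem lintegral_gaussW_mul_restr_sq_le {δ : ℝ} (hδ : 0 < δ) {f : ℝ × Eucl n → ℂ}
    (hf : IsTest f) :
    ∫⁻ ξ, ENNReal.ofReal (gaussW δ ξ) * ‖restr ε f ξ‖ₑ ^ (2 : ℝ)
      ≤ ∫⁻ t, ∫⁻ s, ∫⁻ x, ‖f (t, x)‖ₑ *
          ‖∫ y, dispKer ε δ (t - s) (x - y) * starRingEnd ℂ (f (s, y))‖ₑ := by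
  have hfm := hf.measurable
  have hint : Integrable fun ξ => gaussW δ ξ * ‖restr ε f ξ‖ ^ 2 := by
    refine ((integrable_gaussW hδ).bdd_mul (c := (∫ z, ‖f z‖) ^ 2)
      (f := fun ξ => ‖restr ε f ξ‖ ^ 2)
      ((measurable_restr ε hfm).norm.pow_const 2).aestronglyMeasurable
      (Eventually.of_forall fun ξ => ?_)).congr (Eventually.of_forall fun ξ => mul_comm _ _)
    rw [norm_pow, norm_norm]
    gcongr
    exact norm_restr_le ε f ξ
  have h0 : ∀ ξ, 0 ≤ gaussW δ ξ * ‖restr ε f ξ‖ ^ 2 := fun ξ =>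
    mul_nonneg (gaussW_pos δ ξ).le (by positivity)
  have hGm : Measurable fun v : (ℝ × ℝ × Eucl n) => ∫ y, dispKer ε δ (v.1 - v.2.1) (v.2.2 - y) *
      starRingEnd ℂ (f (v.2.1, y)) := by
    refine measurable_integral_right (f := fun (v : (ℝ × ℝ × Eucl n)) y =>
      dispKer ε δ (v.1 - v.2.1) (v.2.2 - y) * starRingEnd ℂ (f (v.2.1, y))) (Measurable.mul ?_ ?_)
    · exact (measurable_dispKer ε δ).comp (f := fun w : (ℝ × ℝ × Eucl n) × Eucl n =>
        (w.1.1 - w.1.2.1, w.1.2.2 - w.2)) (by fun_prop)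
    · exact Complex.continuous_conj.measurable.comp (hfm.comp
        (f := fun w : (ℝ × ℝ × Eucl n) × Eucl n => (w.1.2.1, w.2)) (by fun_prop))
  calc ∫⁻ ξ, ENNReal.ofReal (gaussW δ ξ) * ‖restr ε f ξ‖ₑ ^ (2 : ℝ)
      = ∫⁻ ξ, ENNReal.ofReal (gaussW δ ξ * ‖restr ε f ξ‖ ^ 2) := by
        refine lintegral_congr fun ξ => ?_
        rw [ENNReal.ofReal_mul (gaussW_pos δ ξ).le, ENNReal.ofReal_pow (norm_nonneg _),
          ofReal_norm, ENNReal.rpow_two]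
    _ = ENNReal.ofReal (∫ ξ, gaussW δ ξ * ‖restr ε f ξ‖ ^ 2) :=
        (ofReal_integral_eq_lintegral_ofReal hint (Eventually.of_forall h0)).symm
    _ = ‖∫ ξ, (gaussW δ ξ : ℂ) * (restr ε f ξ * starRingEnd ℂ (restr ε f ξ))‖ₑ := by
        have : ∫ ξ, (gaussW δ ξ : ℂ) * (restr ε f ξ * starRingEnd ℂ (restr ε f ξ))
            = ((∫ ξ, gaussW δ ξ * ‖restr ε f ξ‖ ^ 2 : ℝ) : ℂ) := by
          rw [← integral_complex_ofReal]
          refine integral_congr_ae (Eventually.of_forall fun ξ => ?_)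
          simp only [Complex.mul_conj']
          push_cast
          ring
        rw [this, ← ofReal_norm, Complex.norm_real, Real.norm_of_nonneg (integral_nonneg h0)]
    _ ≤ ∫⁻ z : ℝ × Eucl n, ‖f z‖ₑ * ∫⁻ s,
          ‖∫ y, dispKer ε δ (z.1 - s) (z.2 - y) * starRingEnd ℂ (f (s, y))‖ₑ := by
        rw [integral_gaussW_mul_restr ε hδ hf]
        refine (enorm_integral_le_lintegral_enorm _).trans (lintegral_mono fun z => ?_)
        rw [enorm_mul]
        gcongr
        exact enorm_integral_le_lintegral_enorm _
    _ = ∫⁻ t, ∫⁻ x, ∫⁻ s, ‖f (t, x)‖ₑ *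
          ‖∫ y, dispKer ε δ (t - s) (x - y) * starRingEnd ℂ (f (s, y))‖ₑ := by
        have hm1 : Measurable fun z : ℝ × Eucl n => ‖f z‖ₑ * ∫⁻ s,
          ‖∫ y, dispKer ε δ (z.1 - s) (z.2 - y) * starRingEnd ℂ (f (s, y))‖ₑ := by
          refine hfm.enorm.mul (Measurable.lintegral_prod_right'
            (f := fun v : (ℝ × Eucl n) × ℝ => ‖∫ y, dispKer ε δ (v.1.1 - v.2) (v.1.2 - y) *
              starRingEnd ℂ (f (v.2, y))‖ₑ) ?_)
          exact (hGm.comp (f := fun v : (ℝ × Eucl n) × ℝ => (v.1.1, v.2, v.1.2))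
            (by fun_prop)).enorm
        rw [Measure.volume_eq_prod, lintegral_prod _ hm1.aemeasurable]
        refine lintegral_congr fun t => lintegral_congr fun x => ?_
        rw [lintegral_const_mul]
        exact (hGm.comp (f := fun s : ℝ => (t, s, x)) (by fun_prop)).enorm
    _ = _ := by
        refine lintegral_congr fun t => lintegral_lintegral_swap ?_
        have hh : Measurable fun z : Eucl n × ℝ => ‖f (t, z.1)‖ₑ *
            ‖∫ y, dispKer ε δ (t - z.2) (z.1 - y) * starRingEnd ℂ (f (z.2, y))‖ₑ :=
          (hfm.comp (f := fun z : Eucl n × ℝ => (t, z.1)) (by fun_prop)).enorm.mul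
            (hGm.comp (f := fun z : Eucl n × ℝ => (t, z.2, z.1)) (by fun_prop)).enorm
        exact hh.aemeasurable

end TT

section Duality

variable {n : ℕ}

theorem enorm_integral_of_nonneg {X : Type*} [MeasurableSpace X] {μ : Measure X} {F : X → ℂ}
    (hF : Integrable F μ) (h : ∀ z, F z = (‖F z‖ : ℂ)) : ‖∫ z, F z ∂μ‖ₑ = ∫⁻ z, ‖F z‖ₑ ∂μ := by
  have : ∫ z, F z ∂μ = ((∫ z, ‖F z‖ ∂μ : ℝ) : ℂ) := by
    rw [← integral_complex_ofReal]
    exact integral_congr_ae (Eventually.of_forall h)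
  rw [this, ← ofReal_norm, Complex.norm_real,
    Real.norm_of_nonneg (integral_nonneg fun _ => norm_nonneg _),
    ofReal_integral_eq_lintegral_ofReal hF.norm (Eventually.of_forall fun _ => norm_nonneg _)]
  simp only [ofReal_norm]

theorem rpow_le_add_rpow {a b y : ℝ} (ha : 0 < a) (hay : a ≤ y) (hyb : y ≤ b) (s : ℝ) :
    y ^ s ≤ a ^ s + b ^ s := by
  have hy : 0 < y := ha.trans_le hay
  rcases le_total 0 s with hs | hs
  · have := Real.rpow_le_rpow hy.le hyb hs
    have := Real.rpow_pos_of_pos ha s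
    linarith
  · have := Real.rpow_le_rpow_of_nonpos ha hay hs
    have := Real.rpow_pos_of_pos (hy.trans_le hyb) s
    linarith

theorem lintegral_le_of_duality_aux {q r : ℝ} (hq : 2 < q) (hr : 2 < r) {u : ℝ × Eucl n → ℂ}
    (hu : Measurable u) {B : ℝ} (hB : ∀ z, ‖u z‖ ≤ B) {K : ℝ≥0∞}
    (hK : ∀ f : ℝ × Eucl n → ℂ, IsTest f → ‖∫ z, f z * u z‖ₑ
      ≤ K * (∫⁻ t, dualNorm r (fun x => f (t, x)) ^ (q / (q - 1))) ^ ((q - 1) / q))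
    {M : ℝ} (hM : 0 < M) {I : ℝ → ℝ≥0∞}
    (hI : ∀ t, I t = ∫⁻ x in Metric.closedBall (0 : Eucl n) M, ‖u (t, x)‖ₑ ^ r)
    {T : Set ℝ} (hT : T = {t | |t| ≤ M ∧ ENNReal.ofReal M⁻¹ ≤ I t}) :
    ∫⁻ t in T, I t ^ (q / r) ≤ K ^ q := by
  have hq0 : 0 < q := by linarith
  have hr0 : 0 < r := by linarith
  have hq1 : 0 < q - 1 := by linarith
  have hr1 : 0 < r - 1 := by linarith
  set S := Metric.closedBall (0 : Eucl n) M with hS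
  have hSm : MeasurableSet S := measurableSet_closedBall
  have hSfin : volume S ≠ ∞ := (isCompact_closedBall _ _).measure_lt_top.ne
  have hB0 : 0 ≤ B := (norm_nonneg _).trans (hB 0)
  have hIm : Measurable I := by
    rw [show I = _ from funext hI]
    exact Measurable.lintegral_prod_right' (f := fun z : ℝ × Eucl n => ‖u z‖ₑ ^ r)
      (hu.enorm.pow_const r)
  set L : ℝ≥0∞ := ENNReal.ofReal B ^ r * volume S with hL
  have hLfin : L ≠ ∞ := ENNReal.mul_ne_top
    (ENNReal.rpow_lt_top_of_nonneg hr0.le ENNReal.ofReal_ne_top).ne hSfin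
  have hIL : ∀ t, I t ≤ L := fun t => by
    rw [hI, hL, ← setLIntegral_const]
    refine lintegral_mono fun x => ?_
    rw [← ofReal_norm]
    gcongr
    exact hB _
  have hIfin : ∀ t, I t ≠ ∞ := fun t => ((hIL t).trans_lt hLfin.lt_top).ne
  have hTm : MeasurableSet T := by
    rw [hT]
    exact (measurableSet_le measurable_norm measurable_const).inter
      (measurableSet_le measurable_const hIm)
  have hTpos : ∀ t ∈ T, 0 < I t := fun t ht => by
    rw [hT] at ht
    exact (ENNReal.ofReal_pos.mpr (by positivity)).trans_le ht.2
  have hTvol : volume T ≠ ∞ := by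
    refine ((measure_mono (t := Metric.closedBall 0 M) fun t ht => ?_).trans_lt
      (isCompact_closedBall (0 : ℝ) M).measure_lt_top).ne
    rw [hT] at ht
    simpa using ht.1
  set J := ∫⁻ t in T, I t ^ (q / r) with hJ
  have hJfin : J ≠ ∞ := by
    refine ((lintegral_mono (g := fun _ => L ^ (q / r)) fun t => ?_).trans_lt ?_).ne
    · exact ENNReal.rpow_le_rpow (hIL t) (by positivity)
    · rw [setLIntegral_const]
      exact ENNReal.mul_lt_top (ENNReal.rpow_lt_top_of_nonneg (by positivity) hLfin) hTvol.lt_top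
  classical
  set D : Set (ℝ × Eucl n) := T ×ˢ S with hD
  have hDm : MeasurableSet D := hTm.prod hSm
  set c : ℝ × Eucl n → ℝ := fun z => ‖u z‖ ^ (r - 2) * (I z.1).toReal ^ ((q - r) / r) with hc
  have hcm : Measurable c := (hu.norm.pow_const _).mul
    (((hIm.comp measurable_fst).ennreal_toReal).pow_const _)
  have hc0 : ∀ z, 0 ≤ c z := fun z => by positivity
  set f : ℝ × Eucl n → ℂ := D.indicator fun z => (c z : ℂ) * starRingEnd ℂ (u z) with hf
  have hfm : Measurable f := ((Complex.measurable_ofReal.comp hcm).mul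
    (Complex.continuous_conj.measurable.comp hu)).indicator hDm
  have hft : IsTest f := by
    refine ⟨hfm, ⟨B ^ (r - 2) * ((M⁻¹) ^ ((q - r) / r) + L.toReal ^ ((q - r) / r)) * B,
      fun z => ?_⟩, ⟨M, fun z hz => ?_⟩⟩
    · rw [hf]
      by_cases hz : z ∈ D
      · rw [Set.indicator_of_mem hz, norm_mul, RCLike.norm_conj, Complex.norm_real,
          Real.norm_of_nonneg (hc0 z)]
        have h1 : z.1 ∈ T := hz.1
        rw [hT] at h1
        have h2 : (I z.1).toReal ^ ((q - r) / r)
            ≤ (M⁻¹) ^ ((q - r) / r) + L.toReal ^ ((q - r) / r) := by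
          refine rpow_le_add_rpow (by positivity) ?_ ?_ _
          · exact (ENNReal.ofReal_le_iff_le_toReal (hIfin _)).mp h1.2
          · exact ENNReal.toReal_mono hLfin (hIL _)
        have h3 : ‖u z‖ ^ (r - 2) ≤ B ^ (r - 2) :=
          Real.rpow_le_rpow (norm_nonneg _) (hB z) (by linarith)
        have := hB z
        simp only [hc]
        gcongr
      · rw [Set.indicator_of_notMem hz, norm_zero]
        positivity
    · have hzD : z ∈ D := by
        by_contra h
        exact hz (Set.indicator_of_notMem h _)
      have h1 : z.1 ∈ T := hzD.1
      rw [hT] at h1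
      have h2 : z.2 ∈ S := hzD.2
      rw [hS, mem_closedBall_zero_iff] at h2
      exact max_le h1.1 h2
  have hfe : ∀ t x, ‖f (t, x)‖ₑ
      = T.indicator (fun t => I t ^ ((q - r) / r)) t *
            S.indicator (fun x => ‖u (t, x)‖ₑ ^ (r - 1)) x := by
    intro t x
    by_cases ht : t ∈ T
    · by_cases hx : x ∈ S
      · rw [hf, Set.indicator_of_mem (show (t, x) ∈ D from ⟨ht, hx⟩), Set.indicator_of_mem ht,
          Set.indicator_of_mem hx, enorm_mul, RCLike.enorm_conj, ← ofReal_norm (c (t, x) : ℂ),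
          Complex.norm_real, Real.norm_of_nonneg (hc0 _), hc, ENNReal.ofReal_mul (by positivity),
          ← ENNReal.ofReal_rpow_of_nonneg (norm_nonneg _) (by linarith),
          ← ENNReal.ofReal_rpow_of_pos (ENNReal.toReal_pos (hTpos t ht).ne' (hIfin t)),
          ENNReal.ofReal_toReal (hIfin t), ofReal_norm,
          show r - 1 = (r - 2) + 1 by ring,
          ENNReal.rpow_add_of_nonneg _ _ (by linarith) (by norm_num), ENNReal.rpow_one]
        ring
      · rw [hf, Set.indicator_of_notMem (fun h : (t, x) ∈ D => hx h.2), Set.indicator_of_notMem hx,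
          enorm_zero, mul_zero]
    · rw [hf, Set.indicator_of_notMem (fun h : (t, x) ∈ D => ht h.1), Set.indicator_of_notMem ht,
          enorm_zero, zero_mul]
  have hSi : ∀ (a : ℝ≥0∞) t,
      ∫⁻ x, a * S.indicator (fun x => ‖u (t, x)‖ₑ ^ r) x = a * I t := by
    intro a t
    have hut : Measurable fun x => ‖u (t, x)‖ₑ ^ r :=
      (hu.comp measurable_prodMk_left).enorm.pow_const r
    rw [lintegral_const_mul _ (hut.indicator hSm), lintegral_indicator hSm, ← hI]
  have hdual : ∀ t, dualNorm r (fun x => f (t, x)) ^ (q / (q - 1))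
      = T.indicator (fun t => I t ^ (q / r)) t := by
    intro t
    rw [dualNorm]
    simp only [hfe]
    by_cases ht : t ∈ T
    · have e : ∀ x, (I t ^ ((q - r) / r) * S.indicator (fun x => ‖u (t, x)‖ₑ ^ (r - 1)) x)
            ^ (r / (r - 1))
          = (I t ^ ((q - r) / r)) ^ (r / (r - 1)) * S.indicator (fun x => ‖u (t, x)‖ₑ ^ r) x := by
        intro x
        rw [ENNReal.mul_rpow_of_nonneg _ _ (by positivity)]
        congr 1
        by_cases hx : x ∈ S
        · rw [Set.indicator_of_mem hx, Set.indicator_of_mem hx, ← ENNReal.rpow_mul]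
          congr 1
          field_simp
        · rw [Set.indicator_of_notMem hx, Set.indicator_of_notMem hx,
            ENNReal.zero_rpow_of_pos (by positivity)]
      have hpos := (hTpos t ht).ne'
      simp only [Set.indicator_of_mem ht]
      simp only [e]
      rw [hSi, ← ENNReal.rpow_mul, ← ENNReal.rpow_mul]
      nth_rewrite 2 [← ENNReal.rpow_one (I t)]
      rw [← ENNReal.rpow_add _ _ hpos (hIfin t), ← ENNReal.rpow_mul]
      congr 1
      field_simp
      ring
    · simp only [Set.indicator_of_notMem ht, zero_mul]
      rw [ENNReal.zero_rpow_of_pos (by positivity), lintegral_zero,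
        ENNReal.zero_rpow_of_pos (by positivity), ENNReal.zero_rpow_of_pos (by positivity)]
  have hpair : ‖∫ z, f z * u z‖ₑ = J := by
    rw [enorm_integral_of_nonneg]
    · have hm : Measurable fun z => ‖f z * u z‖ₑ := (hfm.mul hu).enorm
      rw [Measure.volume_eq_prod, lintegral_prod _ hm.aemeasurable, hJ, ← lintegral_indicator hTm]
      refine lintegral_congr fun t => ?_
      simp only [enorm_mul, hfe]
      by_cases ht : t ∈ T
      · simp only [Set.indicator_of_mem ht]
        have e : ∀ x, I t ^ ((q - r) / r) * S.indicator (fun x => ‖u (t, x)‖ₑ ^ (r - 1)) x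
              * ‖u (t, x)‖ₑ
            = I t ^ ((q - r) / r) * S.indicator (fun x => ‖u (t, x)‖ₑ ^ r) x := by
          intro x
          rw [mul_assoc]
          congr 1
          by_cases hx : x ∈ S
          · rw [Set.indicator_of_mem hx, Set.indicator_of_mem hx]
            nth_rewrite 2 [← ENNReal.rpow_one ‖u (t, x)‖ₑ]
            rw [← ENNReal.rpow_add_of_nonneg _ _ hr1.le zero_le_one, sub_add_cancel]
          · rw [Set.indicator_of_notMem hx, Set.indicator_of_notMem hx, zero_mul]
        simp only [e]
        rw [hSi]
        nth_rewrite 2 [← ENNReal.rpow_one (I t)]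
        rw [← ENNReal.rpow_add _ _ (hTpos t ht).ne' (hIfin t)]
        congr 1
        field_simp
        ring
      · simp only [Set.indicator_of_notMem ht, zero_mul, lintegral_zero]
    · exact (hft.integrable.bdd_mul (c := B) hu.aestronglyMeasurable
        (Eventually.of_forall hB)).congr (Eventually.of_forall fun z => mul_comm _ _)
    · intro z
      rw [hf]
      by_cases hz : z ∈ D
      · rw [Set.indicator_of_mem hz, mul_assoc, mul_comm _ (u z), Complex.mul_conj', norm_mul,
          Complex.norm_real, Real.norm_of_nonneg (hc0 z), ← Complex.ofReal_pow, Complex.norm_real,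
          Real.norm_of_nonneg (by positivity)]
        push_cast
        rfl
      · rw [Set.indicator_of_notMem hz]
        simp
  have key := hK f hft
  rw [hpair] at key
  simp only [hdual] at key
  rw [lintegral_indicator hTm, ← hJ] at key
  rcases eq_or_ne J 0 with h0 | h0
  · rw [h0]; exact zero_le
  have hJ1 : J ^ (1 / q) ≤ K := by
    have h1 : J = J ^ (1 / q) * J ^ ((q - 1) / q) := by
      rw [← ENNReal.rpow_add _ _ h0 hJfin, show 1 / q + (q - 1) / q = 1 by field_simp; ring,
        ENNReal.rpow_one]
    nth_rewrite 1 [h1] at key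
    refine (ENNReal.mul_le_mul_iff_left ?_ ?_).mp key
    · exact (ENNReal.rpow_pos (pos_iff_ne_zero.mpr h0) hJfin).ne'
    · exact (ENNReal.rpow_lt_top_of_nonneg (by positivity) hJfin).ne
  calc J = (J ^ (1 / q)) ^ q := by
        rw [← ENNReal.rpow_mul, one_div_mul_cancel hq0.ne', ENNReal.rpow_one]
    _ ≤ K ^ q := by gcongr

theorem lintegral_le_of_duality {q r : ℝ} (hq : 2 < q) (hr : 2 < r) {u : ℝ × Eucl n → ℂ}
    (hu : Measurable u) {B : ℝ} (hB : ∀ z, ‖u z‖ ≤ B) {K : ℝ≥0∞}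
    (hK : ∀ f : ℝ × Eucl n → ℂ, IsTest f → ‖∫ z, f z * u z‖ₑ
      ≤ K * (∫⁻ t, dualNorm r (fun x => f (t, x)) ^ (q / (q - 1))) ^ ((q - 1) / q)) :
    ∫⁻ t, (∫⁻ x, ‖u (t, x)‖ₑ ^ r) ^ (q / r) ≤ K ^ q := by
  have hqr : 0 < q / r := div_pos (by linarith) (by linarith)
  set I : ℕ → ℝ → ℝ≥0∞ := fun M t =>
    ∫⁻ x in Metric.closedBall (0 : Eucl n) (M + 1 : ℝ), ‖u (t, x)‖ₑ ^ r with hI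
  set T : ℕ → Set ℝ := fun M => {t | |t| ≤ (M + 1 : ℝ) ∧ ENNReal.ofReal (M + 1 : ℝ)⁻¹ ≤ I M t}
    with hT
  have hImono : ∀ t, Monotone fun M => I M t := fun t M N h =>
    lintegral_mono_set (Metric.closedBall_subset_closedBall (by exact_mod_cast Nat.succ_le_succ h))
  have hIm : ∀ M, Measurable (I M) := fun M =>
    Measurable.lintegral_prod_right' (f := fun z : ℝ × Eucl n => ‖u z‖ₑ ^ r)
      (hu.enorm.pow_const r)
  have hTm : ∀ M, MeasurableSet (T M) := fun M =>
    (measurableSet_le measurable_norm measurable_const).inter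
      (measurableSet_le measurable_const (hIm M))
  have hTmono : Monotone T := fun M N h t ht => by
    have h' : (M : ℝ) ≤ N := by exact_mod_cast h
    refine ⟨ht.1.trans (by linarith), le_trans ?_ (ht.2.trans (hImono t h))⟩
    gcongr
  have hIt : ∀ t, Tendsto (fun M => I M t) atTop (𝓝 (∫⁻ x, ‖u (t, x)‖ₑ ^ r)) := by
    intro t
    have hut : Measurable fun x => ‖u (t, x)‖ₑ ^ r :=
      (hu.comp measurable_prodMk_left).enorm.pow_const r
    simp only [hI, ← lintegral_indicator measurableSet_closedBall]
    refine lintegral_tendsto_of_tendsto_of_monotone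
      (fun M => (hut.indicator measurableSet_closedBall).aemeasurable)
      (Eventually.of_forall fun x M N h => ?_) (Eventually.of_forall fun x => ?_)
    · refine Set.indicator_le_indicator_of_subset (Metric.closedBall_subset_closedBall ?_)
        (fun _ => zero_le) x
      exact_mod_cast Nat.succ_le_succ h
    · refine tendsto_const_nhds.congr' ?_
      obtain ⟨N, hN⟩ := exists_nat_ge ‖x‖
      filter_upwards [eventually_ge_atTop N] with M hM
      rw [Set.indicator_of_mem]
      rw [mem_closedBall_zero_iff]
      have : (N : ℝ) ≤ M := by exact_mod_cast hM
      linarith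
  have hlim : Tendsto (fun M => ∫⁻ t, (T M).indicator (fun t => I M t ^ (q / r)) t) atTop
      (𝓝 (∫⁻ t, (∫⁻ x, ‖u (t, x)‖ₑ ^ r) ^ (q / r))) := by
    refine lintegral_tendsto_of_tendsto_of_monotone
      (fun M => (((hIm M).pow_const _).indicator (hTm M)).aemeasurable)
      (Eventually.of_forall fun t M N h => ?_) (Eventually.of_forall fun t => ?_)
    · by_cases ht : t ∈ T M
      · simp only [Set.indicator_of_mem ht, Set.indicator_of_mem (hTmono h ht)]
        exact ENNReal.rpow_le_rpow (hImono t h) hqr.le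
      · simp only [Set.indicator_of_notMem ht]
        exact zero_le
    · have h1 : Tendsto (fun M => I M t ^ (q / r)) atTop
          (𝓝 ((∫⁻ x, ‖u (t, x)‖ₑ ^ r) ^ (q / r))) :=
        (ENNReal.continuous_rpow_const.tendsto _).comp (hIt t)
      refine h1.congr' ?_
      by_cases h0 : ∃ N, I N t ≠ 0
      · obtain ⟨N, hN⟩ := h0
        obtain ⟨N₁, hN₁⟩ := exists_nat_ge |t|
        have h2 : Tendsto (fun M : ℕ => ENNReal.ofReal ((M : ℝ) + 1)⁻¹) atTop (𝓝 0) := by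
          rw [← ENNReal.ofReal_zero]
          refine (ENNReal.continuous_ofReal.tendsto 0).comp ?_
          simpa [one_div] using tendsto_one_div_add_atTop_nhds_zero_nat (𝕜 := ℝ)
        filter_upwards [eventually_ge_atTop N, eventually_ge_atTop N₁,
          h2.eventually (eventually_le_nhds (pos_iff_ne_zero.mpr hN))] with M hM hM₁ hM₂
        rw [Set.indicator_of_mem]
        have : (N₁ : ℝ) ≤ M := by exact_mod_cast hM₁
        exact ⟨by linarith, hM₂.trans (hImono t hM)⟩
      · push Not at h0
        refine Eventually.of_forall fun M => ?_
        simp [Set.indicator, h0 M, ENNReal.zero_rpow_of_pos hqr]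
  refine le_of_tendsto' hlim fun M => ?_
  rw [lintegral_indicator (hTm M)]
  exact lintegral_le_of_duality_aux hq hr hu hB hK (M := (M + 1 : ℝ)) (by positivity)
    (fun t => rfl) rfl

end Duality

section Strichartz

variable {n : ℕ} (ε : Fin n → ℝ)

theorem dualNorm_ne_top {r : ℝ} (hr : 2 < r) {f : Eucl n → ℂ} (hf : IsTest f) :
    dualNorm r f ≠ ∞ := by
  have hr1 : 0 < r - 1 := by linarith
  have hr0 : 0 < r := by linarith
  have hp : 0 < r / (r - 1) := by positivity
  refine (ENNReal.rpow_lt_top_of_nonneg (by positivity) (LT.lt.ne ?_)).ne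
  have := lintegral_rpow_enorm_lt_top_of_eLpNorm_lt_top (p := ENNReal.ofReal (r / (r - 1)))
    (by simpa using hp) ENNReal.ofReal_ne_top (hf.memLp (μ := volume) _).2
  rwa [ENNReal.toReal_ofReal hp.le] at this

theorem measurable_dualNorm (r : ℝ) {f : ℝ × Eucl n → ℂ} (hf : Measurable f) :
    Measurable fun t => dualNorm r fun x => f (t, x) :=
  (Measurable.lintegral_prod_right' (f := fun z : ℝ × Eucl n => ‖f z‖ₑ ^ (r / (r - 1)))
    (hf.enorm.pow_const _)).pow_const _

theorem exists_restr_const (hε : ∀ i, ε i = 1 ∨ ε i = -1) {q r : ℝ} (hq : 2 < q) (hr : 2 < r)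
    (hqr : 2 / q = (n : ℝ) * (1 / 2 - 1 / r)) :
    ∃ C : ℝ≥0∞, C ≠ ∞ ∧ ∀ δ > 0, ∀ f : ℝ × Eucl n → ℂ, IsTest f →
      ∫⁻ ξ, ENNReal.ofReal (gaussW δ ξ) * ‖restr ε f ξ‖ₑ ^ (2 : ℝ)
        ≤ C * (∫⁻ t, dualNorm r (fun x => f (t, x)) ^ (q / (q - 1))) ^ (2 / (q / (q - 1))) := by
  have hq1 : 0 < q - 1 := by linarith
  have hq0 : 0 < q := by linarith
  obtain ⟨C₁, hC₁, h₁⟩ := exists_pairing_const ε hε hr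
  obtain ⟨C₂, hC₂, h₂⟩ := exists_hls_const (p := q / (q - 1))
    (by rw [one_lt_div hq1]; linarith) (by rw [div_lt_iff₀ hq1]; linarith)
  refine ⟨C₁ * C₂, ENNReal.mul_ne_top hC₁ hC₂, fun δ hδ f hf => ?_⟩
  set a : ℝ → ℝ := fun t => (dualNorm r fun x => f (t, x)).toReal with ha
  have ham : Measurable a := (measurable_dualNorm r hf.measurable).ennreal_toReal
  have hao : ∀ t, ENNReal.ofReal (a t) = dualNorm r fun x => f (t, x) := fun t =>
    ENNReal.ofReal_toReal (dualNorm_ne_top hr (hf.slice t))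
  have hexp : -(2 - 2 / (q / (q - 1))) = -((n : ℝ) * (1 / 2 - 1 / r)) := by
    rw [← hqr]
    field_simp
    ring
  have hconj : ∀ t, (dualNorm r fun x => starRingEnd ℂ (f (t, x))) =
        dualNorm r fun x => f (t, x) := by
    intro t
    simp only [dualNorm, RCLike.enorm_conj]
  calc _ ≤ ∫⁻ t, ∫⁻ s, ∫⁻ x, ‖f (t, x)‖ₑ *
          ‖∫ y, dispKer ε δ (t - s) (x - y) * starRingEnd ℂ (f (s, y))‖ₑ :=
        lintegral_gaussW_mul_restr_sq_le ε hδ hf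
    _ ≤ ∫⁻ t, ∫⁻ s, C₁ * (ENNReal.ofReal (|t - s| ^ (-(2 - 2 / (q / (q - 1)))))
          * (ENNReal.ofReal (a t) * ENNReal.ofReal (a s))) := by
        refine lintegral_mono fun t => lintegral_mono_ae ?_
        have : ∀ᵐ s : ℝ, s ≠ t := by
          rw [ae_iff]; simp
        filter_upwards [this] with s hs
        have hsl := (hf.slice s).conj
        have := h₁ δ hδ (t - s) (sub_ne_zero.mpr hs.symm) _ (fun x => f (t, x))
          hsl.measurable hsl.integrable (hsl.memLp 2) (hf.slice t).measurable
        rw [hexp, hao, hao, ← mul_assoc]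
        rwa [hconj] at this
    _ = C₁ * ∫⁻ t, ∫⁻ s, ENNReal.ofReal (|t - s| ^ (-(2 - 2 / (q / (q - 1)))))
          * (ENNReal.ofReal (a t) * ENNReal.ofReal (a s)) := by
        simp only [lintegral_const_mul' _ _ hC₁]
    _ ≤ C₁ * (C₂ * (∫⁻ t, ENNReal.ofReal (a t) ^ (q / (q - 1))) ^ (2 / (q / (q - 1)))) := by
        gcongr
        exact h₂ a (fun t => ENNReal.toReal_nonneg) ham
    _ = _ := by simp only [hao, mul_assoc]

/-- The extension operator `g ↦ ∫ e^{2πi⟨ξ,x⟩ - it|ξ|²_±} g(ξ) dξ`. -/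
def extn (g : Eucl n → ℂ) (t : ℝ) (x : Eucl n) : ℂ := ∫ ξ, phase ε t x ξ * g ξ

theorem measurable_extn {g : Eucl n → ℂ} (hg : Measurable g) :
    Measurable fun z : ℝ × Eucl n => extn ε g z.1 z.2 :=
  measurable_integral_right (f := fun (z : ℝ × Eucl n) ξ => phase ε z.1 z.2 ξ * g ξ)
    ((measurable_phase_comp ε (by fun_prop) (by fun_prop) (by fun_prop)).mul
      (hg.comp measurable_snd))

theorem norm_extn_le (g : Eucl n → ℂ) (t : ℝ) (x : Eucl n) : ‖extn ε g t x‖ ≤ ∫ ξ, ‖g ξ‖ := by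
  refine (norm_integral_le_integral_norm _).trans_eq (integral_congr_ae
    (Eventually.of_forall fun ξ => ?_))
  simp only [norm_mul, norm_phase, one_mul]

theorem integral_mul_extn {f : ℝ × Eucl n → ℂ} (hf : IsTest f) {g : Eucl n → ℂ}
    (hg : Integrable g) :
    ∫ z, f z * extn ε g z.1 z.2 = ∫ ξ, g ξ * restr ε f ξ := by
  have hint : Integrable (Function.uncurry fun (z : ℝ × Eucl n) (ξ : Eucl n) =>
      phase ε z.1 z.2 ξ * (f z * g ξ)) (volume.prod volume) := by
    have h1 := (hf.integrable (μ := volume)).mul_prod hg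
    have hm : Measurable fun v : (ℝ × Eucl n) × Eucl n => phase ε v.1.1 v.1.2 v.2 :=
      measurable_phase_comp ε (by fun_prop) (by fun_prop) (by fun_prop)
    exact h1.bdd_mul (c := 1) hm.aestronglyMeasurable
      (Eventually.of_forall fun z => (norm_phase ε _ _ _).le)
  calc ∫ z, f z * extn ε g z.1 z.2 = ∫ z, ∫ ξ, phase ε z.1 z.2 ξ * (f z * g ξ) := by
        refine integral_congr_ae (Eventually.of_forall fun z => ?_)
        simp only [extn]
        rw [← integral_const_mul]
        refine integral_congr_ae (Eventually.of_forall fun ξ => ?_)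
        simp only
        ring
    _ = ∫ ξ, ∫ z, phase ε z.1 z.2 ξ * (f z * g ξ) := integral_integral_swap hint
    _ = _ := by
        refine integral_congr_ae (Eventually.of_forall fun ξ => ?_)
        simp only [restr]
        rw [← integral_const_mul]
        refine integral_congr_ae (Eventually.of_forall fun z => ?_)
        simp only
        ring

theorem exists_strichartz_const (hε : ∀ i, ε i = 1 ∨ ε i = -1) {q r : ℝ} (hq : 2 < q)
    (hr : 2 < r) (hqr : 2 / q = (n : ℝ) * (1 / 2 - 1 / r)) :
    ∃ C : ℝ≥0∞, C ≠ ∞ ∧ ∀ g : Eucl n → ℂ, Measurable g → Integrable g → ∀ R : ℝ,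
      (∀ ξ, g ξ ≠ 0 → ‖ξ‖ ≤ R) →
      (∫⁻ t, (∫⁻ x, ‖extn ε g t x‖ₑ ^ r) ^ (q / r)) ^ (1 / q)
        ≤ C * (∫⁻ ξ, ‖g ξ‖ₑ ^ (2 : ℝ)) ^ ((1 : ℝ) / 2) := by
  obtain ⟨C, hC, h⟩ := exists_restr_const ε hε hq hr hqr
  have hq1 : 0 < q - 1 := by linarith
  have hq0 : 0 < q := by linarith
  refine ⟨(ENNReal.ofReal (Real.exp 1) * C) ^ ((1 : ℝ) / 2), (ENNReal.rpow_lt_top_of_nonneg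
    (by positivity) (ENNReal.mul_ne_top ENNReal.ofReal_ne_top hC)).ne,
    fun g hg hgi R hR => ?_⟩
  set K := (ENNReal.ofReal (Real.exp 1) * C) ^ ((1 : ℝ) / 2) *
    (∫⁻ ξ, ‖g ξ‖ₑ ^ (2 : ℝ)) ^ ((1 : ℝ) / 2) with hK
  suffices hs : ∫⁻ t, (∫⁻ x, ‖extn ε g t x‖ₑ ^ r) ^ (q / r) ≤ K ^ q by
    calc _ ≤ (K ^ q) ^ (1 / q) := by gcongr
      _ = K := by rw [← ENNReal.rpow_mul, mul_one_div_cancel hq0.ne', ENNReal.rpow_one]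
  refine lintegral_le_of_duality hq hr (u := fun z => extn ε g z.1 z.2) (measurable_extn ε hg)
    (B := ∫ ξ, ‖g ξ‖) (fun z => norm_extn_le ε g _ _) fun f hf => ?_
  set R' := max R 1 with hR'
  have hR0 : 0 < R' := lt_max_of_lt_right one_pos
  have hw : ∀ ξ, ‖g ξ * restr ε f ξ‖ₑ ≤ ‖g ξ‖ₑ * (ENNReal.ofReal (Real.exp 1) ^ ((1 : ℝ) / 2) *
      (ENNReal.ofReal (gaussW (1 / R' ^ 2) ξ) ^ ((1 : ℝ) / 2) * ‖restr ε f ξ‖ₑ)) := by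
    intro ξ
    by_cases h0 : g ξ = 0
    · simp [h0]
    rw [enorm_mul, ← mul_assoc (_ ^ _), ← ENNReal.mul_rpow_of_nonneg _ _ (by norm_num),
      ← ENNReal.ofReal_mul (Real.exp_pos _).le, gaussW, ← Real.exp_add]
    gcongr
    refine le_mul_of_one_le_left zero_le (ENNReal.one_le_rpow ?_ (by norm_num))
    rw [← ENNReal.ofReal_one]
    refine ENNReal.ofReal_le_ofReal (Real.one_le_exp ?_)
    have h1 : ‖ξ‖ ≤ R' := (hR ξ h0).trans (le_max_left _ _)
    have h2 : ‖ξ‖ ^ 2 ≤ R' ^ 2 := by gcongr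
    have h3 : 1 / R' ^ 2 * ‖ξ‖ ^ 2 ≤ 1 := by
      rw [one_div_mul_eq_div, div_le_one (by positivity)]
      exact h2
    linarith
  have hrm := measurable_restr ε hf.measurable
  have hgm : Measurable (gaussW (1 / R' ^ 2) : Eucl n → ℝ) := measurable_gaussW _
  rw [integral_mul_extn ε hf hgi]
  calc ‖∫ ξ, g ξ * restr ε f ξ‖ₑ
      ≤ ∫⁻ ξ, ‖g ξ‖ₑ * (ENNReal.ofReal (Real.exp 1) ^ ((1 : ℝ) / 2) *
      (ENNReal.ofReal (gaussW (1 / R' ^ 2) ξ) ^ ((1 : ℝ) / 2) * ‖restr ε f ξ‖ₑ)) :=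
        (enorm_integral_le_lintegral_enorm _).trans (lintegral_mono hw)
    _ ≤ (∫⁻ ξ, ‖g ξ‖ₑ ^ (2 : ℝ)) ^ ((1 : ℝ) / 2) *
        (∫⁻ ξ, (ENNReal.ofReal (Real.exp 1) ^ ((1 : ℝ) / 2) *
      (ENNReal.ofReal (gaussW (1 / R' ^ 2) ξ) ^ ((1 : ℝ) / 2) * ‖restr ε f ξ‖ₑ)) ^ (2 : ℝ))
        ^ ((1 : ℝ) / 2) :=
        ENNReal.lintegral_mul_le_Lp_mul_Lq _ Real.HolderConjugate.two_two hg.enorm.aemeasurable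
          (((hgm.ennreal_ofReal.pow_const _).mul hrm.enorm).const_mul _).aemeasurable
    _ = (∫⁻ ξ, ‖g ξ‖ₑ ^ (2 : ℝ)) ^ ((1 : ℝ) / 2) * (ENNReal.ofReal (Real.exp 1) *
          ∫⁻ ξ, ENNReal.ofReal (gaussW (1 / R' ^ 2) ξ) * ‖restr ε f ξ‖ₑ ^ (2 : ℝ))
            ^ ((1 : ℝ) / 2) := by
        rw [← lintegral_const_mul' _ _ ENNReal.ofReal_ne_top]
        congr 3
        ext ξ
        rw [ENNReal.mul_rpow_of_nonneg _ _ (by norm_num),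
          ENNReal.mul_rpow_of_nonneg _ _ (by norm_num), ← ENNReal.rpow_mul, ← ENNReal.rpow_mul]
        norm_num
    _ ≤ (∫⁻ ξ, ‖g ξ‖ₑ ^ (2 : ℝ)) ^ ((1 : ℝ) / 2) * (ENNReal.ofReal (Real.exp 1) *
          (C * (∫⁻ t, dualNorm r (fun x => f (t, x)) ^ (q / (q - 1))) ^ (2 / (q / (q - 1)))))
            ^ ((1 : ℝ) / 2) := by
        gcongr
        exact h _ (by positivity) f hf
    _ = _ := by
        rw [hK, ← mul_assoc (ENNReal.ofReal _), ENNReal.mul_rpow_of_nonneg _ _ (by norm_num),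
          ← ENNReal.rpow_mul, show 2 / (q / (q - 1)) * (1 / 2) = (q - 1) / q by field_simp]
        ring

end Strichartz

section Geometry

variable {n : ℕ}

/-- Coordinates `(r, v) ↦ r e + v` adapted to the splitting `ℝe ⊕ P_e`. -/
def splitMap (e : Eucl n) (z : ℝ × hyperplane e) : Eucl n := z.1 • e + (z.2 : Eucl n)

theorem continuous_splitMap (e : Eucl n) : Continuous (splitMap e) := by
  unfold splitMap
  fun_prop

theorem measurePreserving_smul_add_orthogonal {e : Eucl n} (he : ‖e‖ = 1) :
    MeasurePreserving (fun z : ℝ × ((ℝ ∙ e)ᗮ : Submodule ℝ (Eucl n)) =>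
      z.1 • e + (z.2 : Eucl n)) := by
  have h1 : MeasurePreserving (fun z : ℝ × ((ℝ ∙ e)ᗮ : Submodule ℝ (Eucl n)) =>
      (LinearIsometryEquiv.toSpanUnitSingleton e he z.1, z.2)) :=
    (LinearIsometryEquiv.measurePreserving _).prod (MeasurePreserving.id volume)
  have h2 := WithLp.volume_preserving_toLp (U := (ℝ ∙ e : Submodule ℝ (Eucl n)))
    (V := ((ℝ ∙ e)ᗮ : Submodule ℝ (Eucl n)))
  have h3 := ((ℝ ∙ e).orthogonalDecomposition).symm.measurePreserving
  have h4 := h3.comp (h2.comp h1)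
  convert h4 using 1
  funext z
  simp [Submodule.orthogonalDecomposition_symm_apply]

theorem measurePreserving_splitMap {e : Eucl n} (he : ‖e‖ = 1) :
    MeasurePreserving (splitMap e) :=
  measurePreserving_smul_add_orthogonal he

/-- The orthogonal projection onto `P_e`. -/
def hypP (e ξ : Eucl n) : hyperplane e := (hyperplane e).orthogonalProjectionOnto ξ

theorem continuous_hypP (e : Eucl n) : Continuous (hypP e) :=
  ((hyperplane e).orthogonalProjectionOnto).continuous

theorem norm_hypP_le (e ξ : Eucl n) : ‖hypP e ξ‖ ≤ ‖ξ‖ :=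
  (hyperplane e).norm_orthogonalProjectionOnto_apply_le ξ

theorem hypP_splitMap (e : Eucl n) (z : ℝ × hyperplane e) : hypP e (splitMap e z) = z.2 := by
  unfold hypP splitMap
  have h1 : (hyperplane e).orthogonalProjectionOnto (z.1 • e) = 0 := by
    rw [map_smul]
    have : (hyperplane e).orthogonalProjectionOnto e = 0 :=
      Submodule.orthogonalProjectionOnto_orthogonalComplement_singleton_eq_zero e
    rw [this, smul_zero]
  rw [map_add, h1, zero_add, Submodule.orthogonalProjectionOnto_mem_subspace_eq_self]

theorem inner_hyperplane {e : Eucl n} (v : hyperplane e) : inner ℝ e (v : Eucl n) = 0 :=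
  Submodule.mem_orthogonal_singleton_iff_inner_right.mp v.2

theorem inner_splitMap {e : Eucl n} (he : ‖e‖ = 1) (y z : ℝ × hyperplane e) :
    inner ℝ (splitMap e y) (splitMap e z) = y.1 * z.1 + inner ℝ y.2 z.2 := by
  unfold splitMap
  rw [inner_add_left, inner_add_right, inner_add_right, inner_smul_left, inner_smul_right,
    inner_smul_left, inner_smul_right, inner_hyperplane, real_inner_self_eq_norm_sq, he,
    real_inner_comm, inner_hyperplane, Submodule.coe_inner]
  simp

theorem splitMap_apply_single (k : Fin n) (z : ℝ × hyperplane (EuclideanSpace.single k (1 : ℝ))) :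
    splitMap _ z k = z.1 := by
  have h := inner_hyperplane z.2
  rw [EuclideanSpace.inner_single_left] at h
  simp only [map_one, one_mul] at h
  simp [splitMap, h]

theorem quadSym_splitMap (ε : Fin n → ℝ) (k : Fin n)
    (z : ℝ × hyperplane (EuclideanSpace.single k (1 : ℝ))) :
    quadSym ε (splitMap _ z) = ε k * z.1 ^ 2 + quadSym ε (z.2 : Eucl n) := by
  have h := inner_hyperplane z.2
  rw [EuclideanSpace.inner_single_left] at h
  simp only [map_one, one_mul] at h
  unfold quadSym
  rw [← Finset.add_sum_erase _ _ (Finset.mem_univ k),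
    ← Finset.add_sum_erase _ _ (Finset.mem_univ k),
    splitMap_apply_single, h]
  have : ∀ i ∈ Finset.univ.erase k, ε i * (splitMap _ z i) ^ 2 = ε i * ((z.2 : Eucl n) i) ^ 2 := by
    intro i hi
    have : i ≠ k := Finset.ne_of_mem_erase hi
    simp [splitMap, this]
  rw [Finset.sum_congr rfl this]
  ring

theorem lintegral_splitMap {e : Eucl n} (he : ‖e‖ = 1) {f : Eucl n → ℝ≥0∞} (hf : Measurable f) :
    ∫⁻ ξ, f ξ = ∫⁻ ζ : hyperplane e, ∫⁻ η : ℝ, f (splitMap e (η, ζ)) := by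
  rw [← (measurePreserving_splitMap he).lintegral_comp hf, Measure.volume_eq_prod]
  exact lintegral_prod_symm' (fun z => f (splitMap e z))
    (hf.comp (continuous_splitMap e).measurable)

end Geometry

section OneDim

theorem lintegral_branch_le {c σ b : ℝ} (hc : 0 < c) (hσ : σ = 1 ∨ σ = -1) {s : Set ℝ}
    (hs : MeasurableSet s) (hcs : ∀ η ∈ s, c ≤ |η|) (hsgn : ∀ η ∈ s, ∀ η' ∈ s, 0 ≤ η * η')
    (P : ℝ → ℝ≥0∞) :
    ∫⁻ η in s, P (σ * η ^ 2 + b) ≤ ENNReal.ofReal (1 / (2 * c)) * ∫⁻ τ, P τ := by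
  have hσ1 : |σ| = 1 := by rcases hσ with h | h <;> simp [h]
  have hσ0 : σ ≠ 0 := by rcases hσ with h | h <;> simp [h]
  have hder : ∀ x ∈ s, HasDerivWithinAt (fun η : ℝ => σ * η ^ 2 + b) (σ * (2 * x)) s x := by
    intro x _
    have := (((hasDerivAt_pow 2 x).const_mul σ).add_const b).hasDerivWithinAt (s := s)
    simpa using this
  have hinj : Set.InjOn (fun η : ℝ => σ * η ^ 2 + b) s := by
    intro x hx y hy hxy
    have h1 : x ^ 2 = y ^ 2 := by
      have := add_right_cancel hxy
      exact mul_left_cancel₀ hσ0 this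
    rcases sq_eq_sq_iff_eq_or_eq_neg.mp h1 with h | h
    · exact h
    · have := hsgn x hx y hy
      have h2 := hcs y hy
      have : y = 0 := by
        rw [h] at this
        nlinarith [sq_nonneg y]
      rw [this, abs_zero] at h2
      linarith
  have key := lintegral_image_eq_lintegral_abs_deriv_mul hs hder hinj P
  calc ∫⁻ η in s, P (σ * η ^ 2 + b)
      ≤ ∫⁻ η in s, ENNReal.ofReal (1 / (2 * c)) *
          (ENNReal.ofReal |σ * (2 * η)| * P (σ * η ^ 2 + b)) := by
        refine setLIntegral_mono_ae' hs (Eventually.of_forall fun η hη => ?_)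
        rw [← mul_assoc, ← ENNReal.ofReal_mul (by positivity), abs_mul, hσ1, one_mul, abs_mul,
          abs_of_pos (two_pos (α := ℝ))]
        have : 1 ≤ 1 / (2 * c) * (2 * |η|) := by
          rw [one_div, ← div_eq_inv_mul, one_le_div (by positivity)]
          linarith [hcs η hη]
        calc P (σ * η ^ 2 + b) = 1 * P (σ * η ^ 2 + b) := (one_mul _).symm
          _ ≤ _ := by
            gcongr
            rw [← ENNReal.ofReal_one]
            exact ENNReal.ofReal_le_ofReal this
    _ = ENNReal.ofReal (1 / (2 * c)) * ∫⁻ η in s,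
          ENNReal.ofReal |σ * (2 * η)| * P (σ * η ^ 2 + b) :=
        lintegral_const_mul' _ _ ENNReal.ofReal_ne_top
    _ ≤ _ := by
        rw [← key]
        gcongr
        exact Measure.restrict_le_self

theorem lintegral_sq_le {c σ b : ℝ} (hc : 0 < c) (hσ : σ = 1 ∨ σ = -1) (P : ℝ → ℝ≥0∞) :
    ∫⁻ η in {η : ℝ | c ≤ |η|}, P (σ * η ^ 2 + b) ≤ ENNReal.ofReal (1 / c) * ∫⁻ τ, P τ := by
  have hset : {η : ℝ | c ≤ |η|} = Set.Ici c ∪ Set.Iic (-c) := by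
    ext η
    simp only [Set.mem_ofPred_eq, Set.mem_union, Set.mem_Ici, Set.mem_Iic, le_abs]
    refine or_congr Iff.rfl ⟨fun h => by linarith, fun h => by linarith⟩
  rw [hset]
  refine (lintegral_union_le _ _ _).trans ?_
  have h1 := lintegral_branch_le (b := b) hc hσ (measurableSet_Ici (a := c))
    (fun η hη => (Set.mem_Ici.mp hη).trans (le_abs_self η))
    (fun η hη η' hη' => mul_nonneg (hc.le.trans hη) (hc.le.trans hη')) P
  have h2 := lintegral_branch_le (b := b) hc hσ (measurableSet_Iic (a := -c))
    (fun η hη => le_abs.mpr (Or.inr (by linarith [Set.mem_Iic.mp hη])))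
    (fun η hη η' hη' => mul_nonneg_of_nonpos_of_nonpos (by linarith [Set.mem_Iic.mp hη])
      (by linarith [Set.mem_Iic.mp hη'])) P
  refine (add_le_add h1 h2).trans_eq ?_
  rw [← add_mul, ← ENNReal.ofReal_add (by positivity) (by positivity)]
  congr 2
  field_simp
  norm_num

theorem lintegral_time_plancherel {h : ℝ → ℂ} (h1 : Integrable h) (h2 : MemLp h 2) :
    ∫⁻ τ : ℝ, ‖∫ s : ℝ, cexp (((s * τ : ℝ) : ℂ) * Complex.I) * h s‖ₑ ^ (2 : ℝ)
      = ENNReal.ofReal (2 * Real.pi) * ∫⁻ s, ‖h s‖ₑ ^ (2 : ℝ) := by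
  have hpi := Real.pi_pos
  have key := lintegral_image_eq_lintegral_abs_deriv_mul (s := Set.univ) MeasurableSet.univ
    (f := fun w : ℝ => -(2 * Real.pi) * w) (f' := fun _ => -(2 * Real.pi))
    (fun x _ => (hasDerivAt_const_mul (-(2 * Real.pi))).hasDerivWithinAt)
    (fun x _ y _ hxy => mul_left_cancel₀ (by simp [hpi.ne']) hxy)
    (fun τ => ‖∫ s : ℝ, cexp (((s * τ : ℝ) : ℂ) * Complex.I) * h s‖ₑ ^ (2 : ℝ))
  have himg : (fun w : ℝ => -(2 * Real.pi) * w) '' Set.univ = Set.univ := by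
    rw [Set.image_univ]
    exact (mul_left_surjective₀ (by simp [hpi.ne'])).range_eq
  rw [himg, setLIntegral_univ, setLIntegral_univ] at key
  rw [key, lintegral_const_mul' _ _ ENNReal.ofReal_ne_top, abs_neg, abs_of_pos (by positivity)]
  congr 1
  have hF : ∀ w : ℝ, ∫ s : ℝ, cexp (((s * (-(2 * Real.pi) * w) : ℝ) : ℂ) * Complex.I) * h s
      = 𝓕 h w := by
    intro w
    rw [Real.fourier_real_eq_integral_exp_smul]
    refine integral_congr_ae (Eventually.of_forall fun s => ?_)
    simp only [smul_eq_mul]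
    congr 3
    push_cast
    ring
  simp only [hF]
  rw [lintegral_enorm_rpow_two, lintegral_enorm_rpow_two, eLpNorm_fourier_two h1 h2]

end OneDim

/-- Measurable functions of `(s, v)` decaying in `s` and boundedly supported in `v`. -/
structure IsGood {V : Type*} [NormedAddCommGroup V] [MeasurableSpace V] (h : ℝ × V → ℂ) :
    Prop where
  measurable : Measurable h
  decay : ∃ C : ℝ, ∀ z, ‖h z‖ ≤ C * (1 + z.1 ^ 2)⁻¹
  support : ∃ R : ℝ, ∀ z, h z ≠ 0 → ‖z.2‖ ≤ R

/-- Restriction of a function of `(s, v)` to times in `S`. -/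
def cut {V : Type*} (S : Set ℝ) (h : ℝ × V → ℂ) : ℝ × V → ℂ := (Prod.fst ⁻¹' S).indicator h

theorem cut_apply {V : Type*} (S : Set ℝ) (h : ℝ × V → ℂ) (s : ℝ) (v : V) :
    cut S h (s, v) = S.indicator (fun s => h (s, v)) s := by
  by_cases hs : s ∈ S
  · rw [cut, Set.indicator_of_mem (show (s, v) ∈ Prod.fst ⁻¹' S from hs),
      Set.indicator_of_mem hs]
  · rw [cut, Set.indicator_of_notMem (show (s, v) ∉ Prod.fst ⁻¹' S from hs),
      Set.indicator_of_notMem hs]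

theorem norm_cut_le {V : Type*} (S : Set ℝ) (h : ℝ × V → ℂ) (z : ℝ × V) :
    ‖cut S h z‖ ≤ ‖h z‖ := norm_indicator_le_norm_self _ _

theorem cut_add_cut_compl {V : Type*} (S : Set ℝ) (h : ℝ × V → ℂ) :
    cut S h + cut Sᶜ h = h := Set.indicator_self_add_compl _ _

theorem cut_cut {V : Type*} (S T : Set ℝ) (h : ℝ × V → ℂ) :
    cut S (cut T h) = cut (S ∩ T) h := by
  unfold cut
  rw [Set.indicator_indicator, Set.preimage_inter]

section Good

variable {V : Type*} [NormedAddCommGroup V] [MeasurableSpace V]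

theorem IsGood.cut {h : ℝ × V → ℂ} (hh : IsGood h) {S : Set ℝ} (hS : MeasurableSet S) :
    IsGood (cut S h) := by
  obtain ⟨C, hC⟩ := hh.decay
  obtain ⟨R, hR⟩ := hh.support
  refine ⟨hh.measurable.indicator (measurable_fst hS),
    ⟨C, fun z => (norm_cut_le S h z).trans (hC z)⟩, ⟨R, fun z hz => hR z fun h0 => hz ?_⟩⟩
  have := norm_cut_le S h z
  rw [h0, norm_zero] at this
  exact norm_le_zero_iff.mp this

theorem IsGood.exists_bound {h : ℝ × V → ℂ} (hh : IsGood h) :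
    ∃ C : ℝ, 0 ≤ C ∧ ∀ z, ‖h z‖ ≤ C * (1 + z.1 ^ 2)⁻¹ ∧ ‖h z‖ ≤ C := by
  obtain ⟨C, hC⟩ := hh.decay
  refine ⟨|C|, abs_nonneg _, fun z => ?_⟩
  have h1 : ‖h z‖ ≤ |C| * (1 + z.1 ^ 2)⁻¹ :=
    (hC z).trans (mul_le_mul_of_nonneg_right (le_abs_self C) (by positivity))
  refine ⟨h1, h1.trans (mul_le_of_le_one_right (abs_nonneg _) ?_)⟩
  exact inv_le_one_of_one_le₀ (by nlinarith [sq_nonneg z.1])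

theorem IsGood.integrable_slice {h : ℝ × V → ℂ} (hh : IsGood h) (v : V) :
    Integrable fun s => h (s, v) := by
  obtain ⟨C, -, hC⟩ := hh.exists_bound
  exact (integrable_inv_one_add_sq.const_mul C).mono'
    (hh.measurable.comp measurable_prodMk_right).aestronglyMeasurable
    (Eventually.of_forall fun s => (hC (s, v)).1)

theorem IsGood.memLp_slice {h : ℝ × V → ℂ} (hh : IsGood h) (v : V) :
    MemLp (fun s => h (s, v)) 2 := by
  obtain ⟨C, -, hC⟩ := hh.exists_bound
  have hm : Measurable fun s => h (s, v) := hh.measurable.comp measurable_prodMk_right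
  rw [memLp_two_iff_integrable_sq_norm hm.aestronglyMeasurable]
  refine ((hh.integrable_slice v).norm.const_mul C).mono'
    ((hh.measurable.comp measurable_prodMk_right).norm.pow_const 2).aestronglyMeasurable
    (Eventually.of_forall fun s => ?_)
  rw [Real.norm_of_nonneg (by positivity), sq]
  exact mul_le_mul_of_nonneg_right (hC (s, v)).2 (norm_nonneg _)

theorem IsGood.lintegral_ne_top {h : ℝ × V → ℂ} (hh : IsGood h) {μ : Measure V} [SFinite μ]
    [BorelSpace V] [ProperSpace V] [IsFiniteMeasureOnCompacts μ] :
    ∫⁻ s : ℝ, (∫⁻ v, ‖h (s, v)‖ₑ ^ (2 : ℝ) ∂μ) ≠ ∞ := by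
  obtain ⟨C, hC0, hC⟩ := hh.exists_bound
  obtain ⟨R, hR⟩ := hh.support
  have hball : μ (Metric.closedBall 0 R) ≠ ∞ := (isCompact_closedBall _ _).measure_lt_top.ne
  have hs : ∀ s : ℝ, ∫⁻ v, ‖h (s, v)‖ₑ ^ (2 : ℝ) ∂μ
      ≤ ENNReal.ofReal (C * C * (1 + s ^ 2)⁻¹) * μ (Metric.closedBall 0 R) := by
    intro s
    rw [← setLIntegral_const, ← lintegral_indicator measurableSet_closedBall]
    refine lintegral_mono fun v => ?_
    by_cases hv : v ∈ Metric.closedBall (0 : V) R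
    · rw [Set.indicator_of_mem hv, ← ofReal_norm, ENNReal.ofReal_rpow_of_nonneg (norm_nonneg _)
        (by norm_num)]
      refine ENNReal.ofReal_le_ofReal ?_
      rw [Real.rpow_two, sq, mul_assoc]
      exact mul_le_mul (hC (s, v)).2 (hC (s, v)).1 (norm_nonneg _) hC0
    · have : h (s, v) = 0 := by
        by_contra h0
        exact hv (by simpa using hR _ h0)
      rw [this, enorm_zero, ENNReal.zero_rpow_of_pos (by norm_num)]
      exact zero_le
  refine ne_top_of_le_ne_top ?_ (lintegral_mono hs)
  rw [lintegral_mul_const' _ _ hball]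
  exact ENNReal.mul_ne_top
    ((integrable_inv_one_add_sq.const_mul (C * C)).lintegral_lt_top).ne hball

end Good

section LocalSmoothing

variable {n : ℕ} (ε : Fin n → ℝ)

/-- Frequency density of the free evolution generated by data on the hyperplane `P_e`. -/
def lsDens (e : Eucl n) (A : Set (Eucl n)) (h : ℝ × hyperplane e → ℂ) : Eucl n → ℂ :=
  A.indicator fun ξ => ∫ s : ℝ, starRingEnd ℂ (phase ε s 0 ξ) * h (s, hypP e ξ)

variable {ε} {e : Eucl n} {A : Set (Eucl n)} {h : ℝ × hyperplane e → ℂ}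

theorem measurable_conj_phase {X : Type*} [MeasurableSpace X] {a : X → ℝ} {b c : X → Eucl n}
    (ha : Measurable a) (hb : Measurable b) (hc : Measurable c) :
    Measurable fun x => starRingEnd ℂ (phase ε (a x) (b x) (c x)) :=
  Complex.continuous_conj.measurable.comp (measurable_phase_comp ε ha hb hc)

theorem measurable_lsDens (hA : MeasurableSet A) (hh : Measurable h) :
    Measurable (lsDens ε e A h) := by
  refine Measurable.indicator ?_ hA
  refine measurable_integral_right
    (f := fun ξ s => starRingEnd ℂ (phase ε s 0 ξ) * h (s, hypP e ξ)) ?_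
  have h1 : Measurable fun z : Eucl n × ℝ => starRingEnd ℂ (phase ε z.2 0 z.1) :=
    measurable_conj_phase (by fun_prop) (by fun_prop) (by fun_prop)
  have h2 : Measurable fun z : Eucl n × ℝ => h (z.2, hypP e z.1) :=
    hh.comp (f := fun z : Eucl n × ℝ => (z.2, hypP e z.1))
      (measurable_snd.prodMk ((continuous_hypP e).measurable.comp measurable_fst))
  exact h1.mul h2

theorem integrable_conj_phase_mul (hh : IsGood h) (ξ : Eucl n) (v : hyperplane e) :
    Integrable fun s : ℝ => starRingEnd ℂ (phase ε s 0 ξ) * h (s, v) :=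
  (hh.integrable_slice v).bdd_mul (c := 1)
    (measurable_conj_phase (by fun_prop) (by fun_prop) (by fun_prop)).aestronglyMeasurable
    (Eventually.of_forall fun s => by rw [RCLike.norm_conj, norm_phase])

theorem exists_norm_lsDens_le (hh : IsGood h) : ∃ B : ℝ, ∀ S ξ, ‖lsDens ε e A (cut S h) ξ‖ ≤ B := by
  obtain ⟨C, hC0, hC⟩ := hh.exists_bound
  refine ⟨∫ s : ℝ, C * (1 + s ^ 2)⁻¹, fun S ξ => ?_⟩
  refine (norm_indicator_le_norm_self _ _).trans (norm_integral_le_of_norm_le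
    (integrable_inv_one_add_sq.const_mul C) (Eventually.of_forall fun s => ?_))
  rw [norm_mul, RCLike.norm_conj, norm_phase, one_mul]
  exact (norm_cut_le _ _ _).trans (hC (s, hypP e ξ)).1

theorem cut_univ {V : Type*} (h : ℝ × V → ℂ) : cut Set.univ h = h := by
  unfold cut
  rw [Set.preimage_univ, Set.indicator_univ]

theorem integrable_lsDens (hA : MeasurableSet A) (hA' : Bornology.IsBounded A) (hh : IsGood h) :
    Integrable (lsDens ε e A h) := by
  obtain ⟨B, hB⟩ := exists_norm_lsDens_le (ε := ε) (A := A) hh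
  refine memLp_one_iff_integrable.mp (memLp_of_bounded_of_support
    (measurable_lsDens hA hh.measurable).aestronglyMeasurable (B := B) (s := A) (fun ξ => ?_) hA
    hA'.measure_lt_top.ne (fun ξ hξ => Set.indicator_of_notMem hξ _) 1)
  simpa only [cut_univ] using hB Set.univ ξ

theorem lsDens_add_compl (hh : IsGood h) {S : Set ℝ} (hS : MeasurableSet S) (ξ : Eucl n) :
    lsDens ε e A (cut S h) ξ + lsDens ε e A (cut Sᶜ h) ξ = lsDens ε e A h ξ := by
  by_cases hξ : ξ ∈ A
  · rw [lsDens, lsDens, lsDens, Set.indicator_of_mem hξ, Set.indicator_of_mem hξ,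
      Set.indicator_of_mem hξ, ← integral_add (integrable_conj_phase_mul (hh.cut hS) _ _)
      (integrable_conj_phase_mul (hh.cut hS.compl) _ _)]
    refine integral_congr_ae (Eventually.of_forall fun s => ?_)
    simp only
    rw [← mul_add]
    congr 1
    exact congrFun (cut_add_cut_compl S h) _
  · rw [lsDens, lsDens, lsDens, Set.indicator_of_notMem hξ, Set.indicator_of_notMem hξ,
      Set.indicator_of_notMem hξ, add_zero]

theorem lintegral_lsDens_le (hε : ∀ i, ε i = 1 ∨ ε i = -1) {k : Fin n} {c : ℝ} (hc : 0 < c)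
    (hA : MeasurableSet A) (hAc : ∀ ξ ∈ A, c ≤ |ξ k|)
    {h : ℝ × hyperplane (EuclideanSpace.single k (1 : ℝ)) → ℂ} (hh : IsGood h) :
    ∫⁻ ξ, ‖lsDens ε (EuclideanSpace.single k (1 : ℝ)) A h ξ‖ₑ ^ (2 : ℝ)
      ≤ ENNReal.ofReal (2 * Real.pi / c) * ∫⁻ s : ℝ, ∫⁻ v, ‖h (s, v)‖ₑ ^ (2 : ℝ) := by
  have he : ‖(EuclideanSpace.single k (1 : ℝ) : Eucl n)‖ = 1 := by simp
  rw [lintegral_splitMap he ((measurable_lsDens hA hh.measurable).enorm.pow_const _)]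
  have hζ : ∀ ζ : hyperplane (EuclideanSpace.single k (1 : ℝ)),
      ∫⁻ η : ℝ, ‖lsDens ε (EuclideanSpace.single k (1 : ℝ)) A h (splitMap _ (η, ζ))‖ₑ ^ (2 : ℝ)
        ≤ ENNReal.ofReal (2 * Real.pi / c) * ∫⁻ s : ℝ, ‖h (s, ζ)‖ₑ ^ (2 : ℝ) := by
    intro ζ
    set P : ℝ → ℝ≥0∞ := fun τ =>
      ‖∫ s : ℝ, cexp (((s * τ : ℝ) : ℂ) * Complex.I) * h (s, ζ)‖ₑ ^ (2 : ℝ) with hP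
    calc _ ≤ ∫⁻ η in {η : ℝ | c ≤ |η|}, P (ε k * η ^ 2 + quadSym ε (ζ : Eucl n)) := by
          rw [← lintegral_indicator (measurableSet_le measurable_const (by fun_prop))]
          refine lintegral_mono fun η => ?_
          by_cases hmem : splitMap (EuclideanSpace.single k (1 : ℝ)) (η, ζ) ∈ A
          · have hη : η ∈ {η : ℝ | c ≤ |η|} := by
              have := hAc _ hmem
              rwa [splitMap_apply_single] at this
            rw [Set.indicator_of_mem hη, lsDens, Set.indicator_of_mem hmem, hypP_splitMap, hP]
            refine le_of_eq ?_
            congr 2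
            refine integral_congr_ae (Eventually.of_forall fun s => ?_)
            simp only
            congr 1
            rw [phase, ← Complex.exp_conj, map_mul, Complex.conj_ofReal, Complex.conj_I,
              quadSym_splitMap, inner_zero_right]
            congr 1
            push_cast
            ring
          · rw [lsDens, Set.indicator_of_notMem hmem, enorm_zero,
              ENNReal.zero_rpow_of_pos (by norm_num)]
            exact zero_le
      _ ≤ ENNReal.ofReal (1 / c) * ∫⁻ τ, P τ := lintegral_sq_le hc (hε k) P
      _ = ENNReal.ofReal (2 * Real.pi / c) * ∫⁻ s : ℝ, ‖h (s, ζ)‖ₑ ^ (2 : ℝ) := by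
          rw [hP, lintegral_time_plancherel (hh.integrable_slice ζ) (hh.memLp_slice ζ), ← mul_assoc,
            ← ENNReal.ofReal_mul (by positivity)]
          congr 2
          ring
  refine (lintegral_mono hζ).trans_eq ?_
  rw [lintegral_const_mul' _ _ ENNReal.ofReal_ne_top]
  congr 1
  exact lintegral_lintegral_swap
    (f := fun (ζ : hyperplane (EuclideanSpace.single k (1 : ℝ))) (s : ℝ) => ‖h (s, ζ)‖ₑ ^ (2 : ℝ))
    ((hh.measurable.comp measurable_swap).enorm.pow_const _).aemeasurable

theorem measurable_retarded (hA : MeasurableSet A) (hh : Measurable h) :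
    Measurable fun z : ℝ × Eucl n => extn ε (lsDens ε e A (cut (Set.Iio z.1) h)) z.1 z.2 := by
  have h1 : Measurable fun w : ((ℝ × Eucl n) × Eucl n) × ℝ =>
      starRingEnd ℂ (phase ε w.2 0 w.1.2) :=
    measurable_conj_phase (by fun_prop) (by fun_prop) (by fun_prop)
  have h2 : Measurable fun w : ((ℝ × Eucl n) × Eucl n) × ℝ =>
      cut (Set.Iio w.1.1.1) h (w.2, hypP e w.1.2) := by
    have hs : MeasurableSet {w : ((ℝ × Eucl n) × Eucl n) × ℝ | w.2 < w.1.1.1} :=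
      measurableSet_lt (by fun_prop) (by fun_prop)
    have h3 : Measurable fun w : ((ℝ × Eucl n) × Eucl n) × ℝ => h (w.2, hypP e w.1.2) :=
      hh.comp (f := fun w : ((ℝ × Eucl n) × Eucl n) × ℝ => (w.2, hypP e w.1.2))
        (measurable_snd.prodMk ((continuous_hypP e).measurable.comp (by fun_prop)))
    convert h3.indicator hs using 1
    funext w
    exact cut_apply _ _ _ _
  have h4 : Measurable fun w : (ℝ × Eucl n) × Eucl n =>
      ∫ s : ℝ, starRingEnd ℂ (phase ε s 0 w.2) * cut (Set.Iio w.1.1) h (s, hypP e w.2) :=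
    measurable_integral_right
      (f := fun (w : (ℝ × Eucl n) × Eucl n) (s : ℝ) =>
        starRingEnd ℂ (phase ε s 0 w.2) * cut (Set.Iio w.1.1) h (s, hypP e w.2)) (h1.mul h2)
  have h5 : Measurable fun w : (ℝ × Eucl n) × Eucl n =>
      phase ε w.1.1 w.1.2 w.2 * lsDens ε e A (cut (Set.Iio w.1.1) h) w.2 := by
    refine (measurable_phase_comp ε (by fun_prop) (by fun_prop) (by fun_prop)).mul ?_
    exact h4.indicator (s := {w : (ℝ × Eucl n) × Eucl n | w.2 ∈ A}) (measurable_snd hA)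
  exact measurable_integral_right (f := fun (z : ℝ × Eucl n) ξ =>
    phase ε z.1 z.2 ξ * lsDens ε e A (cut (Set.Iio z.1) h) ξ) h5

theorem extn_add {g₁ g₂ : Eucl n → ℂ} (h₁ : Integrable g₁) (h₂ : Integrable g₂) (t : ℝ)
    (x : Eucl n) : extn ε (fun ξ => g₁ ξ + g₂ ξ) t x = extn ε g₁ t x + extn ε g₂ t x := by
  unfold extn
  have hi : ∀ g : Eucl n → ℂ, Integrable g → Integrable fun ξ => phase ε t x ξ * g ξ :=
    fun g hg => hg.bdd_mul (c := 1) (measurable_phase_right ε t x).aestronglyMeasurable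
      (Eventually.of_forall fun ξ => (norm_phase ε t x ξ).le)
  rw [← integral_add (hi _ h₁) (hi _ h₂)]
  refine integral_congr_ae (Eventually.of_forall fun ξ => ?_)
  simp only [mul_add]

end LocalSmoothing

theorem rpow_one_div_le_iff {x y : ℝ≥0∞} {q : ℝ} (hq : 0 < q) :
    x ^ (1 / q) ≤ y ↔ x ≤ y ^ q := by
  rw [one_div, ENNReal.rpow_inv_le_iff hq]

theorem exists_median_of_continuous {ν : Measure ℝ} [IsFiniteMeasure ν] [NullSingletonClass ν]
    (hF : Continuous
    fun m => ν.real (Set.Iio m)) : ∃ m, ν (Set.Iio m) = ν Set.univ / 2 ∧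
      ν (Set.Ici m) = ν Set.univ / 2 := by
  have hT : ν Set.univ ≠ ∞ := measure_ne_top _ _
  suffices h : ∃ m, ν (Set.Iio m) = ν Set.univ / 2 by
    obtain ⟨m, hm⟩ := h
    refine ⟨m, hm, ?_⟩
    rw [← Set.compl_Iio, measure_compl measurableSet_Iio (measure_ne_top _ _), hm]
    exact ENNReal.sub_half hT
  rcases eq_or_ne (ν Set.univ) 0 with h0 | h0
  · exact ⟨0, by rw [h0, ENNReal.zero_div]; exact measure_mono_null (Set.subset_univ _) h0⟩
  have hlt : ν Set.univ / 2 < ν Set.univ := ENNReal.half_lt_self h0 hT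
  have hhalf : ν Set.univ / 2 ≠ ∞ := ne_top_of_lt hlt
  obtain ⟨b, hb⟩ := ((tendsto_measure_Iic_atTop ν).eventually (lt_mem_nhds hlt)).exists
  obtain ⟨a, ha⟩ := ((tendsto_measure_Ici_atBot ν).eventually (lt_mem_nhds hlt)).exists
  have hIic : ν (Set.Iio b) = ν (Set.Iic b) := measure_congr Iio_ae_eq_Iic
  have hIio : ν (Set.Iio a) ≤ ν Set.univ / 2 := by
    rw [← Set.compl_Ici, measure_compl measurableSet_Ici (measure_ne_top _ _)]
    rw [tsub_le_iff_left]
    calc ν Set.univ = ν Set.univ / 2 + ν Set.univ / 2 := (ENNReal.add_halves _).symm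
      _ ≤ _ := by gcongr
  obtain ⟨m, hm⟩ := mem_range_of_exists_le_of_exists_ge (c := (ν Set.univ / 2).toReal) hF
    ⟨a, ENNReal.toReal_mono hhalf hIio⟩
    ⟨b, ENNReal.toReal_mono (measure_ne_top _ _) (hIic ▸ hb.le)⟩
  exact ⟨m, (ENNReal.toReal_eq_toReal_iff' (measure_ne_top _ _) hhalf).mp hm⟩

theorem exists_median {a : ℝ → ℝ≥0∞} (ha : Measurable a) (hfin : ∫⁻ s, a s ≠ ∞) :
    ∃ m, ∫⁻ s in Set.Iio m, a s = (∫⁻ s, a s) / 2 ∧ ∫⁻ s in Set.Ici m, a s = (∫⁻ s, a s) / 2 := by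
  have hfm : IsFiniteMeasure (volume.withDensity a) := isFiniteMeasure_withDensity hfin
  have hint : Integrable fun s => (a s).toReal :=
    integrable_toReal_of_lintegral_ne_top ha.aemeasurable hfin
  have hF : Continuous fun m => (volume.withDensity a).real (Set.Iio m) := by
    have h1 : ∀ m, (volume.withDensity a).real (Set.Iio m)
        = (∫ s in Set.Iic (0 : ℝ), (a s).toReal) + ∫ s in (0 : ℝ)..m, (a s).toReal := by
      intro m
      rw [← intervalIntegral.integral_Iic_sub_Iic hint.integrableOn hint.integrableOn,
        add_sub_cancel, integral_Iic_eq_integral_Iio, Measure.real,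
        withDensity_apply _ measurableSet_Iio, integral_toReal ha.aemeasurable]
      exact ae_restrict_of_ae (ae_lt_top ha hfin)
    simp only [h1]
    exact continuous_const.add
      (intervalIntegral.continuous_primitive (fun _ _ => hint.intervalIntegrable) 0)
  obtain ⟨m, h1, h2⟩ := exists_median_of_continuous hF
  refine ⟨m, ?_, ?_⟩
  · rw [withDensity_apply _ measurableSet_Iio, withDensity_apply _ MeasurableSet.univ,
      setLIntegral_univ] at h1
    exact h1
  · rw [withDensity_apply _ measurableSet_Ici, withDensity_apply _ MeasurableSet.univ,
      setLIntegral_univ] at h2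
    exact h2

theorem le_of_le_mul_add {A ρ K : ℝ≥0∞} (hA : A ≠ ∞) (hρ : ρ < 1) (h : A ≤ ρ * (A + K)) :
    A ≤ (1 - ρ)⁻¹ * (ρ * K) := by
  have h1 : A - ρ * A ≤ ρ * K := by
    rw [tsub_le_iff_left, ← mul_add]
    exact h
  have h2 : (1 - ρ) * A ≤ ρ * K := by
    rwa [ENNReal.sub_mul (fun _ _ => hA), one_mul]
  have h3 : (1 - ρ) ≠ 0 := (tsub_pos_of_lt hρ).ne'
  have h4 : (1 - ρ) ≠ ∞ := ne_top_of_le_ne_top ENNReal.one_ne_top tsub_le_self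
  calc A = (1 - ρ)⁻¹ * ((1 - ρ) * A) := by
        rw [← mul_assoc, ENNReal.inv_mul_cancel h3 h4, one_mul]
    _ ≤ _ := by gcongr

section ChristKiselev

variable {X V : Type*} [MeasurableSpace X] [MeasurableSpace V] (μ : Measure X) (ν : Measure V)

/-- The `L²` norm over time and a second variable. -/
def l2N (h : ℝ × V → ℂ) : ℝ≥0∞ := (∫⁻ s : ℝ, ∫⁻ v, ‖h (s, v)‖ₑ ^ (2 : ℝ) ∂ν) ^ ((1 : ℝ) / 2)

theorem l2N_cut (h : ℝ × V → ℂ) {S : Set ℝ} (hS : MeasurableSet S) :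
    l2N ν (cut S h) = (∫⁻ s in S, ∫⁻ v, ‖h (s, v)‖ₑ ^ (2 : ℝ) ∂ν) ^ ((1 : ℝ) / 2) := by
  rw [l2N, ← lintegral_indicator hS]
  congr 1
  refine lintegral_congr fun s => ?_
  simp only [cut_apply]
  by_cases hs : s ∈ S
  · simp only [Set.indicator_of_mem hs]
  · simp only [Set.indicator_of_notMem hs, enorm_zero, ENNReal.zero_rpow_of_pos two_pos,
      lintegral_zero]

theorem l2N_cut_le (h : ℝ × V → ℂ) {S : Set ℝ} (hS : MeasurableSet S) :
    l2N ν (cut S h) ≤ l2N ν h := by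
  rw [l2N_cut ν h hS]
  exact ENNReal.rpow_le_rpow (setLIntegral_le_lintegral _ _) (by norm_num)

theorem exists_median_cut [SFinite ν] {h : ℝ × V → ℂ} (hh : Measurable h)
    (hfin : ∫⁻ s : ℝ, (∫⁻ v, ‖h (s, v)‖ₑ ^ (2 : ℝ) ∂ν) ≠ ∞) :
    ∃ m, l2N ν (cut (Set.Iio m) h) = 2⁻¹ ^ ((1 : ℝ) / 2) * l2N ν h ∧
      l2N ν (cut (Set.Iio m)ᶜ h) = 2⁻¹ ^ ((1 : ℝ) / 2) * l2N ν h := by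
  obtain ⟨m, h1, h2⟩ := exists_median (a := fun s => ∫⁻ v, ‖h (s, v)‖ₑ ^ (2 : ℝ) ∂ν)
    (Measurable.lintegral_prod_right' (f := fun z : ℝ × V => ‖h z‖ₑ ^ (2 : ℝ))
      (hh.enorm.pow_const _)) hfin
  refine ⟨m, ?_, ?_⟩
  · rw [l2N_cut ν h measurableSet_Iio, h1, l2N, ENNReal.div_eq_inv_mul,
      ENNReal.mul_rpow_of_nonneg _ _ (by norm_num)]
  · rw [Set.compl_Iio, l2N_cut ν h measurableSet_Ici, h2, l2N, ENNReal.div_eq_inv_mul,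
      ENNReal.mul_rpow_of_nonneg _ _ (by norm_num)]

theorem rho_lt_one {q : ℝ} (hq : 2 < q) :
    (2 : ℝ≥0∞) ^ (1 / q) * 2⁻¹ ^ ((1 : ℝ) / 2) < 1 := by
  rw [ENNReal.inv_rpow, ← ENNReal.rpow_neg, ← ENNReal.rpow_add _ _ (by norm_num) (by norm_num)]
  refine ENNReal.rpow_lt_one_of_one_lt_of_neg (by norm_num) ?_
  have : 1 / q < 1 / 2 := one_div_lt_one_div_of_lt (by norm_num) hq
  linarith

/-- The fixed-time `L^r` norm of `E h`. -/
def sliceN (r : ℝ) (E : (ℝ × V → ℂ) → ℝ → X → ℂ) (h : ℝ × V → ℂ) (t : ℝ) : ℝ≥0∞ :=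
  (∫⁻ x, ‖E h t x‖ₑ ^ r ∂μ) ^ (1 / r)

theorem christ_kiselev_step [SFinite μ] [SFinite ν] {Good : (ℝ × V → ℂ) → Prop}
    {E : (ℝ × V → ℂ) → ℝ → X → ℂ} {q r : ℝ} (hq : 2 < q) (hr : 2 < r) {K A : ℝ≥0∞}
    (hmeas : ∀ h, Good h → Measurable h)
    (hfin : ∀ h, Good h → ∫⁻ s : ℝ, (∫⁻ v, ‖h (s, v)‖ₑ ^ (2 : ℝ) ∂ν) ≠ ∞)
    (hcut : ∀ h, Good h → ∀ S, MeasurableSet S → Good (cut S h))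
    (hE : ∀ h, Good h → Measurable fun z : ℝ × X => E h z.1 z.2)
    (hR : ∀ h, Good h → Measurable fun z : ℝ × X => E (cut (Set.Iio z.1) h) z.1 z.2)
    (hadd : ∀ h, Good h → ∀ S, MeasurableSet S → ∀ t x,
      E (cut S h) t x + E (cut Sᶜ h) t x = E h t x)
    (hst : ∀ h, Good h → (∫⁻ t, sliceN μ r E h t ^ q) ^ (1 / q) ≤ K * l2N ν h)
    {T : Set ℝ}
    (hval : ∀ h, Good h →
      (∫⁻ t in T, sliceN μ r E (cut (Set.Iio t) h) t ^ q) ^ (1 / q) ≤ A * l2N ν h)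
    {h : ℝ × V → ℂ} (hh : Good h) :
    (∫⁻ t in T, sliceN μ r E (cut (Set.Iio t) h) t ^ q) ^ (1 / q)
      ≤ 2 ^ (1 / q) * 2⁻¹ ^ ((1 : ℝ) / 2) * (A + K) * l2N ν h := by
  have hq0 : 0 < q := by linarith
  have hr0 : 0 < r := by linarith
  obtain ⟨m, hm1, hm2⟩ := exists_median_cut ν (hmeas h hh) (hfin h hh)
  set h₁ := cut (Set.Iio m) h with hh₁
  set h₂ := cut (Set.Iio m)ᶜ h with hh₂
  have g₁ : Good h₁ := hcut h hh _ measurableSet_Iio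
  have g₂ : Good h₂ := hcut h hh _ measurableSet_Iio.compl
  set N := 2⁻¹ ^ ((1 : ℝ) / 2) * l2N ν h with hN
  have hsm : ∀ g, Good g → Measurable fun t => sliceN μ r E (cut (Set.Iio t) g) t := fun g hg =>
    (Measurable.lintegral_prod_right' (ν := μ)
      (f := fun z : ℝ × X => ‖E (cut (Set.Iio z.1) g) z.1 z.2‖ₑ ^ r)
      ((hR g hg).enorm.pow_const _)).pow_const _
  have hsm' : ∀ g, Good g → Measurable fun t => sliceN μ r E g t := fun g hg =>
    (Measurable.lintegral_prod_right' (ν := μ) (f := fun z : ℝ × X => ‖E g z.1 z.2‖ₑ ^ r)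
      ((hE g hg).enorm.pow_const _)).pow_const _
  have hle : ∀ t, t ≤ m → sliceN μ r E (cut (Set.Iio t) h) t
      = sliceN μ r E (cut (Set.Iio t) h₁) t := by
    intro t ht
    rw [hh₁, cut_cut, Set.inter_eq_self_of_subset_left (Set.Iio_subset_Iio ht)]
  have hgt : ∀ t, m < t → sliceN μ r E (cut (Set.Iio t) h) t
      ≤ sliceN μ r E h₁ t + sliceN μ r E (cut (Set.Iio t) h₂) t := by
    intro t ht
    have e1 : cut (Set.Iio m) (cut (Set.Iio t) h) = h₁ := by
      rw [hh₁, cut_cut, Set.inter_eq_self_of_subset_left (Set.Iio_subset_Iio ht.le)]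
    have e2 : cut (Set.Iio m)ᶜ (cut (Set.Iio t) h) = cut (Set.Iio t) h₂ := by
      rw [hh₂, cut_cut, cut_cut, Set.inter_comm]
    have e3 := hadd _ (hcut h hh (Set.Iio t) measurableSet_Iio) (Set.Iio m) measurableSet_Iio t
    rw [e1, e2] at e3
    have m1 : Measurable fun x => ‖E h₁ t x‖ₑ := ((hE h₁ g₁).comp measurable_prodMk_left).enorm
    have m2 : Measurable fun x => ‖E (cut (Set.Iio t) h₂) t x‖ₑ :=
      ((hR h₂ g₂).comp measurable_prodMk_left).enorm
    refine le_trans ?_ (ENNReal.lintegral_Lp_add_le m1.aemeasurable m2.aemeasurable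
      (by linarith : (1 : ℝ) ≤ r))
    refine ENNReal.rpow_le_rpow (lintegral_mono fun x => ENNReal.rpow_le_rpow ?_ hr0.le)
      (by positivity)
    rw [← e3 x]
    exact enorm_add_le _ _
  have hA1 : ∫⁻ t in T, sliceN μ r E (cut (Set.Iio t) h₁) t ^ q ≤ (A * N) ^ q := by
    have := hval h₁ g₁
    rw [hm1] at this
    exact (rpow_one_div_le_iff hq0).mp this
  have hA2 : ∫⁻ t in T, (sliceN μ r E h₁ t + sliceN μ r E (cut (Set.Iio t) h₂) t) ^ q
      ≤ (K * N + A * N) ^ q := by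
    refine (rpow_one_div_le_iff hq0).mp ?_
    refine (ENNReal.lintegral_Lp_add_le (hsm' h₁ g₁).aemeasurable (hsm h₂ g₂).aemeasurable
      (by linarith : (1 : ℝ) ≤ q)).trans (add_le_add ?_ ?_)
    · refine (ENNReal.rpow_le_rpow (setLIntegral_le_lintegral _ _) (by positivity)).trans ?_
      rw [← hm1]
      exact hst h₁ g₁
    · rw [← hm2]
      exact hval h₂ g₂
  have hsplit : ∫⁻ t in T, sliceN μ r E (cut (Set.Iio t) h) t ^ q
      ≤ 2 * ((A + K) * N) ^ q := by
    rw [← lintegral_add_compl _ (measurableSet_Iic (a := m)), two_mul]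
    refine add_le_add ?_ ?_
    · calc _ = ∫⁻ t in Set.Iic m, sliceN μ r E (cut (Set.Iio t) h₁) t ^ q
            ∂(volume.restrict T) := setLIntegral_congr_fun measurableSet_Iic
              (fun t ht => by simp only [hle t ht])
        _ ≤ _ := setLIntegral_le_lintegral _ _
        _ ≤ _ := hA1
        _ ≤ _ := by gcongr; exact le_self_add
    · calc _ ≤ ∫⁻ t in (Set.Iic m)ᶜ,
            (sliceN μ r E h₁ t + sliceN μ r E (cut (Set.Iio t) h₂) t) ^ q
            ∂(volume.restrict T) := setLIntegral_mono_ae' measurableSet_Iic.compl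
              (Eventually.of_forall fun t ht =>
                ENNReal.rpow_le_rpow (hgt t (not_le.mp ht)) hq0.le)
        _ ≤ _ := setLIntegral_le_lintegral _ _
        _ ≤ _ := hA2
        _ = _ := by rw [← add_mul, add_comm K]
  refine (ENNReal.rpow_le_rpow hsplit (by positivity)).trans_eq ?_
  rw [ENNReal.mul_rpow_of_nonneg _ _ (by positivity), one_div,
    ENNReal.rpow_rpow_inv hq0.ne', hN]
  ring

theorem christ_kiselev [SFinite μ] [SFinite ν] {Good : (ℝ × V → ℂ) → Prop}
    {E : (ℝ × V → ℂ) → ℝ → X → ℂ} {q r : ℝ} (hq : 2 < q) (hr : 2 < r) {K A₀ : ℝ≥0∞}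
    (hmeas : ∀ h, Good h → Measurable h)
    (hfin : ∀ h, Good h → ∫⁻ s : ℝ, (∫⁻ v, ‖h (s, v)‖ₑ ^ (2 : ℝ) ∂ν) ≠ ∞)
    (hcut : ∀ h, Good h → ∀ S, MeasurableSet S → Good (cut S h))
    (hE : ∀ h, Good h → Measurable fun z : ℝ × X => E h z.1 z.2)
    (hR : ∀ h, Good h → Measurable fun z : ℝ × X => E (cut (Set.Iio z.1) h) z.1 z.2)
    (hadd : ∀ h, Good h → ∀ S, MeasurableSet S → ∀ t x,
      E (cut S h) t x + E (cut Sᶜ h) t x = E h t x)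
    (hst : ∀ h, Good h → (∫⁻ t, sliceN μ r E h t ^ q) ^ (1 / q) ≤ K * l2N ν h)
    (hA₀ : A₀ ≠ ∞) (hap : ∀ h, Good h → ∀ t, sliceN μ r E h t ≤ A₀ * l2N ν h)
    {h : ℝ × V → ℂ} (hh : Good h) :
    (∫⁻ t, sliceN μ r E (cut (Set.Iio t) h) t ^ q) ^ (1 / q)
      ≤ (1 - 2 ^ (1 / q) * 2⁻¹ ^ ((1 : ℝ) / 2))⁻¹ * K * l2N ν h := by
  have hq0 : 0 < q := by linarith
  set ρ : ℝ≥0∞ := 2 ^ (1 / q) * 2⁻¹ ^ ((1 : ℝ) / 2) with hρ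
  have hρ1 : ρ < 1 := rho_lt_one hq
  have hNtop : ∀ g, Good g → l2N ν g ≠ ∞ := fun g hg =>
    ENNReal.rpow_ne_top_of_nonneg (by norm_num) (hfin g hg)
  have key : ∀ M : ℕ, ∀ g, Good g →
      (∫⁻ t in Set.Icc (-M : ℝ) M, sliceN μ r E (cut (Set.Iio t) g) t ^ q) ^ (1 / q)
        ≤ (1 - ρ)⁻¹ * K * l2N ν g := by
    intro M
    set T := Set.Icc (-M : ℝ) M with hT
    set Φ : (ℝ × V → ℂ) → ℝ≥0∞ := fun g =>
      (∫⁻ t in T, sliceN μ r E (cut (Set.Iio t) g) t ^ q) ^ (1 / q) with hΦ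
    set A₁ : ℝ≥0∞ := A₀ * volume T ^ (1 / q) with hA₁
    have hA₁top : A₁ ≠ ∞ := ENNReal.mul_ne_top hA₀
      (ENNReal.rpow_ne_top_of_nonneg (by positivity) (by rw [hT]; exact measure_Icc_lt_top.ne))
    have hap' : ∀ g, Good g → Φ g ≤ A₁ * l2N ν g := by
      intro g hg
      calc Φ g ≤ (∫⁻ _ in T, (A₀ * l2N ν g) ^ q) ^ (1 / q) := by
            refine ENNReal.rpow_le_rpow (lintegral_mono fun t => ENNReal.rpow_le_rpow ?_ hq0.le)
              (by positivity)
            exact (hap _ (hcut g hg _ measurableSet_Iio) t).trans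
              (mul_le_mul_right (l2N_cut_le ν g measurableSet_Iio) _)
        _ = A₁ * l2N ν g := by
            rw [setLIntegral_const, ENNReal.mul_rpow_of_nonneg _ _ (by positivity), one_div,
              ENNReal.rpow_rpow_inv hq0.ne', hA₁, one_div]
            ring
    set A : ℝ≥0∞ := ⨆ (g : ℝ × V → ℂ) (_ : Good g ∧ l2N ν g ≠ 0), Φ g / l2N ν g with hA
    have hAle : A ≤ A₁ := iSup₂_le fun g hg =>
      ENNReal.div_le_of_le_mul (hap' g hg.1)
    have hval : ∀ g, Good g → Φ g ≤ A * l2N ν g := by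
      intro g hg
      rcases eq_or_ne (l2N ν g) 0 with h0 | h0
      · have := hap' g hg
        rwa [h0, mul_zero] at this ⊢
      · rw [← ENNReal.div_le_iff h0 (hNtop g hg)]
        exact le_iSup₂ (f := fun (g : ℝ × V → ℂ) (_ : Good g ∧ l2N ν g ≠ 0) => Φ g / l2N ν g) g
          ⟨hg, h0⟩
    have hstep : A ≤ ρ * (A + K) := iSup₂_le fun g hg => by
      refine ENNReal.div_le_of_le_mul ?_
      exact christ_kiselev_step μ ν hq hr hmeas hfin hcut hE hR hadd hst hval hg.1
    have hfinal := le_of_le_mul_add (ne_top_of_le_ne_top hA₁top hAle) hρ1 hstep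
    intro g hg
    refine (hval g hg).trans ?_
    gcongr
    refine hfinal.trans ?_
    gcongr
    exact mul_le_of_le_one_left zero_le hρ1.le
  rw [rpow_one_div_le_iff hq0]
  have hmono : Monotone fun M : ℕ => Set.Icc (-M : ℝ) M := by
    intro a b hab
    have : (a : ℝ) ≤ b := by exact_mod_cast hab
    exact Set.Icc_subset_Icc (by linarith) this
  have hunion : ⋃ M : ℕ, Set.Icc (-M : ℝ) M = Set.univ := by
    refine Set.eq_univ_of_forall fun t => ?_
    obtain ⟨M, hM⟩ := exists_nat_ge |t|
    exact Set.mem_iUnion.mpr ⟨M, abs_le.mp hM⟩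
  rw [← setLIntegral_univ, ← hunion, setLIntegral_iUnion_of_directed _ hmono.directed_le]
  exact iSup_le fun M => (rpow_one_div_le_iff hq0).mp (key M h hh)

end ChristKiselev

section Retarded

variable {n : ℕ} (ε : Fin n → ℝ)

theorem extn_eq_fourierInv (g : Eucl n → ℂ) (t : ℝ) (x : Eucl n) :
    extn ε g t x = 𝓕⁻ (fun ξ => phase ε t 0 ξ * g ξ) x := by
  rw [fourierInv_eq_integral_phase ε, extn]
  refine integral_congr_ae (Eventually.of_forall fun ξ => ?_)
  simp only
  rw [phase_eq_mul ε t x ξ, mul_assoc]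

theorem lintegral_extn_two {g : Eucl n → ℂ} (h1 : Integrable g) (h2 : MemLp g 2) (t : ℝ) :
    ∫⁻ x, ‖extn ε g t x‖ₑ ^ (2 : ℝ) = ∫⁻ ξ, ‖g ξ‖ₑ ^ (2 : ℝ) := by
  have hm := (measurable_phase_right ε t (0 : Eucl n)).aestronglyMeasurable (μ := volume)
  have hi : Integrable fun ξ => phase ε t 0 ξ * g ξ :=
    h1.bdd_mul (c := 1) hm (Eventually.of_forall fun ξ => (norm_phase ε t 0 ξ).le)
  have hL : MemLp (fun ξ => phase ε t 0 ξ * g ξ) 2 := by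
    refine h2.mono (hm.mul h2.1) (Eventually.of_forall fun ξ => ?_)
    rw [norm_mul, norm_phase, one_mul]
  have h3 : (fun x => extn ε g t x) = 𝓕⁻ (fun ξ => phase ε t 0 ξ * g ξ) :=
    funext fun x => extn_eq_fourierInv ε g t x
  calc ∫⁻ x, ‖extn ε g t x‖ₑ ^ (2 : ℝ) = eLpNorm (fun x => extn ε g t x) 2 volume ^ (2 : ℝ) :=
        lintegral_enorm_rpow_two _ _
    _ = eLpNorm (fun ξ => phase ε t 0 ξ * g ξ) 2 volume ^ (2 : ℝ) := by
        rw [h3, eLpNorm_fourierInv_two hi hL]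
    _ = ∫⁻ ξ, ‖phase ε t 0 ξ * g ξ‖ₑ ^ (2 : ℝ) := (lintegral_enorm_rpow_two _ _).symm
    _ = _ := by simp only [enorm_mul, enorm_phase, one_mul]

theorem lintegral_enorm_le_of_support {g : Eucl n → ℂ} (hg : Measurable g) {A : Set (Eucl n)}
    (hA : MeasurableSet A) (h0 : ∀ ξ, ξ ∉ A → g ξ = 0) :
    ∫⁻ ξ, ‖g ξ‖ₑ ≤ volume A ^ ((1 : ℝ) / 2) * (∫⁻ ξ, ‖g ξ‖ₑ ^ (2 : ℝ)) ^ ((1 : ℝ) / 2) := by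
  have h := ENNReal.lintegral_mul_le_Lp_mul_Lq (volume : Measure (Eucl n)) (p := 2) (q := 2)
    (by constructor <;> norm_num) (f := A.indicator 1) (g := fun ξ => ‖g ξ‖ₑ)
    (measurable_one.indicator hA).aemeasurable hg.enorm.aemeasurable
  have e1 : ∀ ξ, ((A.indicator (1 : Eucl n → ℝ≥0∞)) * fun ξ => ‖g ξ‖ₑ) ξ = ‖g ξ‖ₑ := by
    intro ξ
    by_cases hξ : ξ ∈ A
    · simp [hξ]
    · simp [hξ, h0 ξ hξ]
  have e2 : ∀ ξ, A.indicator (1 : Eucl n → ℝ≥0∞) ξ ^ (2 : ℝ) = A.indicator 1 ξ := by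
    intro ξ
    by_cases hξ : ξ ∈ A
    · simp [hξ]
    · simp [hξ]
  simp only [e1, e2, lintegral_indicator_one hA] at h
  exact h

theorem lintegral_extn_le {r : ℝ} (hr : 2 < r) {g : Eucl n → ℂ} (hg : Measurable g)
    (h1 : Integrable g) (h2 : MemLp g 2) {A : Set (Eucl n)} (hA : MeasurableSet A)
    (h0 : ∀ ξ, ξ ∉ A → g ξ = 0) (t : ℝ) :
    (∫⁻ x, ‖extn ε g t x‖ₑ ^ r) ^ (1 / r)
      ≤ (volume A ^ ((1 : ℝ) / 2)) ^ ((r - 2) / r)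
        * (∫⁻ ξ, ‖g ξ‖ₑ ^ (2 : ℝ)) ^ ((1 : ℝ) / 2) := by
  have hr0 : 0 < r := by linarith
  set N := (∫⁻ ξ, ‖g ξ‖ₑ ^ (2 : ℝ)) ^ ((1 : ℝ) / 2) with hN
  have hN2 : N ^ (2 : ℝ) = ∫⁻ ξ, ‖g ξ‖ₑ ^ (2 : ℝ) := by
    rw [hN, one_div, ENNReal.rpow_inv_rpow (by norm_num)]
  have hpt : ∀ x, ‖extn ε g t x‖ₑ ^ r
      ≤ (volume A ^ ((1 : ℝ) / 2) * N) ^ (r - 2) * ‖extn ε g t x‖ₑ ^ (2 : ℝ) := by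
    intro x
    have hx : ‖extn ε g t x‖ₑ ≤ volume A ^ ((1 : ℝ) / 2) * N := by
      refine le_trans ?_ (lintegral_enorm_le_of_support hg hA h0)
      refine (enorm_integral_le_lintegral_enorm _).trans_eq ?_
      simp only [enorm_mul, enorm_phase, one_mul]
    calc ‖extn ε g t x‖ₑ ^ r = ‖extn ε g t x‖ₑ ^ (r - 2) * ‖extn ε g t x‖ₑ ^ (2 : ℝ) := by
          rw [← ENNReal.rpow_add_of_nonneg _ _ (by linarith) (by norm_num), sub_add_cancel]
      _ ≤ _ := by gcongr
  rw [rpow_one_div_le_iff hr0]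
  calc ∫⁻ x, ‖extn ε g t x‖ₑ ^ r
      ≤ ∫⁻ x, (volume A ^ ((1 : ℝ) / 2) * N) ^ (r - 2) * ‖extn ε g t x‖ₑ ^ (2 : ℝ) :=
        lintegral_mono hpt
    _ = (volume A ^ ((1 : ℝ) / 2) * N) ^ (r - 2) * N ^ (2 : ℝ) := by
        have hm : Measurable fun x => ‖extn ε g t x‖ₑ ^ (2 : ℝ) :=
          ((measurable_extn ε hg).comp measurable_prodMk_left).enorm.pow_const _
        rw [lintegral_const_mul _ hm, lintegral_extn_two ε h1 h2, hN2]
    _ = _ := by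
        rw [ENNReal.mul_rpow_of_nonneg _ _ (by linarith), mul_assoc,
          ← ENNReal.rpow_add_of_nonneg _ _ (by linarith) (by norm_num), sub_add_cancel,
          ENNReal.mul_rpow_of_nonneg _ _ hr0.le]
        congr 1
        rw [← ENNReal.rpow_mul (_ ^ _), div_mul_cancel₀ _ hr0.ne']

variable {ε}

theorem memLp_lsDens {e : Eucl n} {A : Set (Eucl n)} {h : ℝ × hyperplane e → ℂ}
    (hA : MeasurableSet A) (hA' : Bornology.IsBounded A) (hh : IsGood h) :
    MemLp (lsDens ε e A h) 2 := by
  obtain ⟨B, hB⟩ := exists_norm_lsDens_le (ε := ε) (A := A) hh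
  refine memLp_of_bounded_of_support
    (measurable_lsDens hA hh.measurable).aestronglyMeasurable (B := B) (s := A) (fun ξ => ?_) hA
    hA'.measure_lt_top.ne (fun ξ hξ => Set.indicator_of_notMem hξ _) 2
  simpa only [cut_univ] using hB Set.univ ξ

theorem sliceN_rpow {X V : Type*} [MeasurableSpace X] (μ : Measure X) {r : ℝ} (q : ℝ)
    (E : (ℝ × V → ℂ) → ℝ → X → ℂ) (h : ℝ × V → ℂ) (t : ℝ) :
    sliceN μ r E h t ^ q = (∫⁻ x, ‖E h t x‖ₑ ^ r ∂μ) ^ (q / r) := by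
  rw [sliceN, ← ENNReal.rpow_mul]
  congr 1
  ring

theorem exists_retarded_const (hε : ∀ i, ε i = 1 ∨ ε i = -1) {q r : ℝ} (hq : 2 < q) (hr : 2 < r)
    (hqr : 2 / q = (n : ℝ) * (1 / 2 - 1 / r)) :
    ∃ C : ℝ≥0∞, C ≠ ∞ ∧ ∀ (k : Fin n) (c : ℝ), 0 < c → ∀ A : Set (Eucl n), MeasurableSet A →
      Bornology.IsBounded A → (∀ ξ ∈ A, c ≤ |ξ k|) →
      ∀ h : ℝ × hyperplane (EuclideanSpace.single k (1 : ℝ)) → ℂ, IsGood h →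
      (∫⁻ t, (∫⁻ x, ‖extn ε (lsDens ε _ A (cut (Set.Iio t) h)) t x
          - extn ε (lsDens ε _ A (cut (Set.Iio 0) h)) t x‖ₑ ^ r) ^ (q / r)) ^ (1 / q)
        ≤ C * ENNReal.ofReal (2 * Real.pi / c) ^ ((1 : ℝ) / 2) * l2N volume h := by
  obtain ⟨C, hC, hS⟩ := exists_strichartz_const ε hε hq hr hqr
  have hq0 : 0 < q := by linarith
  have hr0 : 0 < r := by linarith
  set L : ℝ≥0∞ := (1 - 2 ^ (1 / q) * 2⁻¹ ^ ((1 : ℝ) / 2))⁻¹ with hL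
  have hLtop : L ≠ ∞ := ENNReal.inv_ne_top.mpr (tsub_pos_of_lt (rho_lt_one hq)).ne'
  refine ⟨L * C + C, ENNReal.add_ne_top.mpr ⟨ENNReal.mul_ne_top hLtop hC, hC⟩, ?_⟩
  intro k c hc A hA hA' hAc
  set D : ℝ≥0∞ := ENNReal.ofReal (2 * Real.pi / c) ^ ((1 : ℝ) / 2) with hD
  have hDtop : D ≠ ∞ := ENNReal.rpow_ne_top_of_nonneg (by norm_num) ENNReal.ofReal_ne_top
  set e : Eucl n := EuclideanSpace.single k (1 : ℝ) with he
  intro h hh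
  let E : (ℝ × hyperplane e → ℂ) → ℝ → Eucl n → ℂ := fun g => extn ε (lsDens ε e A g)
  have hD2 : ∀ g, IsGood g → (∫⁻ ξ, ‖lsDens ε e A g ξ‖ₑ ^ (2 : ℝ)) ^ ((1 : ℝ) / 2)
      ≤ D * l2N volume g := by
    intro g hg
    rw [hD, l2N, ← ENNReal.mul_rpow_of_nonneg _ _ (by norm_num)]
    exact ENNReal.rpow_le_rpow (lintegral_lsDens_le hε hc hA hAc hg) (by norm_num)
  have hEm : ∀ g, IsGood g → Measurable fun z : ℝ × Eucl n => E g z.1 z.2 := fun g hg =>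
    measurable_extn ε (measurable_lsDens hA hg.measurable)
  have hst : ∀ g, IsGood g → (∫⁻ t, sliceN volume r E g t ^ q) ^ (1 / q)
      ≤ C * D * l2N volume g := by
    intro g hg
    obtain ⟨R, hR⟩ := hA'.exists_norm_le
    simp only [sliceN_rpow]
    refine (hS _ (measurable_lsDens hA hg.measurable) (integrable_lsDens hA hA' hg) R
      (fun ξ hξ => hR ξ ?_)).trans ?_
    · by_contra h0
      exact hξ (Set.indicator_of_notMem h0 _)
    · rw [mul_assoc]
      gcongr
      exact hD2 g hg
  have hck := christ_kiselev volume volume (Good := IsGood) (E := E) hq hr (K := C * D)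
    (A₀ := (volume A ^ ((1 : ℝ) / 2)) ^ ((r - 2) / r) * D) (fun g hg => hg.measurable)
    (fun g hg => hg.lintegral_ne_top) (fun g hg S hS => hg.cut hS) hEm
    (fun g hg => measurable_retarded hA hg.measurable)
    (fun g hg S hS t x => by
      change extn ε _ t x + extn ε _ t x = extn ε _ t x
      rw [← extn_add (integrable_lsDens hA hA' (hg.cut hS))
        (integrable_lsDens hA hA' (hg.cut hS.compl))]
      congr 1
      exact funext fun ξ => lsDens_add_compl hg hS ξ) hst
    (ENNReal.mul_ne_top (ENNReal.rpow_ne_top_of_nonneg (div_nonneg (by linarith) hr0.le)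
      (ENNReal.rpow_ne_top_of_nonneg (by norm_num) hA'.measure_lt_top.ne)) hDtop)
    (fun g hg t => by
      refine (lintegral_extn_le ε hr (measurable_lsDens hA hg.measurable)
        (integrable_lsDens hA hA' hg) (memLp_lsDens hA hA' hg) hA
        (fun ξ hξ => Set.indicator_of_notMem hξ _) t).trans ?_
      rw [mul_assoc]
      gcongr
      exact hD2 g hg) hh
  have g0 : IsGood (cut (Set.Iio 0) h) := hh.cut measurableSet_Iio
  have hst0 := (hst _ g0).trans (mul_le_mul_right (l2N_cut_le volume h measurableSet_Iio) _)
  have mR := measurable_retarded (ε := ε) hA hh.measurable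
  have m1 : Measurable fun t => sliceN volume r E (cut (Set.Iio t) h) t :=
    (Measurable.lintegral_prod_right'
      (f := fun z : ℝ × Eucl n => ‖E (cut (Set.Iio z.1) h) z.1 z.2‖ₑ ^ r)
      (mR.enorm.pow_const _)).pow_const _
  have m2 : Measurable fun t => sliceN volume r E (cut (Set.Iio 0) h) t :=
    (Measurable.lintegral_prod_right'
      (f := fun z : ℝ × Eucl n => ‖E (cut (Set.Iio 0) h) z.1 z.2‖ₑ ^ r)
      ((hEm _ g0).enorm.pow_const _)).pow_const _
  calc _ ≤ (∫⁻ t, (sliceN volume r E (cut (Set.Iio t) h) t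
          + sliceN volume r E (cut (Set.Iio 0) h) t) ^ q) ^ (1 / q) := by
        refine ENNReal.rpow_le_rpow (lintegral_mono fun t => ?_) (by positivity)
        have k1 : Measurable fun x => ‖E (cut (Set.Iio t) h) t x‖ₑ :=
          (mR.comp measurable_prodMk_left).enorm
        have k2 : Measurable fun x => ‖E (cut (Set.Iio 0) h) t x‖ₑ :=
          ((hEm _ g0).comp measurable_prodMk_left).enorm
        have hmk := ENNReal.lintegral_Lp_add_le k1.aemeasurable k2.aemeasurable (μ := volume)
          (by linarith : (1 : ℝ) ≤ r)
        rw [show q / r = 1 / r * q by ring, ENNReal.rpow_mul]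
        refine ENNReal.rpow_le_rpow (le_trans ?_ hmk) hq0.le
        refine ENNReal.rpow_le_rpow (lintegral_mono fun x => ?_) (by positivity)
        exact ENNReal.rpow_le_rpow enorm_sub_le hr0.le
    _ ≤ _ := ENNReal.lintegral_Lp_add_le m1.aemeasurable m2.aemeasurable
        (by linarith : (1 : ℝ) ≤ q)
    _ ≤ L * (C * D) * l2N volume h + C * D * l2N volume h := add_le_add hck hst0
    _ = _ := by ring

end Retarded

section Slices

variable {n : ℕ}

/-- The spatial weight `(1 + |x|)^{-(n+1)}`. -/
def wgt {V : Type*} [NormedAddCommGroup V] (n : ℕ) (x : V) : ℝ := (1 + ‖x‖) ^ (-((n : ℝ) + 1))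

theorem wgt_nonneg {V : Type*} [NormedAddCommGroup V] (n : ℕ) (x : V) : 0 ≤ wgt n x :=
  Real.rpow_nonneg (by positivity) _

theorem wgt_le_one {V : Type*} [NormedAddCommGroup V] (n : ℕ) (x : V) : wgt n x ≤ 1 :=
  Real.rpow_le_one_of_one_le_of_nonpos (by linarith [norm_nonneg x])
    (by linarith [n.cast_nonneg (α := ℝ)])

theorem integrable_wgt : Integrable (wgt n : Eucl n → ℝ) :=
  integrable_one_add_norm (by rw [finrank_euclideanSpace, Fintype.card_fin]; linarith)

theorem integrable_wgt_hyperplane (e : Eucl n) : Integrable (wgt n : hyperplane e → ℝ) := by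
  refine integrable_one_add_norm ?_
  have h := Submodule.finrank_le (hyperplane e)
  rw [finrank_euclideanSpace, Fintype.card_fin] at h
  have : (Module.finrank ℝ (hyperplane e) : ℝ) ≤ n := by exact_mod_cast h
  linarith

theorem norm_le_norm_splitMap {e : Eucl n} (he : ‖e‖ = 1) (r : ℝ) (v : hyperplane e) :
    ‖v‖ ≤ ‖splitMap e (r, v)‖ := by
  have h := inner_splitMap he (r, v) (r, v)
  rw [real_inner_self_eq_norm_sq, real_inner_self_eq_norm_sq] at h
  simp only at h
  exact le_of_sq_le_sq (by nlinarith [mul_self_nonneg r]) (norm_nonneg _)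

theorem wgt_splitMap_le {e : Eucl n} (he : ‖e‖ = 1) (r : ℝ) (v : hyperplane e) :
    wgt n (splitMap e (r, v)) ≤ wgt n v :=
  Real.rpow_le_rpow_of_nonpos (by positivity)
    (add_le_add_right (norm_le_norm_splitMap he r v) 1) (by linarith [n.cast_nonneg (α := ℝ)])

/-- Measurable space-time functions with polynomial decay. -/
structure IsDec (G : ℝ × Eucl n → ℂ) : Prop where
  measurable : Measurable G
  decay : ∃ C : ℝ, 0 ≤ C ∧ ∀ s x, ‖G (s, x)‖ ≤ C * (1 + s ^ 2)⁻¹ * wgt n x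

theorem inv_one_add_sq_le_one (s : ℝ) : (1 + s ^ 2)⁻¹ ≤ 1 :=
  inv_le_one_of_one_le₀ (by nlinarith [sq_nonneg s])

theorem IsDec.integrable_slice {G : ℝ × Eucl n → ℂ} (hG : IsDec G) (s : ℝ) :
    Integrable fun x => G (s, x) := by
  obtain ⟨C, -, hC⟩ := hG.decay
  exact (integrable_wgt.const_mul (C * (1 + s ^ 2)⁻¹)).mono'
    (hG.measurable.comp measurable_prodMk_left).aestronglyMeasurable
    (Eventually.of_forall fun x => hC s x)

variable {e : Eucl n} {G : ℝ × Eucl n → ℂ}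

theorem IsDec.measurable_split (hG : IsDec G) :
    Measurable fun z : ℝ × ℝ × hyperplane e => G (z.2.1, splitMap e (z.1, z.2.2)) :=
  hG.measurable.comp (f := fun z : ℝ × ℝ × hyperplane e => (z.2.1, splitMap e (z.1, z.2.2)))
    ((by fun_prop : Measurable fun z : ℝ × ℝ × hyperplane e => z.2.1).prodMk
      ((continuous_splitMap e).measurable.comp
        (f := fun z : ℝ × ℝ × hyperplane e => (z.1, z.2.2)) (by fun_prop)))

theorem IsDec.measurable_split_right (hG : IsDec G) (r s : ℝ) :
    Measurable fun v : hyperplane e => G (s, splitMap e (r, v)) :=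
  (hG.measurable_split (e := e)).comp (f := fun v => (r, s, v)) (by fun_prop)

theorem IsDec.integrable_hyperplane (hG : IsDec G) (he : ‖e‖ = 1) (r s : ℝ) :
    Integrable fun v : hyperplane e => G (s, splitMap e (r, v)) := by
  obtain ⟨C, hC0, hC⟩ := hG.decay
  refine ((integrable_wgt_hyperplane e).const_mul (C * (1 + s ^ 2)⁻¹)).mono'
    (hG.measurable_split_right r s).aestronglyMeasurable (Eventually.of_forall fun v => ?_)
  exact (hC _ _).trans (mul_le_mul_of_nonneg_left (wgt_splitMap_le he r v) (by positivity))

theorem IsDec.memLp_hyperplane (hG : IsDec G) (he : ‖e‖ = 1) (r s : ℝ) :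
    MemLp (fun v : hyperplane e => G (s, splitMap e (r, v))) 2 := by
  obtain ⟨C, hC0, hC⟩ := hG.decay
  have hm := (hG.measurable_split_right (e := e) r s)
  rw [memLp_two_iff_integrable_sq_norm hm.aestronglyMeasurable]
  refine ((hG.integrable_hyperplane he r s).norm.const_mul C).mono'
    (hm.norm.pow_const 2).aestronglyMeasurable (Eventually.of_forall fun v => ?_)
  rw [Real.norm_of_nonneg (by positivity), sq]
  refine mul_le_mul_of_nonneg_right ((hC s _).trans ?_) (norm_nonneg _)
  rw [mul_assoc]
  exact mul_le_of_le_one_right hC0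
    (mul_le_one₀ (inv_one_add_sq_le_one s) (wgt_nonneg _ _) (wgt_le_one _ _))

/-- Partial Fourier transform along `P_e` of the slice of `G` at height `r`,
localised to `|ζ| ≤ b`. -/
def sliceFT (ε : Fin n → ℝ) (b : ℝ) (e : Eucl n) (G : ℝ × Eucl n → ℂ) (r : ℝ)
    (z : ℝ × hyperplane e) : ℂ :=
  {z : ℝ × hyperplane e | ‖z.2‖ ≤ b}.indicator
    (fun z => ∫ v : hyperplane e, starRingEnd ℂ (phase ε 0 (v : Eucl n) (z.2 : Eucl n))
      * G (z.1, splitMap e (r, v))) z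

theorem measurable_sliceFT (ε : Fin n → ℝ) (b : ℝ) (hG : IsDec G) :
    Measurable fun z : ℝ × ℝ × hyperplane e => sliceFT ε b e G z.1 z.2 := by
  have h1 : Measurable fun w : (ℝ × ℝ × hyperplane e) × hyperplane e =>
      starRingEnd ℂ (phase ε 0 (w.2 : Eucl n) (w.1.2.2 : Eucl n)) :=
    measurable_conj_phase (by fun_prop) (by fun_prop) (by fun_prop)
  have h2 : Measurable fun w : (ℝ × ℝ × hyperplane e) × hyperplane e =>
      G (w.1.2.1, splitMap e (w.1.1, w.2)) :=
    (hG.measurable_split (e := e)).comp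
      (f := fun w : (ℝ × ℝ × hyperplane e) × hyperplane e => (w.1.1, w.1.2.1, w.2)) (by fun_prop)
  have h3 := measurable_integral_right (μ := volume)
    (f := fun (w : ℝ × ℝ × hyperplane e) (v : hyperplane e) =>
      starRingEnd ℂ (phase ε 0 (v : Eucl n) (w.2.2 : Eucl n)) * G (w.2.1, splitMap e (w.1, v)))
    (h1.mul h2)
  have hs : MeasurableSet {z : ℝ × ℝ × hyperplane e | ‖z.2.2‖ ≤ b} :=
    measurableSet_le (by fun_prop) measurable_const
  convert h3.indicator hs using 1
  funext z
  by_cases hz : ‖z.2.2‖ ≤ b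
  · rw [sliceFT, Set.indicator_of_mem (s := {z : ℝ × hyperplane e | ‖z.2‖ ≤ b}) hz,
      Set.indicator_of_mem (s := {z : ℝ × ℝ × hyperplane e | ‖z.2.2‖ ≤ b}) hz]
  · rw [sliceFT, Set.indicator_of_notMem (s := {z : ℝ × hyperplane e | ‖z.2‖ ≤ b}) hz,
      Set.indicator_of_notMem (s := {z : ℝ × ℝ × hyperplane e | ‖z.2.2‖ ≤ b}) hz]

/-- The mass of the weight on the affine hyperplane at height `r`. -/
def hypW (e : Eucl n) (r : ℝ) : ℝ := ∫ v : hyperplane e, wgt n (splitMap e (r, v))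

theorem continuous_wgt : Continuous (wgt n : Eucl n → ℝ) := by
  unfold wgt
  exact (continuous_const.add continuous_norm).rpow_const
    fun x => Or.inl (add_pos_of_pos_of_nonneg one_pos (norm_nonneg x)).ne'

theorem integrable_wgt_splitMap (he : ‖e‖ = 1) (r : ℝ) :
    Integrable fun v : hyperplane e => wgt n (splitMap e (r, v)) := by
  have hc : Continuous fun v : hyperplane e => wgt n (splitMap e (r, v)) :=
    continuous_wgt.comp ((continuous_splitMap e).comp (by fun_prop))
  refine (integrable_wgt_hyperplane e).mono' hc.aestronglyMeasurable
    (Eventually.of_forall fun v => ?_)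
  rw [Real.norm_of_nonneg (wgt_nonneg _ _)]
  exact wgt_splitMap_le he r v

theorem integrable_hypW (he : ‖e‖ = 1) : Integrable (hypW e) := by
  have h : Integrable (fun z : ℝ × hyperplane e => wgt n (splitMap e z))
      ((volume : Measure ℝ).prod (volume : Measure (hyperplane e))) :=
    (measurePreserving_splitMap he).integrable_comp_of_integrable integrable_wgt
  exact h.integral_prod_left

theorem norm_sliceFT_le (ε : Fin n → ℝ) (b : ℝ) {C : ℝ}
    (hC : ∀ s x, ‖G (s, x)‖ ≤ C * (1 + s ^ 2)⁻¹ * wgt n x) (he : ‖e‖ = 1) (r : ℝ)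
    (z : ℝ × hyperplane e) :
    ‖sliceFT ε b e G r z‖ ≤ C * (1 + z.1 ^ 2)⁻¹ * hypW e r := by
  refine (norm_indicator_le_norm_self _ _).trans ?_
  rw [hypW, ← integral_const_mul]
  refine norm_integral_le_of_norm_le ((integrable_wgt_splitMap he r).const_mul _)
    (Eventually.of_forall fun v => ?_)
  rw [norm_mul, RCLike.norm_conj, norm_phase, one_mul]
  exact hC _ _

theorem IsDec.isGood_sliceFT (ε : Fin n → ℝ) (b : ℝ) (hG : IsDec G) (he : ‖e‖ = 1) (r : ℝ) :
    IsGood (sliceFT ε b e G r) := by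
  obtain ⟨C, hC0, hC⟩ := hG.decay
  have hm : Measurable (sliceFT ε b e G r) :=
    (measurable_sliceFT ε b hG).comp (f := fun z : ℝ × hyperplane e => (r, z)) (by fun_prop)
  refine ⟨hm, ⟨C * hypW e r, fun z => ?_⟩, ⟨b, fun z hz => ?_⟩⟩
  · refine (norm_sliceFT_le ε b hC he r z).trans_eq ?_
    ring
  · by_contra h0
    refine hz ?_
    rw [sliceFT]
    exact Set.indicator_of_notMem (s := {z : ℝ × hyperplane e | ‖z.2‖ ≤ b}) h0 _

theorem innerQ_two_eq (hG : IsDec G) (r : ℝ) :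
    innerQ 2 e G r
      = (∫⁻ s : ℝ, ∫⁻ v : hyperplane e, ‖G (s, splitMap e (r, v))‖ₑ ^ (2 : ℝ)) ^ ((1 : ℝ) / 2) := by
  have hm : Measurable fun z : ℝ × hyperplane e => G (z.1, splitMap e (r, z.2)) :=
    (hG.measurable_split (e := e)).comp (f := fun z : ℝ × hyperplane e => (r, z)) (by fun_prop)
  have h0 : innerQ 2 e G r
      = eLpNorm (fun z : ℝ × hyperplane e => G (z.1, splitMap e (r, z.2))) 2
        ((volume : Measure ℝ).prod (volume : Measure (hyperplane e))) := by
    unfold innerQ splitMap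
    rfl
  rw [h0, eLpNorm_eq_lintegral_rpow_enorm_toReal two_ne_zero ENNReal.ofNat_ne_top,
    ENNReal.toReal_ofNat]
  rw [lintegral_prod _ (hm.enorm.pow_const _).aemeasurable]

theorem integral_conj_phase_eq_fourier (ε : Fin n → ℝ) (f : hyperplane e → ℂ) (ζ : hyperplane e) :
    ∫ v : hyperplane e, starRingEnd ℂ (phase ε 0 (v : Eucl n) (ζ : Eucl n)) * f v = 𝓕 f ζ := by
  rw [Real.fourier_eq']
  refine integral_congr_ae (Eventually.of_forall fun v => ?_)
  simp only [smul_eq_mul]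
  congr 1
  rw [phase, ← Complex.exp_conj, map_mul, Complex.conj_ofReal, Complex.conj_I, zero_mul, sub_zero,
    real_inner_comm, ← Submodule.coe_inner]
  congr 1
  push_cast
  ring

theorem lintegral_sliceFT_le (ε : Fin n → ℝ) (b : ℝ) (hG : IsDec G) (he : ‖e‖ = 1) (r s : ℝ) :
    ∫⁻ ζ, ‖sliceFT ε b e G r (s, ζ)‖ₑ ^ (2 : ℝ)
      ≤ ∫⁻ v : hyperplane e, ‖G (s, splitMap e (r, v))‖ₑ ^ (2 : ℝ) := by
  calc ∫⁻ ζ, ‖sliceFT ε b e G r (s, ζ)‖ₑ ^ (2 : ℝ)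
      ≤ ∫⁻ ζ, ‖𝓕 (fun v : hyperplane e => G (s, splitMap e (r, v))) ζ‖ₑ ^ (2 : ℝ) := by
        refine lintegral_mono fun ζ => ENNReal.rpow_le_rpow ?_ (by norm_num)
        refine (enorm_indicator_le_enorm_self _ _).trans_eq ?_
        simp only [integral_conj_phase_eq_fourier]
    _ = _ := by
        rw [lintegral_enorm_rpow_two, lintegral_enorm_rpow_two,
          eLpNorm_fourier_two (hG.integrable_hyperplane he r s) (hG.memLp_hyperplane he r s)]

theorem l2N_sliceFT_le (ε : Fin n → ℝ) (b : ℝ) (hG : IsDec G) (he : ‖e‖ = 1) (r : ℝ) :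
    l2N volume (sliceFT ε b e G r) ≤ innerQ 2 e G r := by
  rw [innerQ_two_eq hG, l2N]
  exact ENNReal.rpow_le_rpow (lintegral_mono fun s => lintegral_sliceFT_le ε b hG he r s)
    (by norm_num)

end Slices

section Core

variable {n : ℕ} {ε : Fin n → ℝ} {e : Eucl n} {A : Set (Eucl n)} {G : ℝ × Eucl n → ℂ} {b : ℝ}

theorem integrable_uncurry_of_norm_le {α β : Type*} [MeasurableSpace α] [MeasurableSpace β]
    {μ : Measure α} {ν : Measure β} [SFinite μ] [SFinite ν] {f : α → β → ℂ}
    (hf : Measurable (Function.uncurry f)) {u : α → ℝ} {v : β → ℝ} (hu : Integrable u μ)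
    (hv : Integrable v ν) (h : ∀ a b, ‖f a b‖ ≤ u a * v b) :
    Integrable (Function.uncurry f) (μ.prod ν) :=
  (hu.mul_prod hv).mono' hf.aestronglyMeasurable (Eventually.of_forall fun z => h z.1 z.2)

theorem measurable_lsDens_comp {Z : Type*} [MeasurableSpace Z] (hA : MeasurableSet A)
    {H : Z → ℝ × hyperplane e → ℂ} (hH : Measurable fun w : Z × ℝ × hyperplane e => H w.1 w.2)
    {ξ : Z → Eucl n} (hξ : Measurable ξ) : Measurable fun z => lsDens ε e A (H z) (ξ z) := by
  have h1 : Measurable fun w : Z × ℝ => starRingEnd ℂ (phase ε w.2 0 (ξ w.1)) :=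
    measurable_conj_phase (by fun_prop) (by fun_prop) (by fun_prop)
  have h2 : Measurable fun w : Z × ℝ => H w.1 (w.2, hypP e (ξ w.1)) :=
    hH.comp (f := fun w : Z × ℝ => (w.1, w.2, hypP e (ξ w.1)))
      (measurable_fst.prodMk (measurable_snd.prodMk ((continuous_hypP e).measurable.comp
        (hξ.comp measurable_fst))))
  have h3 : Measurable fun z : Z =>
      ∫ s : ℝ, starRingEnd ℂ (phase ε s 0 (ξ z)) * H z (s, hypP e (ξ z)) :=
    measurable_integral_right
      (f := fun (z : Z) (s : ℝ) => starRingEnd ℂ (phase ε s 0 (ξ z)) * H z (s, hypP e (ξ z)))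
      (h1.mul h2)
  exact h3.indicator (s := {z : Z | ξ z ∈ A}) (hξ hA)

theorem measurable_extn_lsDens_comp {Z : Type*} [MeasurableSpace Z] (hA : MeasurableSet A)
    {H : Z → ℝ × hyperplane e → ℂ} (hH : Measurable fun w : Z × ℝ × hyperplane e => H w.1 w.2)
    {t : Z → ℝ} (ht : Measurable t) {x : Z → Eucl n} (hx : Measurable x) :
    Measurable fun z => extn ε (lsDens ε e A (H z)) (t z) (x z) := by
  have h1 : Measurable fun w : Z × Eucl n => lsDens ε e A (H w.1) w.2 :=
    measurable_lsDens_comp (Z := Z × Eucl n) (H := fun w => H w.1) hA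
      (hH.comp (f := fun w : (Z × Eucl n) × ℝ × hyperplane e => (w.1.1, w.2)) (by fun_prop))
      measurable_snd
  exact measurable_integral_right (f := fun (z : Z) ξ =>
    phase ε (t z) (x z) ξ * lsDens ε e A (H z) ξ)
    ((measurable_phase_comp ε (by fun_prop) (by fun_prop) (by fun_prop)).mul h1)

theorem measurable_cut_comp {Z V : Type*} [MeasurableSpace Z] [MeasurableSpace V]
    {H : Z → ℝ × V → ℂ} (hH : Measurable fun w : Z × ℝ × V => H w.1 w.2)
    {S : Z → Set ℝ} (hS : MeasurableSet {w : Z × ℝ × V | w.2.1 ∈ S w.1}) :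
    Measurable fun w : Z × ℝ × V => cut (S w.1) (H w.1) w.2 := by
  convert hH.indicator hS using 1
  funext w
  exact cut_apply _ _ _ _

theorem inner_hypP (ξ : Eucl n) (v : hyperplane e) :
    inner ℝ ξ (v : Eucl n) = inner ℝ (hypP e ξ : Eucl n) (v : Eucl n) := by
  rw [← Submodule.coe_inner, hypP, Submodule.inner_orthogonalProjectionOnto_eq_of_mem_right]

theorem conj_phase_splitMap (z : ℝ × hyperplane e) (ξ : Eucl n) :
    starRingEnd ℂ (phase ε 0 (splitMap e z) ξ)
      = starRingEnd ℂ (phase ε 0 (z.1 • e) ξ)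
        * starRingEnd ℂ (phase ε 0 (z.2 : Eucl n) (hypP e ξ : Eucl n)) := by
  rw [← map_mul, phase, phase, phase, ← Complex.exp_add, splitMap, inner_add_right, inner_hypP]
  congr 2
  push_cast
  ring

theorem measurable_fourier_slice (hG : Measurable G) :
    Measurable fun z : ℝ × Eucl n => 𝓕 (fun y => G (z.1, y)) z.2 := by
  simp only [fourier_eq_integral_phase (fun _ : Fin n => (0 : ℝ))]
  refine measurable_integral_right (f := fun (z : ℝ × Eucl n) y =>
    starRingEnd ℂ (phase (fun _ : Fin n => (0 : ℝ)) 0 y z.2) * G (z.1, y)) ?_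
  exact (measurable_conj_phase (by fun_prop) (by fun_prop) (by fun_prop)).mul
    (hG.comp (f := fun w : (ℝ × Eucl n) × Eucl n => (w.1.1, w.2)) (by fun_prop))

theorem norm_fourier_slice_le {C : ℝ} (hC : ∀ s x, ‖G (s, x)‖ ≤ C * (1 + s ^ 2)⁻¹ * wgt n x)
    (s : ℝ) (ξ : Eucl n) :
    ‖𝓕 (fun y => G (s, y)) ξ‖ ≤ C * (1 + s ^ 2)⁻¹ * ∫ x : Eucl n, wgt n x := by
  rw [fourier_eq_integral_phase (fun _ : Fin n => (0 : ℝ)), ← integral_const_mul]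
  refine norm_integral_le_of_norm_le (integrable_wgt.const_mul _)
    (Eventually.of_forall fun v => ?_)
  rw [norm_mul, RCLike.norm_conj, norm_phase, one_mul]
  exact hC _ _

theorem integral_splitMap (he : ‖e‖ = 1) {g : Eucl n → ℂ} (hg : Integrable g) :
    ∫ y, g y = ∫ r : ℝ, ∫ v : hyperplane e, g (splitMap e (r, v)) := by
  have hsp := measurePreserving_splitMap he
  have hi : Integrable (fun z : ℝ × hyperplane e => g (splitMap e z))
      ((volume : Measure ℝ).prod (volume : Measure (hyperplane e))) :=
    hsp.integrable_comp_of_integrable hg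
  have h1 : ∫ y, g y ∂(Measure.map (splitMap e) volume)
      = ∫ z : ℝ × hyperplane e, g (splitMap e z) ∂volume :=
    integral_map hsp.measurable.aemeasurable (by rw [hsp.map_eq]; exact hg.aestronglyMeasurable)
  rw [hsp.map_eq, Measure.volume_eq_prod] at h1
  rw [h1, integral_prod _ hi]

theorem IsDec.integrable_conj_phase_mul (hG : IsDec G) (s : ℝ) (ξ : Eucl n) :
    Integrable fun y => starRingEnd ℂ (phase ε 0 y ξ) * G (s, y) :=
  (hG.integrable_slice s).bdd_mul (c := 1)
    (measurable_conj_phase (by fun_prop) (by fun_prop) (by fun_prop)).aestronglyMeasurable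
    (Eventually.of_forall fun s => by rw [RCLike.norm_conj, norm_phase])

theorem sliceFT_eq (r : ℝ) {z : ℝ × hyperplane e} (hz : ‖z.2‖ ≤ b) :
    sliceFT ε b e G r z = ∫ v : hyperplane e,
      starRingEnd ℂ (phase ε 0 (v : Eucl n) (z.2 : Eucl n)) * G (z.1, splitMap e (r, v)) := by
  rw [sliceFT, Set.indicator_of_mem (s := {z : ℝ × hyperplane e | ‖z.2‖ ≤ b}) hz]

theorem fourier_slice_eq (hG : IsDec G) (he : ‖e‖ = 1) (s : ℝ) {ξ : Eucl n} (hξ : ‖ξ‖ ≤ b) :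
    𝓕 (fun y => G (s, y)) ξ
      = ∫ r : ℝ, starRingEnd ℂ (phase ε 0 (r • e) ξ) * sliceFT ε b e G r (s, hypP e ξ) := by
  rw [fourier_eq_integral_phase ε, integral_splitMap he (hG.integrable_conj_phase_mul s ξ)]
  refine integral_congr_ae (Eventually.of_forall fun r => ?_)
  simp only
  rw [sliceFT_eq (z := (s, hypP e ξ)) r ((norm_hypP_le e ξ).trans hξ), ← integral_const_mul]
  refine integral_congr_ae (Eventually.of_forall fun v => ?_)
  simp only
  rw [conj_phase_splitMap, mul_assoc]

end Core

section Assembly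

variable {n : ℕ} {ε : Fin n → ℝ} {e : Eucl n} {A : Set (Eucl n)} {G : ℝ × Eucl n → ℂ} {b : ℝ}

theorem norm_conj_phase (s : ℝ) (x ξ : Eucl n) : ‖starRingEnd ℂ (phase ε s x ξ)‖ = 1 := by
  rw [RCLike.norm_conj, norm_phase]

theorem measurable_cut_sliceFT (hG : IsDec G) {S : Set ℝ} (hS : MeasurableSet S) :
    Measurable fun w : ℝ × ℝ × hyperplane e => cut S (sliceFT ε b e G w.1) w.2 :=
  measurable_cut_comp (H := fun r => sliceFT ε b e G r) (S := fun _ => S)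
    (measurable_sliceFT ε b hG) ((measurable_fst.comp measurable_snd) hS)

theorem norm_lsDens_sliceFT_le {C : ℝ} (hC : ∀ s x, ‖G (s, x)‖ ≤ C * (1 + s ^ 2)⁻¹ * wgt n x)
    (he : ‖e‖ = 1) (S : Set ℝ) (r : ℝ) (ξ : Eucl n) :
    ‖lsDens ε e A (cut S (sliceFT ε b e G r)) ξ‖ ≤ (∫ s : ℝ, C * (1 + s ^ 2)⁻¹) * hypW e r := by
  refine (norm_indicator_le_norm_self _ _).trans ?_
  rw [← integral_mul_const]
  refine norm_integral_le_of_norm_le ((integrable_inv_one_add_sq.const_mul C).mul_const _)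
    (Eventually.of_forall fun s => ?_)
  rw [norm_mul, norm_conj_phase, one_mul]
  exact (norm_cut_le _ _ _).trans (norm_sliceFT_le ε b hC he r (s, hypP e ξ))

theorem setIntegral_fourier_slice (hG : IsDec G) (he : ‖e‖ = 1) (hAb : ∀ ξ ∈ A, ‖ξ‖ ≤ b) {S : Set ℝ}
    (hS : MeasurableSet S) {ξ : Eucl n} (hξ : ξ ∈ A) :
    ∫ s in S, starRingEnd ℂ (phase ε s 0 ξ) * 𝓕 (fun y => G (s, y)) ξ
      = ∫ r : ℝ, starRingEnd ℂ (phase ε 0 (r • e) ξ)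
          * lsDens ε e A (cut S (sliceFT ε b e G r)) ξ := by
  obtain ⟨C, hC0, hC⟩ := hG.decay
  set f : ℝ → ℝ → ℂ := fun s r => starRingEnd ℂ (phase ε s 0 ξ)
    * (starRingEnd ℂ (phase ε 0 (r • e) ξ) * sliceFT ε b e G r (s, hypP e ξ)) with hf
  have hfm : Measurable (Function.uncurry f) := by
    refine Measurable.mul (measurable_conj_phase (by fun_prop) (by fun_prop) (by fun_prop))
      (Measurable.mul (measurable_conj_phase (by fun_prop) (by fun_prop) (by fun_prop)) ?_)
    exact (measurable_sliceFT ε b hG).comp (f := fun z : ℝ × ℝ => (z.2, z.1, hypP e ξ))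
      (by fun_prop)
  have hfi : Integrable (Function.uncurry f) ((volume.restrict S).prod volume) := by
    refine integrable_uncurry_of_norm_le hfm
      (integrable_inv_one_add_sq.const_mul C).integrableOn (integrable_hypW he) fun s r => ?_
    simp only [hf, norm_mul, norm_conj_phase, one_mul]
    exact norm_sliceFT_le ε b hC he r (s, hypP e ξ)
  calc ∫ s in S, starRingEnd ℂ (phase ε s 0 ξ) * 𝓕 (fun y => G (s, y)) ξ
      = ∫ s in S, ∫ r, f s r := by
        refine integral_congr_ae (Eventually.of_forall fun s => ?_)
        simp only [hf]
        rw [fourier_slice_eq (ε := ε) hG he s (hAb ξ hξ), ← integral_const_mul]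
    _ = ∫ r, ∫ s in S, f s r := integral_integral_swap hfi
    _ = _ := by
        refine integral_congr_ae (Eventually.of_forall fun r => ?_)
        simp only [hf]
        rw [lsDens, Set.indicator_of_mem hξ, ← integral_indicator hS, ← integral_const_mul]
        refine integral_congr_ae (Eventually.of_forall fun s => ?_)
        simp only
        rw [cut_apply]
        by_cases hs : s ∈ S
        · rw [Set.indicator_of_mem hs, Set.indicator_of_mem hs]
          ring
        · rw [Set.indicator_of_notMem hs, Set.indicator_of_notMem hs, mul_zero, mul_zero]

/-- The integrand of the slice superposition. -/
theorem integrable_slice_density (hG : IsDec G) (he : ‖e‖ = 1) (hA : MeasurableSet A)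
    (hA' : Bornology.IsBounded A) {S : Set ℝ} (hS : MeasurableSet S) (t : ℝ) (x : Eucl n) :
    Integrable (Function.uncurry fun (ξ : Eucl n) (r : ℝ) =>
      phase ε t (x - r • e) ξ * lsDens ε e A (cut S (sliceFT ε b e G r)) ξ)
      ((volume.restrict A).prod volume) := by
  obtain ⟨C, hC0, hC⟩ := hG.decay
  have hm : Measurable fun z : Eucl n × ℝ => lsDens ε e A (cut S (sliceFT ε b e G z.2)) z.1 :=
    measurable_lsDens_comp (Z := Eucl n × ℝ) (H := fun z => cut S (sliceFT ε b e G z.2)) hA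
      ((measurable_cut_sliceFT hG hS).comp
        (f := fun w : (Eucl n × ℝ) × ℝ × hyperplane e => (w.1.2, w.2)) (by fun_prop)) measurable_fst
  have : IsFiniteMeasure (volume.restrict A) := ⟨by
    rw [Measure.restrict_apply_univ]; exact hA'.measure_lt_top⟩
  refine integrable_uncurry_of_norm_le (u := fun _ => ∫ s : ℝ, C * (1 + s ^ 2)⁻¹)
    ((measurable_phase_comp ε (by fun_prop) (by fun_prop) (by fun_prop)).mul hm)
    (integrable_const _) (integrable_hypW he) fun ξ r => ?_
  rw [norm_mul, norm_phase, one_mul]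
  exact norm_lsDens_sliceFT_le hC he S r ξ

theorem extn_lsDens_eq (h : ℝ × hyperplane e → ℂ) (t : ℝ) (x : Eucl n) :
    extn ε (lsDens ε e A h) t x = ∫ ξ in A, phase ε t x ξ * lsDens ε e A h ξ := by
  rw [extn, setIntegral_eq_integral_of_forall_compl_eq_zero]
  intro ξ hξ
  rw [lsDens, Set.indicator_of_notMem hξ, mul_zero]

theorem integrable_extn_slice (hG : IsDec G) (he : ‖e‖ = 1) (hA : MeasurableSet A)
    (hA' : Bornology.IsBounded A) {S : Set ℝ} (hS : MeasurableSet S) (t : ℝ) (x : Eucl n) :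
    Integrable fun r : ℝ => extn ε (lsDens ε e A (cut S (sliceFT ε b e G r))) t (x - r • e) := by
  simp only [extn_lsDens_eq]
  exact (integrable_slice_density hG he hA hA' hS t x).integral_prod_right

theorem setIntegral_piece_eq (hG : IsDec G) (he : ‖e‖ = 1) (hA : MeasurableSet A)
    (hA' : Bornology.IsBounded A) (hAb : ∀ ξ ∈ A, ‖ξ‖ ≤ b) {S : Set ℝ} (hS : MeasurableSet S)
    (t : ℝ) (x : Eucl n) :
    ∫ s in S, ∫ ξ in A, phase ε (t - s) x ξ * 𝓕 (fun y => G (s, y)) ξ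
      = ∫ r : ℝ, extn ε (lsDens ε e A (cut S (sliceFT ε b e G r))) t (x - r • e) := by
  obtain ⟨C, hC0, hC⟩ := hG.decay
  have : IsFiniteMeasure (volume.restrict A) := ⟨by
    rw [Measure.restrict_apply_univ]; exact hA'.measure_lt_top⟩
  set f : ℝ → Eucl n → ℂ := fun s ξ => phase ε (t - s) x ξ * 𝓕 (fun y => G (s, y)) ξ with hf
  have hfi : Integrable (Function.uncurry f) ((volume.restrict S).prod (volume.restrict A)) := by
    refine integrable_uncurry_of_norm_le (v := fun _ => ∫ x : Eucl n, wgt n x)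
      (Measurable.mul (measurable_phase_comp ε (by fun_prop) (by fun_prop) (by fun_prop))
        (measurable_fourier_slice hG.measurable))
      (integrable_inv_one_add_sq.const_mul C).integrableOn (integrable_const _) fun s ξ => ?_
    simp only [hf, norm_mul, norm_phase, one_mul]
    exact norm_fourier_slice_le hC s ξ
  rw [integral_integral_swap hfi]
  calc ∫ ξ in A, ∫ s in S, f s ξ
      = ∫ ξ in A, ∫ r : ℝ, phase ε t (x - r • e) ξ
          * lsDens ε e A (cut S (sliceFT ε b e G r)) ξ := by
        refine setIntegral_congr_fun hA fun ξ hξ => ?_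
        have h1 : ∀ s, f s ξ = phase ε t x ξ
            * (starRingEnd ℂ (phase ε s 0 ξ) * 𝓕 (fun y => G (s, y)) ξ) := fun s => by
          simp only [hf]
          rw [← mul_assoc, phase_mul_conj, sub_zero]
        simp only [h1]
        rw [integral_const_mul, setIntegral_fourier_slice hG he hAb hS hξ, ← integral_const_mul]
        refine integral_congr_ae (Eventually.of_forall fun r => ?_)
        simp only
        rw [← mul_assoc, phase_mul_conj, sub_zero]
    _ = _ := by
        rw [integral_integral_swap (integrable_slice_density hG he hA hA' hS t x)]
        simp only [extn_lsDens_eq]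

end Assembly

section Cones

variable {n : ℕ}

/-- The part of the annulus `a ≤ |ξ| ≤ b` where `k` is the least index whose coordinate carries at
least the average share of `|ξ|`. -/
def coneSet (a b : ℝ) (k : Fin n) : Set (Eucl n) :=
  {ξ | a ≤ ‖ξ‖} ∩ {ξ | ‖ξ‖ ≤ b} ∩ {ξ | ‖ξ‖ ≤ √n * |ξ k|} ∩ ⋂ i, {ξ | i < k → √n * |ξ i| < ‖ξ‖}

theorem mem_coneSet {a b : ℝ} {k : Fin n} {ξ : Eucl n} :
    ξ ∈ coneSet a b k ↔ ((a ≤ ‖ξ‖ ∧ ‖ξ‖ ≤ b) ∧ ‖ξ‖ ≤ √n * |ξ k|) ∧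
      ∀ i, i < k → √n * |ξ i| < ‖ξ‖ := by
  simp only [coneSet, Set.mem_inter_iff, Set.mem_ofPred_eq, Set.mem_iInter]

theorem measurable_abs_apply (k : Fin n) : Measurable fun ξ : Eucl n => √n * |ξ k| := by
  have : Continuous fun ξ : Eucl n => √n * |ξ k| := by fun_prop
  exact this.measurable

theorem measurableSet_coneSet (a b : ℝ) (k : Fin n) : MeasurableSet (coneSet a b k) := by
  refine (((measurableSet_le measurable_const measurable_norm).inter
    (measurableSet_le measurable_norm measurable_const)).inter
    (measurableSet_le measurable_norm (measurable_abs_apply k))).inter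
    (MeasurableSet.iInter fun i => ?_)
  by_cases hi : i < k
  · simp only [hi, true_implies]
    exact measurableSet_lt (measurable_abs_apply i) measurable_norm
  · simp only [hi, false_implies, Set.ofPred_true, MeasurableSet.univ]

theorem isBounded_coneSet (a b : ℝ) (k : Fin n) : Bornology.IsBounded (coneSet a b k) := by
  refine (Metric.isBounded_closedBall (x := (0 : Eucl n)) (r := b)).subset fun ξ hξ => ?_
  rw [mem_closedBall_zero_iff]
  exact (mem_coneSet.mp hξ).1.1.2

theorem le_abs_of_mem_coneSet {a b : ℝ} {k : Fin n} {ξ : Eucl n} (hξ : ξ ∈ coneSet a b k) :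
    a / √n ≤ |ξ k| := by
  obtain ⟨⟨⟨h1, -⟩, h2⟩, -⟩ := mem_coneSet.mp hξ
  have hn : (0 : ℝ) < n := by exact_mod_cast k.pos
  rw [div_le_iff₀ (Real.sqrt_pos.mpr hn), mul_comm]
  exact h1.trans h2

theorem exists_norm_le_coord (hn : 0 < n) (ξ : Eucl n) : ∃ k, ‖ξ‖ ≤ √n * |ξ k| := by
  by_contra! h
  have h1 : ∀ k, (n : ℝ) * ξ k ^ 2 < ‖ξ‖ ^ 2 := fun k => by
    have := pow_lt_pow_left₀ (h k) (by positivity) two_ne_zero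
    rwa [mul_pow, Real.sq_sqrt n.cast_nonneg, sq_abs] at this
  have : NeZero n := ⟨hn.ne'⟩
  have h2 := Finset.sum_lt_sum_of_nonempty (s := Finset.univ) Finset.univ_nonempty
    fun k _ => h1 k
  rw [← Finset.mul_sum, Finset.sum_const, Finset.card_univ, Fintype.card_fin, nsmul_eq_mul,
    EuclideanSpace.norm_sq_eq] at h2
  simp only [Real.norm_eq_abs, sq_abs, lt_self_iff_false] at h2

theorem existsUnique_mem_coneSet (hn : 0 < n) {a b : ℝ} {ξ : Eucl n} (ha : a ≤ ‖ξ‖)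
    (hb : ‖ξ‖ ≤ b) : ∃ k, ξ ∈ coneSet a b k ∧ ∀ l ≠ k, ξ ∉ coneSet a b l := by
  obtain ⟨k, hk, hmin⟩ := wellFounded_lt.has_min {k : Fin n | ‖ξ‖ ≤ √n * |ξ k|}
    (exists_norm_le_coord hn ξ)
  refine ⟨k, mem_coneSet.mpr ⟨⟨⟨ha, hb⟩, hk⟩, fun i hi => not_le.mp fun h => hmin i h hi⟩,
    fun l hl h => ?_⟩
  obtain ⟨⟨-, h2⟩, h3⟩ := mem_coneSet.mp h
  rcases lt_or_gt_of_ne hl with h4 | h4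
  · exact hmin l h2 h4
  · exact absurd hk (not_le.mpr (h3 k h4))

theorem eq_sum_indicator_coneSet (hn : 0 < n) {a b : ℝ} {g : Eucl n → ℂ}
    (hg : ∀ ξ, g ξ ≠ 0 → a ≤ ‖ξ‖ ∧ ‖ξ‖ ≤ b) (ξ : Eucl n) :
    g ξ = ∑ k, (coneSet a b k).indicator g ξ := by
  by_cases h : g ξ = 0
  · rw [h, Finset.sum_eq_zero]
    intro k _
    exact Set.indicator_apply_eq_zero.mpr fun _ => h
  · obtain ⟨k, hk, hk'⟩ := existsUnique_mem_coneSet hn (hg ξ h).1 (hg ξ h).2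
    rw [Finset.sum_eq_single k (fun l _ hl => Set.indicator_of_notMem (hk' l hl) _)
      (fun h => absurd (Finset.mem_univ k) h), Set.indicator_of_mem hk]

end Cones

section Duhamel

variable {n : ℕ} {ε : Fin n → ℝ} {e : Eucl n} {A : Set (Eucl n)} {G : ℝ × Eucl n → ℂ} {a b : ℝ}

theorem prop_eq_integral (t : ℝ) (f : Eucl n → ℂ) (x : Eucl n) :
    prop ε t f x = ∫ ξ, phase ε t x ξ * 𝓕 f ξ := by
  rw [prop, mulOp, fourierInv_eq_integral_phase ε]
  refine integral_congr_ae (Eventually.of_forall fun ξ => ?_)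
  simp only
  have h : cexp (-Complex.I * t * quadSym ε ξ) = phase ε t 0 ξ := by
    rw [phase, inner_zero_right]
    congr 1
    push_cast
    ring
  rw [phase_eq_mul ε t x ξ, h, mul_assoc]

theorem integrable_phase_mul_fourier (hG : IsDec G) (hA' : Bornology.IsBounded A) (t : ℝ)
    (x : Eucl n) : Integrable (Function.uncurry fun (s : ℝ) (ξ : Eucl n) =>
      phase ε (t - s) x ξ * 𝓕 (fun y => G (s, y)) ξ) (volume.prod (volume.restrict A)) := by
  obtain ⟨C, hC0, hC⟩ := hG.decay
  have : IsFiniteMeasure (volume.restrict A) := ⟨by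
    rw [Measure.restrict_apply_univ]; exact hA'.measure_lt_top⟩
  refine integrable_uncurry_of_norm_le (v := fun _ => ∫ x : Eucl n, wgt n x)
    (Measurable.mul (measurable_phase_comp ε (by fun_prop) (by fun_prop) (by fun_prop))
      (measurable_fourier_slice hG.measurable))
    (integrable_inv_one_add_sq.const_mul C) (integrable_const _) fun s ξ => ?_
  rw [norm_mul, norm_phase, one_mul]
  exact norm_fourier_slice_le hC s ξ

theorem integrableOn_phase_mul_fourier (hG : IsDec G) (hA' : Bornology.IsBounded A) (t s : ℝ)
    (x : Eucl n) : IntegrableOn (fun ξ : Eucl n => phase ε t x ξ * 𝓕 (fun y => G (s, y)) ξ) A := by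
  obtain ⟨C, hC0, hC⟩ := hG.decay
  have : IsFiniteMeasure (volume.restrict A) := ⟨by
    rw [Measure.restrict_apply_univ]; exact hA'.measure_lt_top⟩
  refine (integrable_const (C * (1 + s ^ 2)⁻¹ * ∫ x : Eucl n, wgt n x)).mono'
    ((measurable_phase_right ε t x).mul ((measurable_fourier_slice hG.measurable).comp
      (f := fun ξ : Eucl n => (s, ξ)) (by fun_prop))).aestronglyMeasurable
    (Eventually.of_forall fun ξ => ?_)
  rw [norm_mul, norm_phase, one_mul]
  exact norm_fourier_slice_le hC s ξ

/-- The contribution of the slice at height `r` to the Duhamel integral. -/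
def sliceSol (ε : Fin n → ℝ) (e : Eucl n) (A : Set (Eucl n)) (b : ℝ) (G : ℝ × Eucl n → ℂ) (r t : ℝ)
    (x : Eucl n) : ℂ :=
  extn ε (lsDens ε e A (cut (Set.Iio t) (sliceFT ε b e G r))) t x
    - extn ε (lsDens ε e A (cut (Set.Iio 0) (sliceFT ε b e G r))) t x

theorem intervalIntegral_piece_eq (hG : IsDec G) (he : ‖e‖ = 1) (hA : MeasurableSet A)
    (hA' : Bornology.IsBounded A) (hAb : ∀ ξ ∈ A, ‖ξ‖ ≤ b) (t : ℝ) (x : Eucl n) :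
    ∫ s in (0 : ℝ)..t, ∫ ξ in A, phase ε (t - s) x ξ * 𝓕 (fun y => G (s, y)) ξ
      = ∫ r : ℝ, sliceSol ε e A b G r t (x - r • e) := by
  have hi := (integrable_phase_mul_fourier (ε := ε) hG hA' t x).integral_prod_left
  simp only [Function.uncurry] at hi
  rw [← intervalIntegral.integral_Iic_sub_Iic hi.integrableOn hi.integrableOn,
    integral_Iic_eq_integral_Iio, integral_Iic_eq_integral_Iio,
    setIntegral_piece_eq hG he hA hA' hAb measurableSet_Iio,
    setIntegral_piece_eq hG he hA hA' hAb measurableSet_Iio]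
  exact (integral_sub (integrable_extn_slice hG he hA hA' measurableSet_Iio t x)
    (integrable_extn_slice hG he hA hA' measurableSet_Iio t x)).symm

theorem duhamel_eq_sum (hn : 0 < n) (hG : IsDec G)
    (hsupp : ∀ s ξ, 𝓕 (fun y => G (s, y)) ξ ≠ 0 → a ≤ ‖ξ‖ ∧ ‖ξ‖ ≤ b) (t : ℝ) (x : Eucl n) :
    duhamel ε G (t, x) = ∑ k : Fin n, ∫ r : ℝ, sliceSol ε (EuclideanSpace.single k (1 : ℝ))
      (coneSet a b k) b G r t (x - r • EuclideanSpace.single k (1 : ℝ)) := by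
  have h1 : ∀ s, prop ε (t - s) (fun y => G (s, y)) x
      = ∑ k : Fin n, ∫ ξ in coneSet a b k, phase ε (t - s) x ξ * 𝓕 (fun y => G (s, y)) ξ := by
    intro s
    rw [prop_eq_integral]
    simp only [← integral_indicator (measurableSet_coneSet a b _)]
    rw [← integral_finsetSum _ fun k _ => (integrable_indicator_iff
      (measurableSet_coneSet a b k)).mpr (integrableOn_phase_mul_fourier hG
        (isBounded_coneSet a b k) (t - s) s x)]
    refine integral_congr_ae (Eventually.of_forall fun ξ => ?_)
    exact eq_sum_indicator_coneSet hn (g := fun ξ => phase ε (t - s) x ξ * 𝓕 (fun y => G (s, y)) ξ)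
      (fun ξ hξ => hsupp s ξ (right_ne_zero_of_mul hξ)) ξ
  rw [duhamel]
  simp only [h1]
  rw [intervalIntegral.integral_finsetSum]
  · refine Finset.sum_congr rfl fun k _ => ?_
    exact intervalIntegral_piece_eq hG (by simp) (measurableSet_coneSet a b k)
      (isBounded_coneSet a b k) (fun ξ hξ => (mem_coneSet.mp hξ).1.1.2) t x
  · intro k _
    have hi := (integrable_phase_mul_fourier (ε := ε) hG (isBounded_coneSet a b k)
      t x).integral_prod_left
    exact hi.intervalIntegrable

end Duhamel

section Mixed

/-- The mixed Lebesgue norm of a nonnegative function. -/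
def mixL {X : Type*} [MeasurableSpace X] (μ : Measure X) (q r : ℝ) (w : ℝ → X → ℝ≥0∞) : ℝ≥0∞ :=
  (∫⁻ t, (∫⁻ x, w t x ^ r ∂μ) ^ (q / r)) ^ (1 / q)

variable {X : Type*} [MeasurableSpace X] {ν : Measure X}

theorem mixL_mono {q r : ℝ} (hq : 0 ≤ q) (hr : 0 ≤ r) {w w' : ℝ → X → ℝ≥0∞}
    (h : ∀ t x, w t x ≤ w' t x) : mixL ν q r w ≤ mixL ν q r w' := by
  unfold mixL
  gcongr with t x
  exact h t x

variable [SigmaFinite ν]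

theorem mixL_lintegral_le {α : Type*} [MeasurableSpace α] {μ : Measure α} [SFinite μ]
    {f : α → ℝ → X → ℝ≥0∞} (hf : Measurable fun z : α × ℝ × X => f z.1 z.2.1 z.2.2) {q r : ℝ}
    (hq : 1 < q) (hr : 1 < r) :
    mixL ν q r (fun t x => ∫⁻ a, f a t x ∂μ) ≤ ∫⁻ a, mixL ν q r (f a) ∂μ := by
  have hr0 : 0 < r := by linarith
  have hpow : ∀ y : ℝ≥0∞, y ^ (q / r) = (y ^ (1 / r)) ^ q := fun y => by
    rw [← ENNReal.rpow_mul]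
    congr 1
    ring
  have h1 : Measurable fun z : (α × ℝ) × X => f z.1.1 z.1.2 z.2 ^ r :=
    (hf.comp (f := fun z : (α × ℝ) × X => (z.1.1, z.1.2, z.2)) (by fun_prop)).pow_const r
  have h2 : Measurable (Function.uncurry fun (a : α) (t : ℝ) =>
      (∫⁻ x, f a t x ^ r ∂ν) ^ (1 / r)) :=
    (h1.lintegral_prod_right' (f := fun z : (α × ℝ) × X => f z.1.1 z.1.2 z.2 ^ r)).pow_const _
  unfold mixL
  simp only [hpow]
  refine le_trans (ENNReal.rpow_le_rpow (lintegral_mono fun t => ENNReal.rpow_le_rpow ?_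
    (by linarith)) (by positivity)) (lintegral_Lp_lintegral_le h2 hq)
  exact lintegral_Lp_lintegral_le (f := fun a x => f a t x)
    (hf.comp (f := fun z : α × X => (z.1, t, z.2)) (by fun_prop)) hr

theorem mixL_sum_le {n : ℕ} {f : Fin n → ℝ → X → ℝ≥0∞}
    (hf : ∀ k, Measurable fun z : ℝ × X => f k z.1 z.2) {q r : ℝ} (hq : 1 < q) (hr : 1 < r) :
    mixL ν q r (fun t x => ∑ k, f k t x) ≤ ∑ k, mixL ν q r (f k) := by
  have h1 : Measurable fun z : Fin n × ℝ × X => f z.1 z.2.1 z.2.2 :=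
    measurable_from_prod_countable_right hf
  have h2 := mixL_lintegral_le (ν := ν) (μ := Measure.count) h1 hq hr
  simpa only [lintegral_count, tsum_fintype] using h2

theorem mixL_translate {n : ℕ} {q r : ℝ} (w : ℝ → Eucl n → ℝ≥0∞) (y : Eucl n) :
    mixL volume q r (fun t x => w t (x - y)) = mixL volume q r w := by
  unfold mixL
  congr 2
  funext t
  rw [lintegral_sub_right_eq_self (fun x => w t x ^ r) y]

theorem mixNorm_eq_mixL {n : ℕ} {q r : ℝ} (hq : 0 < q) (hr : 0 < r) (u : ℝ × Eucl n → ℂ) :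
    mixNorm (ENNReal.ofReal q) (ENNReal.ofReal r) u
      = mixL volume q r (fun t x => ‖u (t, x)‖ₑ) := by
  rw [mixNorm, if_neg ENNReal.ofReal_ne_top, ENNReal.toReal_ofReal hq.le, mixL]
  congr 2
  funext t
  rw [eLpNorm_eq_lintegral_rpow_enorm_toReal (ENNReal.ofReal_pos.mpr hr).ne' ENNReal.ofReal_ne_top,
    ENNReal.toReal_ofReal hr.le, ← ENNReal.rpow_mul]
  congr 1
  ring

end Mixed

section Bound

variable {n : ℕ} {ε : Fin n → ℝ} {e : Eucl n} {A : Set (Eucl n)} {G : ℝ × Eucl n → ℂ} {a b : ℝ}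

theorem measurable_sliceSol (hG : IsDec G) (hA : MeasurableSet A) :
    Measurable fun z : ℝ × ℝ × Eucl n => sliceSol ε e A b G z.1 z.2.1 (z.2.2 - z.1 • e) := by
  have hH : Measurable fun w : (ℝ × ℝ × Eucl n) × ℝ × hyperplane e =>
      sliceFT ε b e G w.1.1 w.2 :=
    (measurable_sliceFT ε b hG).comp
      (f := fun w : (ℝ × ℝ × Eucl n) × ℝ × hyperplane e => (w.1.1, w.2)) (by fun_prop)
  refine Measurable.sub ?_ ?_
  · refine measurable_extn_lsDens_comp (Z := ℝ × ℝ × Eucl n)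
      (H := fun z => cut (Set.Iio z.2.1) (sliceFT ε b e G z.1)) hA
      (measurable_cut_comp (H := fun z : ℝ × ℝ × Eucl n => sliceFT ε b e G z.1)
        (S := fun z => Set.Iio z.2.1) hH ?_) (by fun_prop) (by fun_prop)
    exact measurableSet_lt (f := fun w : (ℝ × ℝ × Eucl n) × ℝ × hyperplane e => w.2.1)
      (g := fun w => w.1.2.1) (by fun_prop) (by fun_prop)
  · refine measurable_extn_lsDens_comp (Z := ℝ × ℝ × Eucl n)
      (H := fun z => cut (Set.Iio 0) (sliceFT ε b e G z.1)) hA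
      (measurable_cut_comp (H := fun z : ℝ × ℝ × Eucl n => sliceFT ε b e G z.1)
        (S := fun _ => Set.Iio 0) hH ?_) (by fun_prop) (by fun_prop)
    exact measurableSet_lt (f := fun w : (ℝ × ℝ × Eucl n) × ℝ × hyperplane e => w.2.1)
      (g := fun _ => (0 : ℝ)) (by fun_prop) (by fun_prop)

theorem aniNorm_one_eq (p : ℝ≥0∞) (e : Eucl n) (u : ℝ × Eucl n → ℂ) :
    aniNorm 1 p e u = ∫⁻ r, innerQ p e u r := by
  rw [aniNorm, if_neg ENNReal.one_ne_top, ENNReal.toReal_one, div_one, ENNReal.rpow_one]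
  simp only [ENNReal.rpow_one]

theorem exists_duhamel_const (hn : 0 < n) (hε : ∀ i, ε i = 1 ∨ ε i = -1) {q r : ℝ} (hq : 2 < q)
    (hr : 2 < r) (hqr : 2 / q = (n : ℝ) * (1 / 2 - 1 / r)) :
    ∃ C : ℝ≥0∞, C ≠ ∞ ∧ ∀ (a b : ℝ), 0 < a → ∀ G : ℝ × Eucl n → ℂ, IsDec G →
      (∀ s ξ, 𝓕 (fun y => G (s, y)) ξ ≠ 0 → a ≤ ‖ξ‖ ∧ ‖ξ‖ ≤ b) →
      mixNorm (ENNReal.ofReal q) (ENNReal.ofReal r) (duhamel ε G)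
        ≤ C * ENNReal.ofReal (2 * Real.pi / (a / √n)) ^ ((1 : ℝ) / 2)
          * sphSup (fun e => aniNorm 1 2 e G) := by
  obtain ⟨C, hC, hR⟩ := exists_retarded_const hε hq hr hqr
  refine ⟨n * C, ENNReal.mul_ne_top (ENNReal.natCast_ne_top n) hC, fun a b ha G hG hsupp => ?_⟩
  have hc : 0 < a / √n := div_pos ha (Real.sqrt_pos.mpr (by exact_mod_cast hn))
  set K : ℝ≥0∞ := C * ENNReal.ofReal (2 * Real.pi / (a / √n)) ^ ((1 : ℝ) / 2) with hK
  set w : Fin n → ℝ → ℝ → Eucl n → ℝ≥0∞ := fun k ρ t x =>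
    ‖sliceSol ε (EuclideanSpace.single k (1 : ℝ)) (coneSet a b k) b G ρ t
      (x - ρ • EuclideanSpace.single k (1 : ℝ))‖ₑ with hw
  have hwm : ∀ k, Measurable fun z : ℝ × ℝ × Eucl n => w k z.1 z.2.1 z.2.2 := fun k =>
    (measurable_sliceSol hG (measurableSet_coneSet a b k)).enorm
  have hwk : ∀ k ρ, mixL volume q r (w k ρ)
      ≤ K * innerQ 2 (EuclideanSpace.single k (1 : ℝ)) G ρ := by
    intro k ρ
    refine (mixL_translate (fun t x => ‖sliceSol ε (EuclideanSpace.single k (1 : ℝ))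
      (coneSet a b k) b G ρ t x‖ₑ) _).trans_le ?_
    refine (hR k (a / √n) hc (coneSet a b k) (measurableSet_coneSet a b k)
      (isBounded_coneSet a b k) (fun ξ hξ => le_abs_of_mem_coneSet hξ) _
      (hG.isGood_sliceFT ε b (by simp) ρ)).trans ?_
    exact mul_le_mul_right (l2N_sliceFT_le ε b hG (by simp) ρ) _
  rw [mixNorm_eq_mixL (by linarith) (by linarith)]
  calc mixL volume q r (fun t x => ‖duhamel ε G (t, x)‖ₑ)
      ≤ mixL volume q r (fun t x => ∑ k, ∫⁻ ρ, w k ρ t x) := by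
        refine mixL_mono (by linarith) (by linarith) fun t x => ?_
        rw [duhamel_eq_sum hn hG hsupp]
        exact (enorm_sum_le _ _).trans
          (Finset.sum_le_sum fun k _ => enorm_integral_le_lintegral_enorm _)
    _ ≤ ∑ k, mixL volume q r (fun t x => ∫⁻ ρ, w k ρ t x) := by
        refine mixL_sum_le (fun k => ?_) (by linarith) (by linarith)
        exact ((hwm k).comp (f := fun z : (ℝ × Eucl n) × ℝ => (z.2, z.1))
          (by fun_prop)).lintegral_prod_right'
    _ ≤ ∑ k : Fin n, K * sphSup (fun e => aniNorm 1 2 e G) := by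
        refine Finset.sum_le_sum fun k _ => ?_
        refine (mixL_lintegral_le (hwm k) (by linarith) (by linarith)).trans ?_
        refine (lintegral_mono (hwk k)).trans ?_
        rw [lintegral_const_mul' _ _ (ENNReal.mul_ne_top hC
          (ENNReal.rpow_ne_top_of_nonneg (by norm_num) ENNReal.ofReal_ne_top)), ← aniNorm_one_eq]
        refine mul_le_mul_right ?_ _
        exact le_iSup₂_of_le (f := fun (e : Eucl n) (_ : ‖e‖ = 1) => aniNorm 1 2 e G)
          (EuclideanSpace.single k (1 : ℝ)) (by simp) le_rfl
    _ = _ := by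
        rw [Finset.sum_const, Finset.card_univ, Fintype.card_fin, nsmul_eq_mul, hK]
        ring

end Bound

section LittlewoodPaley

variable {n : ℕ}

/-- The Littlewood–Paley symbol as a function on `ℝⁿ`. -/
def lpSym (n : ℕ) (χ : ℝ → ℝ) (j : ℤ) (ξ : Eucl n) : ℂ := (psiR χ ((2 : ℝ) ^ (-j) * ‖ξ‖) : ℂ)

variable {χ : ℝ → ℝ}

theorem IsBump.psiR_eq_zero_of_le (hχ : IsBump χ) {s : ℝ} (hs : |s| ≤ 1 / 2) : psiR χ s = 0 := by
  rw [psiR, hχ.one _ (by rw [abs_abs]; linarith),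
    hχ.one _ (by rw [abs_mul, abs_abs, abs_two]; linarith), sub_self]

theorem IsBump.psiR_eq_zero_of_ge (hχ : IsBump χ) {s : ℝ} (hs : 2 ≤ |s|) : psiR χ s = 0 := by
  rw [psiR, hχ.supp _ (by rwa [abs_abs]),
    hχ.supp _ (by rw [abs_mul, abs_abs, abs_two]; linarith), sub_self]

theorem abs_two_zpow_mul_norm (j : ℤ) (ξ : Eucl n) :
    |(2 : ℝ) ^ (-j) * ‖ξ‖| = ‖ξ‖ / (2 : ℝ) ^ j := by
  rw [abs_of_nonneg (by positivity), zpow_neg]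
  ring

theorem IsBump.lpSym_ne_zero (hχ : IsBump χ) {j : ℤ} {ξ : Eucl n} (h : lpSym n χ j ξ ≠ 0) :
    (2 : ℝ) ^ j / 2 ≤ ‖ξ‖ ∧ ‖ξ‖ ≤ 2 * (2 : ℝ) ^ j := by
  have h2 : (0 : ℝ) < (2 : ℝ) ^ j := by positivity
  have key : ∀ s, (|s| ≤ 1 / 2 ∨ 2 ≤ |s|) → psiR χ s = 0 := fun s hs =>
    hs.elim hχ.psiR_eq_zero_of_le hχ.psiR_eq_zero_of_ge
  by_contra hcon
  refine h ?_
  rw [lpSym, key, Complex.ofReal_zero]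
  rw [abs_two_zpow_mul_norm, div_le_iff₀ h2, le_div_iff₀ h2]
  by_contra hc
  push Not at hc
  exact hcon ⟨by linarith [hc.1], by linarith [hc.2]⟩

theorem IsBump.contDiff_lpSym (hχ : IsBump χ) (j : ℤ) :
    ContDiff ℝ (⊤ : ℕ∞) (lpSym n χ j) := by
  have h2 : (0 : ℝ) < (2 : ℝ) ^ j := by positivity
  refine contDiff_iff_contDiffAt.mpr fun ξ => ?_
  rcases eq_or_ne ξ 0 with rfl | hξ
  · have : lpSym n χ j =ᶠ[𝓝 0] fun _ => 0 := by
      filter_upwards [Metric.ball_mem_nhds (0 : Eucl n) (half_pos h2)] with ξ hξ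
      by_contra hne
      have := (hχ.lpSym_ne_zero hne).1
      rw [mem_ball_zero_iff] at hξ
      linarith
    exact contDiffAt_const.congr_of_eventuallyEq this
  · have hc : ContDiff ℝ (⊤ : ℕ∞) χ := contDiff_infty.mpr hχ.smooth
    have h1 : ContDiffAt ℝ (⊤ : ℕ∞) (fun ξ : Eucl n => (2 : ℝ) ^ (-j) * ‖ξ‖) ξ :=
      contDiffAt_const.mul (contDiffAt_norm ℝ hξ)
    have h3 : ContDiffAt ℝ (⊤ : ℕ∞) (fun ξ : Eucl n => ((χ ((2 : ℝ) ^ (-j) * ‖ξ‖)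
        - χ (2 * ((2 : ℝ) ^ (-j) * ‖ξ‖)) : ℝ) : ℂ)) ξ :=
      Complex.ofRealCLM.contDiff.contDiffAt.comp ξ ((hc.contDiffAt.comp ξ h1).sub
        (hc.contDiffAt.comp ξ (contDiffAt_const.mul h1)))
    refine h3.congr_of_eventuallyEq (Eventually.of_forall fun η => ?_)
    simp only [lpSym, psiR]
    rw [abs_of_nonneg (by positivity)]

theorem IsBump.hasCompactSupport_lpSym (hχ : IsBump χ) (j : ℤ) :
    HasCompactSupport (lpSym n χ j) := by
  refine HasCompactSupport.intro (isCompact_closedBall (0 : Eucl n) (2 * (2 : ℝ) ^ j))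
    fun ξ hξ => ?_
  by_contra hne
  exact hξ (mem_closedBall_zero_iff.mpr (hχ.lpSym_ne_zero hne).2)

theorem schwartz_decay {V : Type*} [NormedAddCommGroup V] [NormedSpace ℝ V]
    (f : SchwartzMap V ℂ) (k : ℕ) : ∃ C : ℝ, 0 ≤ C ∧ ∀ x, (1 + ‖x‖) ^ k * ‖f x‖ ≤ C := by
  refine ⟨_, ?_, fun x => by
    simpa using SchwartzMap.one_add_le_sup_seminorm_apply (𝕜 := ℝ) (m := (k, 0)) le_rfl le_rfl f x⟩
  positivity

end LittlewoodPaley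

section LittlewoodPaley

variable {n : ℕ} {χ : ℝ → ℝ}

theorem fourierInv_mul_fourier_eq_conv {m f : Eucl n → ℂ} (hm : Integrable m) (hf : Integrable f)
    (x : Eucl n) : 𝓕⁻ (fun ξ => m ξ * 𝓕 f ξ) x = ∫ y, 𝓕⁻ m (x - y) * f y := by
  have hph : ∀ y ξ : Eucl n, phase 0 0 x ξ * starRingEnd ℂ (phase 0 0 y ξ)
      = phase 0 0 (x - y) ξ := by
    intro y ξ
    simp only [phase, ← Complex.exp_conj, map_mul, Complex.conj_ofReal, Complex.conj_I]
    rw [← Complex.exp_add, inner_sub_right]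
    congr 1
    push_cast
    ring
  have hc : Continuous fun z : Eucl n × Eucl n => phase 0 0 (x - z.2) z.1 :=
    (continuous_phase 0).comp (f := fun z : Eucl n × Eucl n => ((0 : ℝ), x - z.2, z.1))
      (by fun_prop)
  calc 𝓕⁻ (fun ξ => m ξ * 𝓕 f ξ) x
      = ∫ ξ, ∫ y, phase 0 0 (x - y) ξ * (m ξ * f y) := by
        rw [fourierInv_eq_integral_phase 0]
        refine integral_congr_ae (Eventually.of_forall fun ξ => ?_)
        simp only
        rw [fourier_eq_integral_phase 0, ← integral_const_mul, ← integral_const_mul]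
        refine integral_congr_ae (Eventually.of_forall fun y => ?_)
        simp only
        rw [← hph]
        ring
    _ = ∫ y, ∫ ξ, phase 0 0 (x - y) ξ * (m ξ * f y) := by
        refine integral_integral_swap ?_
        exact (hm.mul_prod hf).bdd_mul (c := 1) hc.aestronglyMeasurable
          (Eventually.of_forall fun z => (norm_phase _ _ _ _).le)
    _ = _ := by
        refine integral_congr_ae (Eventually.of_forall fun y => ?_)
        simp only
        rw [fourierInv_eq_integral_phase 0, ← integral_mul_const]
        refine integral_congr_ae (Eventually.of_forall fun ξ => ?_)
        simp only
        ring

theorem schwartz_norm_le_wgt (F : SchwartzMap (ℝ × Eucl n) ℂ) :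
    ∃ C : ℝ, 0 ≤ C ∧ ∀ s y, ‖F (s, y)‖ ≤ C * (1 + s ^ 2)⁻¹ * (wgt n y * wgt n y) := by
  obtain ⟨C, hC0, hC⟩ := schwartz_decay F (2 + (n + 1) * 2)
  refine ⟨C, hC0, fun s y => ?_⟩
  have hw : wgt n y = ((1 + ‖y‖) ^ (n + 1))⁻¹ := by
    rw [wgt, Real.rpow_neg (by positivity), ← Real.rpow_natCast]
    push_cast
    rfl
  have h1 : (1 + s ^ 2) * ((1 + ‖y‖) ^ (n + 1) * (1 + ‖y‖) ^ (n + 1))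
      ≤ (1 + ‖(s, y)‖) ^ (2 + (n + 1) * 2) := by
    have hs : |s| ≤ ‖(s, y)‖ := norm_fst_le (s, y)
    have hy : ‖y‖ ≤ ‖(s, y)‖ := norm_snd_le (s, y)
    rw [pow_add (1 + ‖(s, y)‖) 2, pow_mul, sq ((1 + ‖(s, y)‖) ^ (n + 1))]
    refine mul_le_mul ?_ ?_ (by positivity) (by positivity)
    · nlinarith [sq_abs s, abs_nonneg s]
    · gcongr
  rw [hw, ← mul_inv, mul_assoc, ← mul_inv, ← div_eq_mul_inv, le_div_iff₀ (by positivity)]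
  calc _ ≤ ‖F (s, y)‖ * (1 + ‖(s, y)‖) ^ (2 + (n + 1) * 2) := by gcongr
    _ ≤ C := by rw [mul_comm]; exact hC _

theorem wgt_sub_mul_wgt_le (x y : Eucl n) : wgt n (x - y) * wgt n y ≤ wgt n x := by
  rw [wgt, wgt, wgt, ← Real.mul_rpow (by positivity) (by positivity)]
  refine Real.rpow_le_rpow_of_nonpos (by positivity) ?_ (by linarith [n.cast_nonneg (α := ℝ)])
  have := norm_add_le (x - y) y
  rw [sub_add_cancel] at this
  nlinarith [mul_nonneg (norm_nonneg (x - y)) (norm_nonneg y)]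

theorem IsBump.exists_kernel (hχ : IsBump χ) (j : ℤ) : Continuous (𝓕⁻ (lpSym n χ j)) ∧
    ∃ C : ℝ, 0 ≤ C ∧ ∀ z, ‖𝓕⁻ (lpSym n χ j) z‖ ≤ C * wgt n z := by
  set S : SchwartzMap (Eucl n) ℂ := (hχ.hasCompactSupport_lpSym j).toSchwartzMap
    (hχ.contDiff_lpSym j) with hS
  have hK : ((𝓕⁻ S : SchwartzMap (Eucl n) ℂ) : Eucl n → ℂ) = 𝓕⁻ (lpSym n χ j) :=
    SchwartzMap.fourierInv_coe S
  rw [← hK]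
  refine ⟨SchwartzMap.continuous _, ?_⟩
  obtain ⟨C, hC0, hC⟩ := schwartz_decay (𝓕⁻ S) (n + 1)
  refine ⟨C, hC0, fun z => ?_⟩
  rw [wgt, Real.rpow_neg (by positivity), ← div_eq_mul_inv, le_div_iff₀ (by positivity), mul_comm]
  have := hC z
  rw [← Real.rpow_natCast] at this
  exact_mod_cast this

theorem projT_eq_mul (χ : ℝ → ℝ) (j : ℤ) (u : ℝ × Eucl n → ℂ) (s : ℝ) :
    (fun x => projT χ j u (s, x)) = 𝓕⁻ (fun ξ => lpSym n χ j ξ * 𝓕 (fun y => u (s, y)) ξ) := rfl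

theorem IsBump.integrable_lpSym (hχ : IsBump χ) (j : ℤ) : Integrable (lpSym n χ j) :=
  (hχ.contDiff_lpSym j).continuous.integrable_of_hasCompactSupport (hχ.hasCompactSupport_lpSym j)

theorem schwartz_slice_integrable (F : SchwartzMap (ℝ × Eucl n) ℂ) (s : ℝ) :
    Integrable fun y => F (s, y) := by
  obtain ⟨C, hC0, hC⟩ := schwartz_norm_le_wgt F
  refine (integrable_wgt.const_mul (C * (1 + s ^ 2)⁻¹)).mono'
    (F.continuous.comp (f := fun y => (s, y)) (by fun_prop)).aestronglyMeasurable
    (Eventually.of_forall fun y => (hC s y).trans ?_)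
  exact mul_le_mul_of_nonneg_left (mul_le_of_le_one_left (wgt_nonneg n y) (wgt_le_one n y))
    (by positivity)

theorem IsBump.projT_eq_conv (hχ : IsBump χ) (j : ℤ) (F : SchwartzMap (ℝ × Eucl n) ℂ) (s : ℝ)
    (x : Eucl n) : projT χ j (fun p => F p) (s, x)
      = ∫ y, 𝓕⁻ (lpSym n χ j) (x - y) * F (s, y) :=
  fourierInv_mul_fourier_eq_conv (hχ.integrable_lpSym j) (schwartz_slice_integrable F s) x

theorem IsBump.isDec_projT (hχ : IsBump χ) (j : ℤ) (F : SchwartzMap (ℝ × Eucl n) ℂ) :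
    IsDec (projT χ j (fun p => F p)) := by
  obtain ⟨hKc, C₁, hC₁, hK⟩ := hχ.exists_kernel (n := n) j
  obtain ⟨C₂, hC₂, hF⟩ := schwartz_norm_le_wgt F
  constructor
  · have : projT χ j (fun p => F p)
        = fun z : ℝ × Eucl n => ∫ y, 𝓕⁻ (lpSym n χ j) (z.2 - y) * F (z.1, y) :=
      funext fun z => hχ.projT_eq_conv j F z.1 z.2
    rw [this]
    refine measurable_integral_right (Continuous.measurable ?_)
    exact (hKc.comp (f := fun w : (ℝ × Eucl n) × Eucl n => w.1.2 - w.2) (by fun_prop)).mul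
      (F.continuous.comp (f := fun w : (ℝ × Eucl n) × Eucl n => (w.1.1, w.2)) (by fun_prop))
  · refine ⟨C₁ * C₂ * ∫ y : Eucl n, wgt n y, mul_nonneg (mul_nonneg hC₁ hC₂)
      (integral_nonneg fun y => wgt_nonneg n y), fun s x => ?_⟩
    rw [hχ.projT_eq_conv]
    refine (norm_integral_le_of_norm_le
      (integrable_wgt.const_mul (C₁ * C₂ * (1 + s ^ 2)⁻¹ * wgt n x))
      (Eventually.of_forall fun y => ?_)).trans_eq ?_
    · rw [norm_mul]
      calc _ ≤ C₁ * wgt n (x - y) * (C₂ * (1 + s ^ 2)⁻¹ * (wgt n y * wgt n y)) :=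
            mul_le_mul (hK _) (hF s y) (norm_nonneg _) (mul_nonneg hC₁ (wgt_nonneg _ _))
        _ = C₁ * C₂ * (1 + s ^ 2)⁻¹ * (wgt n (x - y) * wgt n y) * wgt n y := by ring
        _ ≤ _ := by
            gcongr
            · exact wgt_nonneg _ _
            · exact wgt_sub_mul_wgt_le x y
    · rw [integral_const_mul]
      ring

theorem IsBump.fourier_projT_ne_zero (hχ : IsBump χ) (j : ℤ) (F : SchwartzMap (ℝ × Eucl n) ℂ)
    (s : ℝ) (ξ : Eucl n) (h : 𝓕 (fun y => projT χ j (fun p => F p) (s, y)) ξ ≠ 0) :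
    (2 : ℝ) ^ j / 2 ≤ ‖ξ‖ ∧ ‖ξ‖ ≤ 2 * (2 : ℝ) ^ j := by
  have hG := (hχ.isDec_projT j F).integrable_slice s
  have hc := continuous_fourier_of_integrable (schwartz_slice_integrable F s)
  rw [projT_eq_mul] at h hG
  have hmc : Continuous fun η => lpSym n χ j η * 𝓕 (fun y => F (s, y)) η :=
    (hχ.contDiff_lpSym j).continuous.mul hc
  have hmi : Integrable fun η => lpSym n χ j η * 𝓕 (fun y => F (s, y)) η :=
    hmc.integrable_of_hasCompactSupport (hχ.hasCompactSupport_lpSym j).mul_right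
  rw [show 𝓕 (𝓕⁻ fun η => lpSym n χ j η * 𝓕 (fun y => F (s, y)) η)
    = fun η => lpSym n χ j η * 𝓕 (fun y => F (s, y)) η from ?_] at h
  · exact hχ.lpSym_ne_zero (left_ne_zero_of_mul h)
  · refine hmc.fourier_fourierInv_eq hmi ?_
    have h0 := hG.comp_neg
    refine h0.congr (Eventually.of_forall fun y => ?_)
    simp only
    rw [Real.fourierInv_eq_fourier_neg, neg_neg]

theorem ofReal_rpow_half_eq (hn : 0 < n) (j : ℤ) :
    ENNReal.ofReal (2 * Real.pi / ((2 : ℝ) ^ j / 2 / √n)) ^ ((1 : ℝ) / 2)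
      = ENNReal.ofReal ((4 * Real.pi * √n) ^ ((1 : ℝ) / 2)) * tp (-(j : ℝ) / 2) := by
  have hs : 0 < √(n : ℝ) := Real.sqrt_pos.mpr (by exact_mod_cast hn)
  have h1 : 2 * Real.pi / ((2 : ℝ) ^ j / 2 / √n) = (4 * Real.pi * √n) * (2 : ℝ) ^ (-(j : ℝ)) := by
    rw [Real.rpow_neg (by norm_num), Real.rpow_intCast]
    field_simp
    ring
  rw [h1, ENNReal.ofReal_rpow_of_nonneg (by positivity) (by norm_num),
    Real.mul_rpow (by positivity) (by positivity), ← Real.rpow_mul (by norm_num),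
    ENNReal.ofReal_mul (by positivity), tp]
  congr 3
  ring

end LittlewoodPaley

end DNLS

/-- `‖∫_0^t W_±(t-s)P_jF(s)ds‖_{L^q_tL^r_x}
≤ C 2^{-j/2} sup_e ‖P_j F‖_{L^{1,2}_e}` for admissible `(q,r)` with `q,r > 2`. -/
theorem duhamel_strichartz_from_N
    (n : ℕ) (hn : 2 ≤ n) (ε : Fin n → ℝ) (hε : ∀ i, ε i = 1 ∨ ε i = -1)
    (χ : ℝ → ℝ) (hχ : IsBump χ)
    (q r : ℝ) (hadm : Admissible n q r) (hq : 2 < q) (hr : 2 < r) :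
    ∃ C : ℝ, 0 < C ∧ ∀ (F : SchwartzMap (ℝ × Eucl n) ℂ) (j : ℤ),
      mixNorm (ENNReal.ofReal q) (ENNReal.ofReal r)
        (duhamel ε (projT χ j (fun q' => F q')))
      ≤ ENNReal.ofReal C * tp (-(j : ℝ) / 2) *
          sphSup (fun e => aniNorm 1 2 e (projT χ j (fun q' => F q'))) := by
  have hn0 : 0 < n := by omega
  obtain ⟨C, hC, hmain⟩ := exists_duhamel_const hn0 hε hq hr hadm.1
  set B : ℝ := (4 * Real.pi * √n) ^ ((1 : ℝ) / 2) with hB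
  have hB0 : 0 ≤ B := by positivity
  refine ⟨C.toReal * B + 1, by positivity, fun F j => ?_⟩
  refine (hmain ((2 : ℝ) ^ j / 2) (2 * (2 : ℝ) ^ j) (by positivity) _ (hχ.isDec_projT j F)
    (hχ.fourier_projT_ne_zero j F)).trans ?_
  rw [ofReal_rpow_half_eq hn0, ← mul_assoc]
  gcongr
  rw [← hB]
  calc C * ENNReal.ofReal B = ENNReal.ofReal (C.toReal * B) := by
        rw [ENNReal.ofReal_mul ENNReal.toReal_nonneg, ENNReal.ofReal_toReal hC]
    _ ≤ _ := ENNReal.ofReal_le_ofReal (by linarith)
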